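/- Assume the Riemann Hypothesis, i.e. every zero ρ of ζ with 0 < Re(ρ) < 1 has Re(ρ) = 1/2 (so β_{ζ,0} = 1/2). Then there exists a constant c > 0 such that the limiting logarithmic distribution μ_ζ of E_ζ satisfies μ_ζ(ℝ ∖ [−A, A]) ≫ exp(−exp(cA)) for all sufficiently large A. In particular, 0 < liminf_{Y→∞} (1/Y) ∫₂^Y 1_{E_ζ(e^y) ≥ 0} dy ≤ limsup_{Y→∞} (1/Y) ∫₂^Y 1_{E_ζ(e^y) ≥ 0} dy < 1. -/

import Mathlib

open MeasureTheory Filter Topology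

noncomputable section

/-- `F : ℝ → ℝ` admits the Borel probability measure `μ` as limiting logarithmic
distribution: for every bounded Lipschitz `g : ℝ → ℝ`,
`(1/Y) ∫₂^Y g(F(e^y)) dy → ∫ g dμ` as `Y → ∞`. -/
def HasLimitingLogDistribution (F : ℝ → ℝ) (μ : Measure ℝ) : Prop :=
  IsProbabilityMeasure μ ∧
  ∀ g : ℝ → ℝ, (∃ C, LipschitzWith C g) → (∃ B, ∀ x, |g x| ≤ B) →
    Tendsto (fun Y : ℝ => (1 / Y) * ∫ y in (2:ℝ)..Y, g (F (Real.exp y)))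
      atTop (𝓝 (∫ t, g t ∂μ))

/-- The number of primes `≤ x`. -/
def primeCount (x : ℝ) : ℕ := ((Finset.range (⌊x⌋₊ + 1)).filter Nat.Prime).card

/-- The logarithmic integral `Li(x) = ∫₂^x dt / log t`. -/
def Li (x : ℝ) : ℝ := ∫ t in (2:ℝ)..x, 1 / Real.log t

/-- `β_{ζ,0}`: the supremum of the real parts of the zeros of `ζ` in the critical strip. -/
def betaZeta : ℝ :=
  sSup {b : ℝ | ∃ ρ : ℂ, riemannZeta ρ = 0 ∧ 0 < ρ.re ∧ ρ.re < 1 ∧ ρ.re = b}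

/-- `E_ζ(x) = (log x / x^{β_{ζ,0}}) (π(x) − Li(x))`. -/
def Ezeta (x : ℝ) : ℝ := (Real.log x / x ^ betaZeta) * ((primeCount x : ℝ) - Li x)

namespace RS

/-- fractional part on `(1,∞)`. -/
def fr : ℝ → ℂ := Set.indicator (Set.Ioi 1) (fun t => ((Int.fract t : ℝ) : ℂ))

lemma fr_meas : Measurable fr := by
  unfold fr
  exact (Complex.measurable_ofReal.comp measurable_fract).indicator measurableSet_Ioi

lemma fr_bdd (t : ℝ) : ‖fr t‖ ≤ 1 := by
  unfold fr
  refine (norm_indicator_le_norm_self _ _).trans ?_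
  rw [Complex.norm_real, Real.norm_eq_abs, abs_of_nonneg (Int.fract_nonneg _)]
  exact (Int.fract_lt_one _).le

lemma fr_mellin_diff {s : ℂ} (hs : s.re < 0) : DifferentiableAt ℂ (mellin fr) s := by
  refine mellin_differentiableAt_of_isBigO_rpow (a := 0) (b := s.re - 1) ?_ ?_ hs ?_ (by linarith)
  · refine (LocallyIntegrable.locallyIntegrableOn ?_ _)
    refine (locallyIntegrable_const (1:ℝ)).mono fr_meas.aestronglyMeasurable ?_
    filter_upwards with t
    simpa using fr_bdd t
  · simp only [neg_zero, Real.rpow_zero]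
    refine Asymptotics.IsBigO.of_bound 1 ?_
    filter_upwards with t
    simpa using fr_bdd t
  · refine Asymptotics.IsBigO.of_bound 1 ?_
    have : Set.Iio (1:ℝ) ∈ 𝓝[>] (0:ℝ) := mem_nhdsWithin_of_mem_nhds (Iio_mem_nhds one_pos)
    filter_upwards [this] with t ht
    have : fr t = 0 := by
      unfold fr; rw [Set.indicator_of_notMem]; simpa using ht.le
    rw [this]; simp

lemma mellin_fr (s : ℂ) : mellin fr (-s) =
    ∫ t in Set.Ioi (1:ℝ), ((Int.fract t : ℝ) : ℂ) * (t:ℂ) ^ (-(s+1)) := by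
  unfold mellin
  have : ∀ t : ℝ, (t:ℂ) ^ (-s - 1) • fr t = Set.indicator (Set.Ioi 1)
      (fun t : ℝ => ((Int.fract t : ℝ) : ℂ) * (t:ℂ) ^ (-(s+1))) t := by
    intro t
    unfold fr
    by_cases h : t ∈ Set.Ioi (1:ℝ)
    · simp only [Set.indicator_of_mem h, smul_eq_mul]; rw [mul_comm]; congr 2; ring
    · simp [Set.indicator_of_notMem h]
  simp_rw [this]
  rw [setIntegral_indicator measurableSet_Ioi]
  congr 2
  ext x; simp

lemma norm_mellin_fr {s : ℂ} (hs : 0 < s.re) : ‖mellin fr (-s)‖ ≤ 1 / s.re := by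
  rw [mellin_fr]
  have h1 : ∫ t in Set.Ioi (1:ℝ), t ^ (-(s.re+1)) = 1 / s.re := by
    rw [integral_Ioi_rpow_of_lt (by linarith) one_pos]
    simp
  rw [← h1]
  refine norm_integral_le_of_norm_le (integrableOn_Ioi_rpow_of_lt (by linarith) one_pos) ?_
  refine (ae_restrict_iff' measurableSet_Ioi).2 (Eventually.of_forall fun t ht => ?_)
  have ht0 : (0:ℝ) < t := lt_trans one_pos ht
  rw [norm_mul, Complex.norm_cpow_eq_rpow_re_of_pos ht0, Complex.norm_real, Real.norm_eq_abs,
    abs_of_nonneg (Int.fract_nonneg _)]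
  have : (-(s+1)).re = -(s.re+1) := by simp
  rw [this]
  calc _ ≤ 1 * t ^ (-(s.re+1)) := by
        gcongr; exact (Int.fract_lt_one _).le
    _ = _ := one_mul _

lemma zeta1_eq_of_ne {s : ℂ} (hs : s ≠ 1) : riemannZeta₁ s = (s - 1) * riemannZeta s := by
  rw [riemannZeta_eq_inv_sub_mul hs, mul_inv_cancel_left₀ (sub_ne_zero.2 hs)]

lemma zeta1_of_one_lt {s : ℂ} (hs : 1 < s.re) :
    riemannZeta₁ s = s - s * (s - 1) * mellin fr (-s) := by
  have hs1 : s ≠ 1 := by rintro rfl; simp at hs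
  have hs1' : s - 1 ≠ 0 := sub_ne_zero.2 hs1
  have hL := LSeries_eq_mul_integral_of_nonneg (fun _ => (1:ℝ)) zero_le_one hs ?_ (by simp)
  swap
  · simp only [Finset.sum_const, Nat.card_Icc, Real.rpow_one]
    refine Asymptotics.IsBigO.of_bound 1 ?_
    filter_upwards with n
    simp
  have hz : riemannZeta s = LSeries (fun _ => ((1:ℝ):ℂ)) s := by
    have := LSeries_one_eq_riemannZeta hs
    rw [← this]; congr 1
  rw [zeta1_eq_of_ne hs1, hz, hL, mellin_fr]
  have hi : ∫ t in Set.Ioi (1:ℝ), (t:ℂ) ^ (-s) = 1 / (s - 1) := by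
    rw [integral_Ioi_cpow_of_lt (by simpa using hs) one_pos]
    simp
    rw [show -s + 1 = -(s-1) by ring, div_neg, neg_div, neg_neg, one_div]
  have hIntg1 : IntegrableOn (fun t : ℝ => (t:ℂ) ^ (-s)) (Set.Ioi 1) :=
    integrableOn_Ioi_cpow_of_lt (by simpa using hs) one_pos
  have hIntg2 : IntegrableOn (fun t : ℝ => ((Int.fract t : ℝ) : ℂ) * (t:ℂ) ^ (-(s+1))) (Set.Ioi 1) := by
    have : IntegrableOn (fun t : ℝ => (t:ℂ) ^ (-(s+1))) (Set.Ioi 1) :=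
      integrableOn_Ioi_cpow_of_lt (by simp; linarith) one_pos
    refine Integrable.bdd_mul (c := 1) this ?_ ?_
    · exact (Complex.measurable_ofReal.comp measurable_fract).aestronglyMeasurable
    · filter_upwards with t
      rw [Complex.norm_real, Real.norm_eq_abs, abs_of_nonneg (Int.fract_nonneg _)]
      exact (Int.fract_lt_one _).le
  have : ∫ t in Set.Ioi (1:ℝ), (∑ k ∈ Finset.Icc 1 ⌊t⌋₊, ((1:ℝ) : ℂ)) * (t:ℂ) ^ (-(s + 1)) =
      (∫ t in Set.Ioi (1:ℝ), (t:ℂ) ^ (-s)) -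
      ∫ t in Set.Ioi (1:ℝ), ((Int.fract t : ℝ) : ℂ) * (t:ℂ) ^ (-(s+1)) := by
    rw [← integral_sub hIntg1 hIntg2]
    refine setIntegral_congr_fun measurableSet_Ioi fun t ht => ?_
    have ht0 : (0:ℝ) < t := lt_trans one_pos ht
    have htc : (t:ℂ) ≠ 0 := by exact_mod_cast ht0.ne'
    have e1 : (t:ℂ) ^ (-s) = t * (t:ℂ) ^ (-(s+1)) := by
      rw [show -s = 1 + (-(s+1)) by ring, Complex.cpow_add _ _ htc, Complex.cpow_one]
    have e2 : ((Int.fract t : ℝ):ℂ) = t - (⌊t⌋₊:ℂ) := by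
      have : Int.fract t = t - (⌊t⌋₊:ℝ) := by
        rw [natCast_floor_eq_intCast_floor ht0.le]; rfl
      rw [this]; push_cast; ring
    simp only [e1, e2]
    simp
    ring
  rw [this, hi]
  field_simp

lemma zeta1_eq {s : ℂ} (hs : 0 < s.re) :
    riemannZeta₁ s = s - s * (s - 1) * mellin fr (-s) := by
  have hU : IsOpen {s : ℂ | 0 < s.re} := isOpen_lt continuous_const Complex.continuous_re
  have hc : IsPreconnected {s : ℂ | 0 < s.re} := (convex_halfSpace_re_gt 0).isPreconnected
  have ha : AnalyticOnNhd ℂ riemannZeta₁ {s : ℂ | 0 < s.re} :=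
    fun z _ => differentiable_riemannZeta₁.analyticAt z
  have hb : AnalyticOnNhd ℂ (fun s => s - s * (s - 1) * mellin fr (-s)) {s : ℂ | 0 < s.re} := by
    refine DifferentiableOn.analyticOnNhd (fun z hz => ?_) hU
    have : DifferentiableAt ℂ (fun s => mellin fr (-s)) z := by
      have h1 : DifferentiableAt ℂ (mellin fr) (-z) := fr_mellin_diff (by simpa using hz)
      exact DifferentiableAt.fun_comp' (g := mellin fr) (f := fun s => -s) z h1 (by fun_prop)
    exact DifferentiableAt.differentiableWithinAt (by fun_prop)
  refine ha.eqOn_of_preconnected_of_eventuallyEq hb hc (z₀ := 2) (by simp) ?_ hs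
  have : {s : ℂ | 1 < s.re} ∈ 𝓝 (2:ℂ) :=
    (isOpen_lt continuous_const Complex.continuous_re).mem_nhds (by simp)
  filter_upwards [this] with z hz using zeta1_of_one_lt hz

lemma norm_zeta1_le {s : ℂ} (hs : 0 < s.re) :
    ‖riemannZeta₁ s‖ ≤ ‖s‖ + ‖s‖ * (‖s‖ + 1) * (1 / s.re) := by
  rw [zeta1_eq hs]
  refine (norm_sub_le _ _).trans ?_
  rw [norm_mul, norm_mul]
  gcongr
  · exact (norm_sub_le _ _).trans (by simp)
  · exact norm_mellin_fr hs

lemma zeta1_conj (s : ℂ) : riemannZeta₁ ((starRingEnd ℂ) s) = (starRingEnd ℂ) (riemannZeta₁ s) := by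
  by_cases h : s = 1
  · subst h; simp
  · have : (starRingEnd ℂ) s ≠ 1 := by
      intro h'; apply h; have := congrArg (starRingEnd ℂ) h'; simpa using this
    rw [zeta1_eq_of_ne h, zeta1_eq_of_ne this, riemannZeta_conj]; simp

/-- lower bound on the line `Re s = 2`. -/
lemma norm_zeta1_two_ge (T : ℝ) : 1/4 ≤ ‖riemannZeta₁ (2 + T * Complex.I)‖ := by
  set s : ℂ := 2 + T * Complex.I with hs
  have hre : s.re = 2 := by simp [hs]
  have hs1 : s ≠ 1 := by intro h; rw [h] at hre; norm_num at hre
  rw [zeta1_eq_of_ne hs1, norm_mul]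
  have h1 : 1 ≤ ‖s - 1‖ := by
    have := Complex.abs_re_le_norm (s-1)
    simp [hre] at this; norm_num at this; exact this
  have h2 : 1/4 ≤ ‖riemannZeta s‖ := by
    have hz := zeta_eq_tsum_one_div_nat_add_one_cpow (s := s) (by rw [hre]; norm_num)
    have hsumm : Summable (fun n : ℕ => 1 / ((n:ℝ) + 1) ^ (2:ℕ)) := by
      have := (summable_nat_add_iff 1).mpr (Real.summable_one_div_nat_pow (p := 2) |>.2 (by norm_num))
      simpa using this
    have hterm : ∀ n : ℕ, ‖1 / ((n:ℂ) + 1) ^ s‖ = 1 / ((n:ℝ) + 1) ^ (2:ℕ) := by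
      intro n
      rw [norm_div, norm_one]
      congr 1
      have : ((n:ℂ)+1) = ((n+1 : ℝ) : ℂ) := by push_cast; ring
      rw [this, Complex.norm_cpow_eq_rpow_re_of_pos (by positivity), hre]
      norm_cast
    have hsummc : Summable (fun n : ℕ => 1 / ((n:ℂ) + 1) ^ s) := by
      apply Summable.of_norm
      simpa only [hterm] using hsumm
    have hs2 : ∑' n : ℕ, 1 / ((n:ℝ) + 1) ^ (2:ℕ) = Real.pi^2/6 := by
      have h := hasSum_zeta_two
      have := (hasSum_nat_add_iff' 1).2 h
      simp at this
      simpa using this.tsum_eq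
    rw [hsummc.tsum_eq_zero_add] at hz
    rw [hsumm.tsum_eq_zero_add] at hs2
    have hA : ‖∑' n : ℕ, 1 / (((n+1:ℕ):ℂ) + 1) ^ s‖ ≤ Real.pi^2/6 - 1 := by
      have : ‖∑' n : ℕ, 1 / (((n+1:ℕ):ℂ) + 1) ^ s‖ ≤ ∑' n : ℕ, 1 / (((n+1:ℕ):ℝ) + 1) ^ (2:ℕ) := by
        apply tsum_of_norm_bounded ((summable_nat_add_iff 1).2 hsumm).hasSum
        intro n; rw [hterm]
      simp at hs2 this ⊢
      linarith
    have hpi : Real.pi^2/6 - 1 ≤ 3/4 := by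
      have := Real.pi_lt_d2
      have := Real.pi_pos
      nlinarith
    rw [hz]
    simp only [Nat.cast_zero, zero_add, Complex.one_cpow, div_one]
    have := norm_sub_norm_le (1:ℂ) (-(∑' n : ℕ, 1 / (((n+1:ℕ):ℂ) + 1) ^ s))
    rw [norm_neg, sub_neg_eq_add, norm_one] at this
    linarith
  nlinarith [norm_nonneg (riemannZeta s)]

end RS

namespace RS

lemma order_ne_top {F : ℂ → ℂ} (hF : Differentiable ℂ F) (hne : ∃ c, F c ≠ 0) (a : ℂ) :
    analyticOrderAt F a ≠ ⊤ := by
  obtain ⟨c, hc⟩ := hne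
  have hA : AnalyticOnNhd ℂ F Set.univ := fun z _ => hF.analyticAt z
  refine hA.analyticOrderAt_ne_top_of_isPreconnected isPreconnected_univ (Set.mem_univ c)
    (Set.mem_univ a) ?_
  have : analyticOrderAt F c = 0 := (hF.analyticAt c).analyticOrderAt_eq_zero.2 hc
  simp [this]

lemma factor_one {F : ℂ → ℂ} (hF : Differentiable ℂ F) (hne : ∃ c, F c ≠ 0) (a : ℂ) :
    ∃ g : ℂ → ℂ, Differentiable ℂ g ∧ (∀ s, F s = (s - a) ^ analyticOrderNatAt F a * g s) ∧
      g a ≠ 0 := by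
  set n := analyticOrderNatAt F a with hn
  obtain ⟨h, hh, h0, heq⟩ := ((hF.analyticAt a).analyticOrderNatAt_eq_iff
    (order_ne_top hF hne a)).1 hn.symm
  classical
  let g : ℂ → ℂ := fun s => if s = a then h a else F s / (s - a) ^ n
  have hgh : g =ᶠ[𝓝 a] h := by
    filter_upwards [heq] with z hz
    by_cases hza : z = a
    · simp [g, hza]
    · have : z - a ≠ 0 := sub_ne_zero.2 hza
      simp only [g, hza, if_false]
      rw [hz, smul_eq_mul]; field_simp
  refine ⟨g, ?_, ?_, ?_⟩
  · intro s
    by_cases hs : s = a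
    · subst hs
      exact (hh.differentiableAt).congr_of_eventuallyEq hgh
    · have : g =ᶠ[𝓝 s] fun s => F s / (s - a) ^ n := by
        filter_upwards [isOpen_ne.mem_nhds hs] with z hz
        have : z ≠ a := hz
        simp [g, this]
      refine DifferentiableAt.congr_of_eventuallyEq ?_ this
      have : (s - a) ^ n ≠ 0 := pow_ne_zero _ (sub_ne_zero.2 hs)
      exact (hF s).fun_div (by fun_prop) this
  · intro s
    by_cases hs : s = a
    · subst hs
      have := heq.self_of_nhds
      rw [this]; simp [g]
    · have : (s - a) ^ n ≠ 0 := pow_ne_zero _ (sub_ne_zero.2 hs)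
      simp only [g, hs, if_false]; field_simp
  · simp [g, h0]

lemma factor {F : ℂ → ℂ} (hF : Differentiable ℂ F) (hne : ∃ c, F c ≠ 0) (S : Finset ℂ) :
    ∃ g : ℂ → ℂ, Differentiable ℂ g ∧
      (∀ s, F s = (∏ ρ ∈ S, (s - ρ) ^ analyticOrderNatAt F ρ) * g s) ∧
      ∀ ρ ∈ S, g ρ ≠ 0 := by
  classical
  induction S using Finset.induction_on with
  | empty => exact ⟨F, hF, by simp, by simp⟩
  | insert a S ha ih =>
    obtain ⟨g, hg, hFg, hgS⟩ := ih
    have hgne : ∃ c, g c ≠ 0 := by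
      obtain ⟨c, hc⟩ := hne
      exact ⟨c, fun h => hc (by rw [hFg, h, mul_zero])⟩
    obtain ⟨h, hh, hgh, hha⟩ := factor_one hg hgne a
    have hord : analyticOrderNatAt F a = analyticOrderNatAt g a := by
      have hPd : Differentiable ℂ (fun s : ℂ => ∏ ρ ∈ S, (s - ρ) ^ analyticOrderNatAt F ρ) := by
        fun_prop
      have e : F = (fun s : ℂ => ∏ ρ ∈ S, (s - ρ) ^ analyticOrderNatAt F ρ) * g := by
        ext s; exact hFg s
      have hP0 : analyticOrderAt (fun s : ℂ => ∏ ρ ∈ S, (s - ρ) ^ analyticOrderNatAt F ρ) a = 0 := by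
        refine (hPd.analyticAt a).analyticOrderAt_eq_zero.2 ?_
        refine Finset.prod_ne_zero_iff.2 fun ρ hρ => pow_ne_zero _ (sub_ne_zero.2 ?_)
        rintro rfl; exact ha hρ
      have : analyticOrderAt F a = analyticOrderAt g a := by
        conv_lhs => rw [e]
        rw [analyticOrderAt_mul (hPd.analyticAt a) (hg.analyticAt a), hP0, zero_add]
      simp [analyticOrderNatAt, this]
    refine ⟨h, hh, ?_, ?_⟩
    · intro s
      rw [Finset.prod_insert ha, hFg s, hgh s, hord]; ring
    · intro ρ hρ
      rcases Finset.mem_insert.1 hρ with rfl | hρ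
      · exact hha
      · intro h0
        exact hgS ρ hρ (by rw [hgh, h0, mul_zero])

lemma max_mod {f : ℂ → ℂ} (hf : Differentiable ℂ f) {c : ℂ} {R M : ℝ} (hR : 0 < R)
    (hM : ∀ z, ‖z - c‖ = R → ‖f z‖ ≤ M) {s : ℂ} (hs : ‖s - c‖ ≤ R) : ‖f s‖ ≤ M := by
  refine Complex.norm_le_of_forall_mem_frontier_norm_le (U := Metric.ball c R) Metric.isBounded_ball
    hf.diffContOnCl ?_ ?_
  · intro z hz
    rw [frontier_ball c hR.ne', mem_sphere_iff_norm] at hz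
    exact hM z hz
  · rw [closure_ball c hR.ne', mem_closedBall_iff_norm]; exact hs

/-- Jensen-type bound. -/
lemma jensen {F : ℂ → ℂ} (hF : Differentiable ℂ F) {c : ℂ} (hc : F c ≠ 0) (S : Finset ℂ)
    {r R M : ℝ} (hr : 0 < r) (hrR : r < R) (hS : ∀ ρ ∈ S, ‖ρ - c‖ ≤ r)
    (hM : ∀ z, ‖z - c‖ = R → ‖F z‖ ≤ M) :
    (R / r) ^ (∑ ρ ∈ S, analyticOrderNatAt F ρ) * ‖F c‖ ≤ M := by
  have hR : 0 < R := hr.trans hrR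
  obtain ⟨g, hg, hFg, -⟩ := factor hF ⟨c, hc⟩ S
  let B : ℂ → ℂ := fun s => ∏ ρ ∈ S,
    (((R:ℂ) ^ 2 - (starRingEnd ℂ) (ρ - c) * (s - c)) / R) ^ analyticOrderNatAt F ρ
  have hB : Differentiable ℂ B := by
    intro s; simp only [B]; fun_prop
  have key : ∀ z, ‖z - c‖ = R → ‖B z * g z‖ ≤ M := by
    intro z hz
    refine le_trans (le_of_eq ?_) (hM z hz)
    rw [hFg z, norm_mul, norm_mul]
    congr 1
    simp only [B, norm_prod, norm_pow]
    refine Finset.prod_congr rfl fun ρ _ => ?_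
    congr 1
    have h1 : (R:ℂ) ^ 2 = (starRingEnd ℂ) (z - c) * (z - c) := by
      rw [← Complex.normSq_eq_conj_mul_self, Complex.normSq_eq_norm_sq, hz]; push_cast; rfl
    rw [h1, ← sub_mul, ← map_sub, norm_div, norm_mul, RCLike.norm_conj, hz]
    simp only [Complex.norm_real, Real.norm_eq_abs, abs_of_pos hR]
    field_simp
    congr 1; ring
  have h2 := max_mod (hB.mul hg) hR key (s := c) (by simp [hR.le])
  have hBc : ‖B c‖ = R ^ (∑ ρ ∈ S, analyticOrderNatAt F ρ) := by
    simp only [B, sub_self, mul_zero, sub_zero, norm_prod, norm_pow]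
    rw [← Finset.prod_pow_eq_pow_sum]
    refine Finset.prod_congr rfl fun ρ _ => ?_
    congr 1
    rw [norm_div, norm_pow]; simp [abs_of_pos hR]; field_simp
  have hFc : ‖F c‖ ≤ r ^ (∑ ρ ∈ S, analyticOrderNatAt F ρ) * ‖g c‖ := by
    rw [hFg c, norm_mul, ← Finset.prod_pow_eq_pow_sum, norm_prod]
    gcongr with ρ hρ
    rw [norm_pow]
    gcongr
    rw [norm_sub_rev]; exact hS ρ hρ
  simp only [Pi.mul_apply, norm_mul, hBc] at h2
  refine le_trans ?_ h2
  calc _ ≤ (R / r) ^ (∑ ρ ∈ S, analyticOrderNatAt F ρ) *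
        (r ^ (∑ ρ ∈ S, analyticOrderNatAt F ρ) * ‖g c‖) := by gcongr
    _ = _ := by rw [← mul_assoc, ← mul_pow]; congr 2; field_simp

/-- Log-derivative bound. -/
lemma logDeriv_bound {G : ℂ → ℂ} (hG : Differentiable ℂ G) {c : ℂ} {r R K : ℝ} (hr : 0 < r)
    (hrR : r < R) (h0 : ∀ z, ‖z - c‖ < R → G z ≠ 0) (hK : 1 < K)
    (hM : ∀ z, ‖z - c‖ < R → ‖G z‖ ≤ K * ‖G c‖) {s : ℂ} (hs : ‖s - c‖ ≤ r) :
    ‖deriv G s / G s‖ ≤ 16 * R / (R - r) ^ 2 * Real.log K := by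
  have hR : 0 < R := hr.trans hrR
  have hdl : DifferentiableOn ℂ (fun z => deriv G z / G z) (Metric.ball c R) := by
    intro z hz
    refine DifferentiableAt.differentiableWithinAt ?_
    have : DifferentiableAt ℂ (deriv G) z := (hG.analyticAt z).deriv.differentiableAt
    exact this.fun_div (hG z) (h0 z (by simpa [dist_eq_norm] using hz))
  obtain ⟨p, hp⟩ := hdl.isExactOn_ball
  have hc0 : G c ≠ 0 := h0 c (by simp [hR])
  have hexp : ∀ z ∈ Metric.ball c R, G z = G c * Complex.exp (p z - p c) := by
    have hconv : Convex ℝ (Metric.ball c R) := convex_ball c R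
    have hconst : ∀ z ∈ Metric.ball c R, G z * Complex.exp (-(p z - p c)) = G c * Complex.exp (-(p c - p c)) := by
      intro z hz
      refine IsOpen.is_const_of_deriv_eq_zero (𝕜 := ℂ) Metric.isOpen_ball hconv.isPreconnected
        (f := fun z => G z * Complex.exp (-(p z - p c))) ?_ ?_ hz (Metric.mem_ball_self hR)
      · intro w hw
        have := hp w hw
        exact ((hG w).mul ((((this.differentiableAt).sub_const (p c)).neg).cexp)).differentiableWithinAt
      · intro w hw
        have h1 := (hG w).hasDerivAt.mul ((((hp w hw).sub_const (p c)).neg).cexp)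
        have h2 := h1.deriv
        refine h2.trans ?_
        have := h0 w (by simpa [dist_eq_norm] using hw)
        simp only [Pi.zero_apply, Pi.neg_apply, Pi.sub_apply]
        field_simp
        ring
    intro z hz
    have := hconst z hz
    rw [sub_self, neg_zero, Complex.exp_zero, mul_one] at this
    rw [← this, mul_assoc, ← Complex.exp_add]; simp
  -- Borel–Carathéodory
  let q : ℂ → ℂ := fun z => p (c + z) - p c
  have hlogK : 0 < Real.log K := Real.log_pos hK
  have hmem : ∀ z, z ∈ Metric.ball (0:ℂ) R → c + z ∈ Metric.ball c R := by
    intro z hz; simpa using hz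
  have hq : DifferentiableOn ℂ q (Metric.ball 0 R) := by
    intro z hz
    have := (hp (c+z) (hmem z hz)).differentiableAt
    refine DifferentiableAt.differentiableWithinAt ?_
    exact (DifferentiableAt.fun_comp' z this (by fun_prop)).sub_const _
  have hmap : Set.MapsTo q (Metric.ball 0 R) {z | z.re ≤ Real.log K} := by
    intro z hz
    have h1 := hM (c+z) (by simpa using hz)
    rw [hexp _ (hmem z hz), norm_mul, Complex.norm_exp, mul_comm] at h1
    have h2 := le_of_mul_le_mul_right h1 (norm_pos_iff.2 hc0)
    exact (Real.le_log_iff_exp_le (by linarith)).2 h2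
  have hbc : ∀ z ∈ Metric.ball (0:ℂ) R, ‖q z‖ ≤ 2 * Real.log K * ‖z‖ / (R - ‖z‖) := fun z hz =>
    Complex.borelCaratheodory_zero hlogK hq hmap hR hz (by simp [q])
  set δ := (R - r) / 2 with hδ
  have hδ0 : 0 < δ := by rw [hδ]; linarith
  have hsph : ∀ z ∈ Metric.sphere (s - c) δ, ‖q z‖ ≤ 2 * Real.log K * R / δ := by
    intro z hz
    rw [mem_sphere_iff_norm] at hz
    have h1 : ‖z‖ ≤ r + δ := by
      calc ‖z‖ = ‖(z - (s - c)) + (s - c)‖ := by congr 1; ring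
        _ ≤ δ + r := (norm_add_le _ _).trans (by rw [hz]; gcongr)
        _ = _ := add_comm _ _
    have h2 : z ∈ Metric.ball (0:ℂ) R := by simp; linarith
    refine (hbc z h2).trans ?_
    have : ‖z‖ ≤ R := by
      have h3 : ‖z‖ < R := by simpa using h2
      exact h3.le
    gcongr
    linarith
  have hdc : DiffContOnCl ℂ q (Metric.ball (s - c) δ) := by
    refine DifferentiableOn.diffContOnCl ?_
    refine hq.mono ?_
    rw [closure_ball _ hδ0.ne']
    intro z hz
    rw [mem_closedBall_iff_norm] at hz
    have h1 : ‖z‖ ≤ r + δ := by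
      calc ‖z‖ = ‖(z - (s - c)) + (s - c)‖ := by congr 1; ring
        _ ≤ δ + r := (norm_add_le _ _).trans (by gcongr)
        _ = _ := add_comm _ _
    simp; linarith
  have hder := Complex.norm_deriv_le_of_forall_mem_sphere_norm_le hδ0 hdc hsph
  have hsc : s ∈ Metric.ball c R := by rw [mem_ball_iff_norm]; linarith
  have hdq : deriv q (s - c) = deriv G s / G s := by
    have h1 := hp s hsc
    have h2 : HasDerivAt p (deriv G s / G s) (c + (s - c)) := by
      rw [add_sub_cancel]; exact h1
    exact ((h2.comp_const_add c (s - c)).sub_const _).deriv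
  rw [hdq] at hder
  refine hder.trans ?_
  rw [hδ]
  have : R - r ≠ 0 := by linarith
  have h3 : 2 * Real.log K * R / ((R - r) / 2) / ((R - r) / 2) = 8 * R / (R - r) ^ 2 * Real.log K := by
    field_simp; ring
  rw [h3]
  gcongr
  norm_num

end RS

namespace RS

def RHyp : Prop := ∀ ρ : ℂ, riemannZeta ρ = 0 → 0 < ρ.re → ρ.re < 1 → ρ.re = 1 / 2

/-- the point `1/2 + iγ` -/
def rp (γ : ℝ) : ℂ := 1 / 2 + γ * Complex.I

@[simp] lemma rp_re (γ : ℝ) : (rp γ).re = 1 / 2 := by simp [rp]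
@[simp] lemma rp_im (γ : ℝ) : (rp γ).im = γ := by simp [rp]

lemma rp_inj : Function.Injective rp := by
  intro a b h
  have := congrArg Complex.im h
  simpa using this

def mz (γ : ℝ) : ℕ := analyticOrderNatAt riemannZeta₁ (rp γ)

lemma zeta1_ne : ∃ c, riemannZeta₁ c ≠ 0 := ⟨1, by simp [riemannZeta₁_one]⟩

lemma zeta1_zero_of_re {s : ℂ} (hRH : RHyp) (hs : 0 < s.re) (h : riemannZeta₁ s = 0) :
    s = rp s.im := by
  have h1 : s ≠ 1 := by rintro rfl; simp [riemannZeta₁_one] at h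
  rw [zeta1_eq_of_ne h1, mul_eq_zero] at h
  have h2 : riemannZeta s = 0 := h.resolve_left (sub_ne_zero.2 h1)
  have h3 : s.re < 1 := by
    by_contra h3
    exact riemannZeta_ne_zero_of_one_le_re (not_lt.1 h3) h2
  have := hRH s h2 hs h3
  apply Complex.ext <;> simp [this]

lemma zeta1_ne_zero_of_half {s : ℂ} (hRH : RHyp) (hs : 1 / 2 < s.re) : riemannZeta₁ s ≠ 0 := by
  intro h
  have := congrArg Complex.re (zeta1_zero_of_re hRH (by linarith) h)
  rw [rp_re] at this; linarith

lemma zs_finite (a b : ℝ) : {γ : ℝ | γ ∈ Set.Icc a b ∧ riemannZeta₁ (rp γ) = 0}.Finite := by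
  have hK : IsCompact (rp '' Set.Icc a b) := isCompact_Icc.image (by unfold rp; fun_prop)
  have := hK.inter_riemannZetaZeros_finite
  have h2 : (rp '' {γ : ℝ | γ ∈ Set.Icc a b ∧ riemannZeta₁ (rp γ) = 0}).Finite := by
    refine this.subset ?_
    rintro _ ⟨γ, ⟨hγ, h0⟩, rfl⟩
    refine ⟨⟨γ, hγ, rfl⟩, ?_⟩
    have h1 : rp γ ≠ 1 := by
      intro h; have := congrArg Complex.re h; simp at this
    rw [zeta1_eq_of_ne h1, mul_eq_zero] at h0
    exact h0.resolve_left (sub_ne_zero.2 h1)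
  exact h2.of_finite_image rp_inj.injOn

def zs (a b : ℝ) : Finset ℝ := (zs_finite a b).toFinset

lemma mem_zs {a b γ : ℝ} : γ ∈ zs a b ↔ (a ≤ γ ∧ γ ≤ b) ∧ riemannZeta₁ (rp γ) = 0 := by
  simp [zs]

def ell (T : ℝ) : ℝ := Real.log (|T| + 4)

lemma one_le_ell (T : ℝ) : 1 ≤ ell T := by
  unfold ell
  rw [Real.le_log_iff_exp_le (by positivity)]
  have := Real.exp_one_lt_d9
  have := abs_nonneg T
  linarith

/-- factorization in terms of `zs` -/
lemma factor_zs (a b : ℝ) : ∃ g : ℂ → ℂ, Differentiable ℂ g ∧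
      (∀ s, riemannZeta₁ s = (∏ γ ∈ zs a b, (s - rp γ) ^ mz γ) * g s) ∧
      ∀ γ ∈ zs a b, g (rp γ) ≠ 0 := by
  classical
  obtain ⟨g, hg, h1, h2⟩ := factor differentiable_riemannZeta₁ zeta1_ne ((zs a b).image rp)
  refine ⟨g, hg, ?_, ?_⟩
  · intro s
    rw [h1 s, Finset.prod_image (fun x _ y _ h => rp_inj h)]; rfl
  · intro γ hγ
    exact h2 _ (Finset.mem_image_of_mem _ hγ)

lemma logDeriv_factor {Z g : ℂ → ℂ} (hg : Differentiable ℂ g) {S : Finset ℝ}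
    (h : ∀ s, Z s = (∏ γ ∈ S, (s - rp γ) ^ mz γ) * g s) {s : ℂ} (hs : ∀ γ ∈ S, s ≠ rp γ)
    (hgs : g s ≠ 0) :
    logDeriv Z s = ∑ γ ∈ S, (mz γ : ℂ) / (s - rp γ) + logDeriv g s := by
  have e : Z = fun s => (∏ γ ∈ S, (s - rp γ) ^ mz γ) * g s := funext h
  have hP : ∏ γ ∈ S, (s - rp γ) ^ mz γ ≠ 0 :=
    Finset.prod_ne_zero_iff.2 fun γ hγ => pow_ne_zero _ (sub_ne_zero.2 (hs γ hγ))
  rw [e, logDeriv_mul s hP hgs (by fun_prop) (hg s)]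
  congr 1
  rw [logDeriv_prod]
  · refine Finset.sum_congr rfl fun γ hγ => ?_
    rw [logDeriv_fun_pow (by fun_prop)]
    rw [logDeriv_apply]
    simp [div_eq_mul_inv]
  · intro γ hγ; exact pow_ne_zero _ (sub_ne_zero.2 (hs γ hγ))
  · intro γ hγ; fun_prop

def cT (T : ℝ) : ℂ := 2 + T * Complex.I

lemma norm_sq_sub_cT (z : ℂ) (T : ℝ) : ‖z - cT T‖ ^ 2 = (z.re - 2) ^ 2 + (z.im - T) ^ 2 := by
  rw [Complex.sq_norm, Complex.normSq_apply]; simp [cT]; ring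

lemma zeta1_bd_sphere (T : ℝ) (z : ℂ) (hz : ‖z - cT T‖ = 19 / 10) :
    ‖riemannZeta₁ z‖ ≤ 21 * (|T| + 4) ^ 2 := by
  have h1 := norm_sq_sub_cT z T
  rw [hz] at h1
  have hre : 1 / 10 ≤ z.re := by nlinarith [sq_nonneg (z.im - T)]
  have hn : ‖z‖ ≤ |T| + 4 := by
    calc ‖z‖ = ‖(z - cT T) + cT T‖ := by congr 1; ring
      _ ≤ 19 / 10 + ‖cT T‖ := (norm_add_le _ _).trans (by rw [hz])
      _ ≤ 19 / 10 + (2 + |T|) := by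
        gcongr
        unfold cT
        refine (norm_add_le _ _).trans ?_
        simp
      _ ≤ _ := by linarith
  refine (norm_zeta1_le (by linarith)).trans ?_
  have h2 : 1 / z.re ≤ 10 := by
    rw [div_le_iff₀ (by linarith)]; linarith
  have hX : 4 ≤ |T| + 4 := by linarith [abs_nonneg T]
  have h0 := norm_nonneg z
  calc ‖z‖ + ‖z‖ * (‖z‖ + 1) * (1 / z.re) ≤ (|T| + 4) + (|T| + 4) * ((|T| + 4) + 1) * 10 := by gcongr
    _ ≤ _ := by nlinarith

lemma norm_rp_sub_cT {T γ : ℝ} (h : γ ∈ zs (T - 1) (T + 1)) : ‖rp γ - cT T‖ ^ 2 ≤ 13 / 4 := by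
  rw [norm_sq_sub_cT]; simp
  have := (mem_zs.1 h).1
  nlinarith

lemma le_181 {x : ℝ} (h : x ^ 2 ≤ 13 / 4) : x ≤ 181 / 100 := by
  nlinarith

/-- count bound -/
lemma count_bound : ∃ C > 0, ∀ T : ℝ, ∑ γ ∈ zs (T - 1) (T + 1), (mz γ : ℝ) ≤ C * ell T := by
  have hlog : 0 < Real.log (190 / 181 : ℝ) := Real.log_pos (by norm_num)
  refine ⟨(Real.log 84 + 2) / Real.log (190 / 181 : ℝ), by
    have : 0 < Real.log 84 := Real.log_pos (by norm_num)
    positivity, fun T => ?_⟩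
  classical
  have hc := norm_zeta1_two_ge T
  have hc0 : riemannZeta₁ (cT T) ≠ 0 := by
    intro h; rw [cT] at h; rw [h] at hc; norm_num at hc
  have hj := jensen differentiable_riemannZeta₁ hc0 ((zs (T-1) (T+1)).image rp) (r := 181 / 100)
    (R := 19 / 10) (M := 21 * (|T| + 4) ^ 2) (by norm_num) (by norm_num) (by
      intro ρ hρ
      obtain ⟨γ, hγ, rfl⟩ := Finset.mem_image.1 hρ
      exact le_181 (norm_rp_sub_cT hγ)) (zeta1_bd_sphere T)
  rw [Finset.sum_image (fun x _ y _ h => rp_inj h)] at hj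
  set N := ∑ γ ∈ zs (T - 1) (T + 1), mz γ with hN
  have hN' : ∑ x ∈ zs (T - 1) (T + 1), analyticOrderNatAt riemannZeta₁ (rp x) = N := rfl
  rw [hN'] at hj
  have h1 : ((190 : ℝ) / 181) ^ N ≤ 84 * (|T| + 4) ^ 2 := by
    have e : (19 / 10 / (181 / 100) : ℝ) = 190 / 181 := by norm_num
    rw [e] at hj
    have : (1:ℝ) / 4 ≤ ‖riemannZeta₁ (cT T)‖ := hc
    have h3 : (0:ℝ) < (190 / 181) ^ N := by positivity
    nlinarith
  have hX : 0 < |T| + 4 := by positivity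
  have h2 := Real.log_le_log (by positivity) h1
  rw [Real.log_pow, Real.log_mul (by norm_num) (by positivity), Real.log_pow] at h2
  have h3 := one_le_ell T
  have : (∑ γ ∈ zs (T - 1) (T + 1), (mz γ : ℝ)) = (N : ℝ) := by rw [hN]; push_cast; rfl
  rw [this, div_mul_eq_mul_div, le_div_iff₀ hlog]
  have h84 : 0 < Real.log 84 := Real.log_pos (by norm_num)
  have : Real.log (|T| + 4) = ell T := rfl
  rw [this] at h2
  push_cast at h2
  nlinarith

lemma rp_sum_prod_bound {T : ℝ} {z : ℂ} {κ : ℝ} (hκ : 0 ≤ κ)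
    (h : ∀ γ ∈ zs (T - 1) (T + 1), κ ≤ ‖z - rp γ‖) :
    κ ^ (∑ γ ∈ zs (T - 1) (T + 1), mz γ) ≤ ‖∏ γ ∈ zs (T - 1) (T + 1), (z - rp γ) ^ mz γ‖ := by
  rw [← Finset.prod_pow_eq_pow_sum, norm_prod]
  refine Finset.prod_le_prod (fun _ _ => by positivity) fun γ hγ => ?_
  rw [norm_pow]; exact pow_le_pow_left₀ hκ (h γ hγ) _

lemma rp_sum_prod_bound' {T : ℝ} {z : ℂ} {κ : ℝ} 
    (h : ∀ γ ∈ zs (T - 1) (T + 1), ‖z - rp γ‖ ≤ κ) :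
    ‖∏ γ ∈ zs (T - 1) (T + 1), (z - rp γ) ^ mz γ‖ ≤ κ ^ (∑ γ ∈ zs (T - 1) (T + 1), mz γ) := by
  rw [← Finset.prod_pow_eq_pow_sum, norm_prod]
  refine Finset.prod_le_prod (fun _ _ => by positivity) fun γ hγ => ?_
  rw [norm_pow]; exact pow_le_pow_left₀ (norm_nonneg _) (h γ hγ) _

lemma local_bound (hRH : RHyp) : ∃ C > 0, ∀ T : ℝ, ∀ s : ℂ, 1 / 2 < s.re → s.re ≤ 3 / 2 →
    |s.im - T| ≤ 1 / 2 →
    ‖logDeriv riemannZeta₁ s - ∑ γ ∈ zs (T - 1) (T + 1), (mz γ : ℂ) / (s - rp γ)‖ ≤ C * ell T := by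
  obtain ⟨C₀, hC₀, hcount⟩ := count_bound
  have hl84 : 0 < Real.log 84 := Real.log_pos (by norm_num)
  have hl20 : 0 < Real.log (181/9) := Real.log_pos (by norm_num)
  refine ⟨16 * (9/5) / (9/5 - 8/5) ^ 2 * (Real.log 84 + 2 + C₀ * Real.log (181/9)), by positivity,
    fun T s hs1 hs2 hs3 => ?_⟩
  obtain ⟨g, hg, hfac, hg0⟩ := factor_zs (T - 1) (T + 1)
  set N := ∑ γ ∈ zs (T - 1) (T + 1), mz γ with hN
  have hX : 4 ≤ |T| + 4 := by linarith [abs_nonneg T]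
  set M := 21 * (|T| + 4) ^ 2 with hM
  have hc : (1:ℝ) / 4 ≤ ‖riemannZeta₁ (cT T)‖ := norm_zeta1_two_ge T
  -- nonvanishing
  have hgne : ∀ z, ‖z - cT T‖ < 9 / 5 → g z ≠ 0 := by
    intro z hz h
    have hz2 := norm_sq_sub_cT z T
    have hzsq : ‖z - cT T‖ ^ 2 ≤ (9/5) ^ 2 := by gcongr
    have hre : 0 < z.re := by nlinarith [sq_nonneg (z.im - T)]
    have hZ : riemannZeta₁ z = 0 := by rw [hfac, h, mul_zero]
    have hzz := zeta1_zero_of_re hRH hre hZ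
    have hre2 : z.re = 1/2 := by rw [hzz]; simp
    rw [hre2] at hz2
    have : z.im ∈ zs (T-1) (T+1) := by
      rw [mem_zs, ← hzz]
      refine ⟨⟨?_, ?_⟩, hZ⟩ <;> nlinarith
    apply hg0 _ this
    rw [← hzz]; exact h
  have hgup : ∀ z, ‖z - cT T‖ ≤ 19/10 → ‖g z‖ ≤ M / (9/100) ^ N := by
    intro z hz
    refine max_mod hg (by norm_num : (0:ℝ) < 19/10) (fun z hz => ?_) hz
    have h1 : (9/100 : ℝ) ^ N ≤ ‖∏ γ ∈ zs (T - 1) (T + 1), (z - rp γ) ^ mz γ‖ := by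
      refine rp_sum_prod_bound (by norm_num) fun γ hγ => ?_
      have h2 := le_181 (norm_rp_sub_cT hγ)
      have h3 : ‖z - cT T‖ ≤ ‖z - rp γ‖ + ‖rp γ - cT T‖ := by
        have := norm_add_le (z - rp γ) (rp γ - cT T)
        simpa using this
      rw [hz] at h3; linarith
    have h2 := zeta1_bd_sphere T z hz
    rw [hfac, norm_mul] at h2
    rw [le_div_iff₀ (by positivity)]
    refine le_trans ?_ h2
    rw [mul_comm]; gcongr
  have hglow : (1/4) / (181/100) ^ N ≤ ‖g (cT T)‖ := by
    have h1 : ‖∏ γ ∈ zs (T - 1) (T + 1), (cT T - rp γ) ^ mz γ‖ ≤ (181/100 : ℝ) ^ N := by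
      refine rp_sum_prod_bound' fun γ hγ => ?_
      rw [norm_sub_rev]
      exact le_181 (norm_rp_sub_cT hγ)
    rw [hfac, norm_mul] at hc
    rw [div_le_iff₀ (by positivity)]
    refine hc.trans ?_
    rw [mul_comm]; gcongr
  have hM0 : 0 < M := by positivity
  have hM1 : 1 ≤ M := by nlinarith
  set K := 4 * M * (181/9 : ℝ) ^ N with hK
  have hK1 : 1 < K := by
    have : (1:ℝ) ≤ (181/9) ^ N := one_le_pow₀ (by norm_num)
    nlinarith
  have hKg : ∀ z, ‖z - cT T‖ < 9 / 5 → ‖g z‖ ≤ K * ‖g (cT T)‖ := by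
    intro z hz
    refine (hgup z (by linarith)).trans ?_
    calc M / (9/100) ^ N = K * ((1/4) / (181/100) ^ N) := by
          rw [hK]
          have : (181/9 : ℝ) ^ N = (181/100) ^ N / (9/100) ^ N := by
            rw [← div_pow]; norm_num
          rw [this]; field_simp
      _ ≤ _ := by gcongr
  have hsc : ‖s - cT T‖ ≤ 8/5 := by
    have := norm_sq_sub_cT s T
    have h4 : (s.im - T) ^ 2 ≤ (1/2) ^ 2 := by
      rw [← sq_abs]; gcongr
    nlinarith [norm_nonneg (s - cT T)]
  have hb := logDeriv_bound hg (by norm_num : (0:ℝ) < 8/5) (by norm_num : (8/5:ℝ) < 9/5) hgne hK1 hKg hsc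
  have hne : ∀ γ ∈ zs (T-1) (T+1), s ≠ rp γ := by
    intro γ _ h
    rw [h] at hs1; simp at hs1
  rw [logDeriv_factor hg hfac hne (hgne s (by linarith)), add_sub_cancel_left, logDeriv_apply]
  refine hb.trans ?_
  rw [mul_assoc]
  gcongr
  have hlK : Real.log K = Real.log 84 + 2 * ell T + N * Real.log (181/9) := by
    have : K = 84 * (|T| + 4) ^ 2 * (181/9) ^ N := by rw [hK, hM]; ring
    rw [this, Real.log_mul (by positivity) (by positivity), Real.log_mul (by norm_num) (by positivity),
      Real.log_pow, Real.log_pow]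
    simp [ell]
  rw [hlK]
  have h5 := hcount T
  have : (∑ γ ∈ zs (T - 1) (T + 1), (mz γ : ℝ)) = (N : ℝ) := by rw [hN]; push_cast; rfl
  rw [this] at h5
  have h6 := one_le_ell T
  nlinarith

end RS

namespace RS

def fF (y : ℝ) : ℝ :=
  if 0 < y then Real.exp (-y / 2) * (Chebyshev.psi (Real.exp y) - Real.exp y) else 0

def Lf (w : ℂ) : ℂ := -(logDeriv riemannZeta₁ (w + 1 / 2) + 1) / (w + 1 / 2)

lemma fF_nonpos {y : ℝ} (hy : y ≤ 0) : fF y = 0 := by simp [fF, not_lt.2 hy]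

lemma fF_meas : Measurable fF := by
  unfold fF
  have := Chebyshev.psi_mono.measurable
  refine Measurable.ite measurableSet_Ioi ?_ measurable_const
  fun_prop

lemma abs_psi_sub {x : ℝ} (hx : 0 ≤ x) : |Chebyshev.psi x - x| ≤ 6 * x := by
  have h1 := Chebyshev.psi_le_const_mul_self hx
  have h2 := Chebyshev.psi_nonneg x
  have h3 : Real.log 4 ≤ 2 := by
    have : Real.log 4 = 2 * Real.log 2 := by
      rw [show (4:ℝ) = 2 ^ 2 by norm_num, Real.log_pow]; norm_num
    have := Real.log_two_lt_d9
    linarith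
  rw [abs_le]; constructor <;> nlinarith

lemma abs_fF_le (y : ℝ) : |fF y| ≤ 6 * Real.exp (y / 2) := by
  unfold fF
  split_ifs with h
  · rw [abs_mul, Real.abs_exp]
    calc _ ≤ Real.exp (-y/2) * (6 * Real.exp y) := by
          gcongr; exact abs_psi_sub (Real.exp_pos y).le
      _ = 6 * Real.exp (y/2) := by
          rw [mul_left_comm, ← Real.exp_add]; ring_nf
  · simp; positivity

lemma fF_eq_small {y : ℝ} (hy : 0 < y) (h2 : y < Real.log 2) : fF y = - Real.exp (y / 2) := by
  have : Real.exp y < 2 := by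
    rw [← Real.lt_log_iff_exp_lt (by norm_num)]; exact h2
  simp only [fF, hy, if_true, Chebyshev.psi_eq_zero_of_lt_two this, zero_sub, mul_neg, ← Real.exp_add]
  ring_nf

lemma norm_cexp_neg (w : ℂ) (y : ℝ) : ‖Complex.exp (-w * y)‖ = Real.exp (-w.re * y) := by
  rw [Complex.norm_exp]; simp

lemma fF_laplace_integrable {w : ℂ} (hw : 1 / 2 < w.re) :
    Integrable (fun y : ℝ => (fF y : ℂ) * Complex.exp (-w * y)) := by
  have hI : IntegrableOn (fun y : ℝ => (fF y : ℂ) * Complex.exp (-w * y)) (Set.Ioi 0) := by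
    have h0 : IntegrableOn (fun y : ℝ => 6 * Real.exp ((1/2 - w.re) * y)) (Set.Ioi 0) :=
      (integrableOn_exp_mul_Ioi (by linarith) 0).const_mul 6
    refine h0.mono' ?_ ?_
    · have := fF_meas
      refine Measurable.aestronglyMeasurable ?_
      fun_prop
    · refine Eventually.of_forall fun y => ?_
      rw [norm_mul, norm_cexp_neg, Complex.norm_real, Real.norm_eq_abs]
      calc _ ≤ 6 * Real.exp (y/2) * Real.exp (-w.re * y) := by gcongr; exact abs_fF_le y
        _ = _ := by rw [mul_assoc, ← Real.exp_add]; ring_nf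
  rw [← integrableOn_univ]
  refine hI.of_forall_sdiff_eq_zero MeasurableSet.univ ?_
  intro y hy
  have : y ≤ 0 := by simpa using hy.2
  simp [fF_nonpos this]

lemma image_exp_Ioi : Real.exp '' Set.Ioi 0 = Set.Ioi 1 := by
  ext x; constructor
  · rintro ⟨y, hy, rfl⟩
    exact Real.one_lt_exp_iff.2 hy
  · intro hx
    have hx' : (1:ℝ) < x := hx
    exact ⟨Real.log x, Real.log_pos hx', Real.exp_log (by linarith)⟩

lemma psi_eq_Icc1 (t : ℝ) : Chebyshev.psi t =
    ∑ k ∈ Finset.Icc 1 ⌊t⌋₊, ArithmeticFunction.vonMangoldt k := by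
  rw [Chebyshev.psi_eq_sum_Icc]
  symm
  refine Finset.sum_subset (Finset.Icc_subset_Icc_left (by norm_num)) ?_
  intro k hk hk'
  have : k = 0 := by
    simp only [Finset.mem_Icc, not_and, not_le] at hk hk'
    by_contra h
    have := hk' (by omega)
    omega
  simp [this]

lemma psi_laplace {s : ℂ} (hs : 1 < s.re) :
    ∫ y in Set.Ioi (0:ℝ), (Chebyshev.psi (Real.exp y) : ℂ) * Complex.exp (-s * y) =
      -(deriv riemannZeta s / riemannZeta s) / s := by
  have h1 := LSeries_eq_mul_integral_of_nonneg (fun n => ArithmeticFunction.vonMangoldt n) (r := 1)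
    zero_le_one hs ?_ (fun n => ArithmeticFunction.vonMangoldt_nonneg)
  · rw [ArithmeticFunction.LSeries_vonMangoldt_eq_deriv_riemannZeta_div hs] at h1
    have hs0 : s ≠ 0 := by rintro rfl; simp at hs; linarith
    have h2 : ∫ t in Set.Ioi (1:ℝ), (∑ k ∈ Finset.Icc 1 ⌊t⌋₊, (ArithmeticFunction.vonMangoldt k : ℂ)) *
        (t:ℂ) ^ (-(s + 1)) = ∫ y in Set.Ioi (0:ℝ), (Chebyshev.psi (Real.exp y) : ℂ) * Complex.exp (-s * y) := by
      rw [← image_exp_Ioi, integral_image_eq_integral_abs_deriv_smul measurableSet_Ioi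
        (fun x _ => (Real.hasDerivAt_exp x).hasDerivWithinAt) (Real.exp_injective.injOn)]
      refine setIntegral_congr_fun measurableSet_Ioi fun y _ => ?_
      rw [psi_eq_Icc1, abs_of_pos (Real.exp_pos y), Complex.real_smul]
      push_cast
      rw [Complex.cpow_def_of_ne_zero (Complex.exp_ne_zero _), ← Complex.ofReal_exp, ← Complex.ofReal_log (Real.exp_pos y).le, Real.log_exp]
      rw [mul_left_comm, Complex.ofReal_exp, ← Complex.exp_add]
      congr 2; ring
    rw [← h2, eq_div_iff hs0, mul_comm, ← h1, neg_div]
  · refine Asymptotics.IsBigO.of_bound 6 (Eventually.of_forall fun n => ?_)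
    have h3 := psi_eq_Icc1 (n:ℝ)
    rw [Nat.floor_natCast] at h3
    rw [← h3, Real.norm_eq_abs, abs_of_nonneg (Chebyshev.psi_nonneg _)]
    simp only [Real.rpow_one, Real.norm_eq_abs, Nat.abs_cast]
    refine (Chebyshev.psi_le_const_mul_self (Nat.cast_nonneg n)).trans ?_
    gcongr
    have : Real.log 4 = 2 * Real.log 2 := by
      rw [show (4:ℝ) = 2 ^ 2 by norm_num, Real.log_pow]; norm_num
    have := Real.log_two_lt_d9
    linarith

lemma logDeriv_zeta1 {s : ℂ} (hs : 1 < s.re) :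
    logDeriv riemannZeta₁ s = 1 / (s - 1) + deriv riemannZeta s / riemannZeta s := by
  have h1 : s ≠ 1 := by rintro rfl; simp at hs
  have he : riemannZeta₁ =ᶠ[𝓝 s] fun z => (z - 1) * riemannZeta z := by
    filter_upwards [isOpen_ne.mem_nhds h1] with z hz
    exact zeta1_eq_of_ne hz
  have hz : riemannZeta s ≠ 0 := riemannZeta_ne_zero_of_one_le_re hs.le
  have hd := differentiableAt_riemannZeta h1
  rw [logDeriv_apply, he.deriv_eq, he.eq_of_nhds, ← logDeriv_apply (fun z => (z - 1) * riemannZeta z),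
    logDeriv_mul (f := fun z => z - 1) s (sub_ne_zero.2 h1) hz (by fun_prop) hd]
  congr 1
  simp [logDeriv_apply]

lemma fF_laplace1 {w : ℂ} (hw : 1 / 2 < w.re) :
    ∫ y : ℝ, (fF y : ℂ) * Complex.exp (-w * y) = Lf w := by
  have hs : 1 < (w + 1/2).re := by simp; linarith
  set s := w + 1/2 with hsdef
  have hs0 : s ≠ 0 := by intro h; rw [h] at hs; simp at hs; linarith
  have hs1 : s - 1 ≠ 0 := by intro h; rw [sub_eq_zero.1 h] at hs; simp at hs
  have e1 : ∫ y : ℝ, (fF y : ℂ) * Complex.exp (-w * y) =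
      ∫ y in Set.Ioi (0:ℝ), (fF y : ℂ) * Complex.exp (-w * y) := by
    symm
    refine setIntegral_eq_integral_of_forall_compl_eq_zero fun y hy => ?_
    simp [fF_nonpos (by simpa using hy)]
  have e2 : ∫ y in Set.Ioi (0:ℝ), Complex.exp ((1 - s) * y) = 1 / (s - 1) := by
    rw [integral_exp_mul_complex_Ioi (by simp; linarith)]
    have h3 : 1 - s ≠ 0 := by intro h; exact hs1 (by linear_combination -h)
    simp; rw [show 1 - s = -(s - 1) by ring]; field_simp
  have hIntg2 : IntegrableOn (fun y : ℝ => Complex.exp ((1 - s) * y)) (Set.Ioi 0) :=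
    integrableOn_exp_mul_complex_Ioi (by simp; linarith) 0
  have hpt : ∀ y ∈ Set.Ioi (0:ℝ), (fF y : ℂ) * Complex.exp (-w * y) =
      (Chebyshev.psi (Real.exp y) : ℂ) * Complex.exp (-s * y) - Complex.exp ((1 - s) * y) := by
    intro y hy
    have hy' : 0 < y := hy
    simp only [fF, hy', if_true]
    push_cast
    have a1 : Complex.exp (-s * y) = Complex.exp (-(y:ℂ)/2) * Complex.exp (-w * y) := by
      rw [← Complex.exp_add]; congr 1; rw [hsdef]; ring
    have a2 : Complex.exp ((1 - s) * y) = Complex.exp y * (Complex.exp (-(y:ℂ)/2) * Complex.exp (-w * y)) := by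
      rw [← Complex.exp_add, ← Complex.exp_add]; congr 1; rw [hsdef]; ring
    rw [a1, a2]; ring
  have hIntg1 : IntegrableOn (fun y : ℝ => (Chebyshev.psi (Real.exp y) : ℂ) * Complex.exp (-s * y)) (Set.Ioi 0) := by
    have := ((fF_laplace_integrable hw).integrableOn (s := Set.Ioi 0)).add hIntg2
    refine this.congr_fun (fun y hy => ?_) measurableSet_Ioi
    simp only [Pi.add_apply]
    rw [hpt y hy]; ring
  rw [e1, setIntegral_congr_fun measurableSet_Ioi hpt, integral_sub hIntg1 hIntg2, e2, psi_laplace hs]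
  rw [Lf, ← hsdef, logDeriv_zeta1 hs]
  field_simp
  ring

end RS

namespace RS

lemma gauss_ft {δ : ℝ} (hδ : 0 < δ) (t : ℝ) :
    ∫ y : ℝ, Complex.exp (Complex.I * t * y) * (Real.exp (-δ * y ^ 2) : ℂ) =
      ((Real.sqrt (Real.pi / δ) * Real.exp (-t ^ 2 / (4 * δ)) : ℝ) : ℂ) := by
  have := fourierIntegral_gaussian (b := (δ:ℂ)) (by simpa using hδ) (t:ℂ)
  push_cast
  rw [this, Real.sqrt_eq_rpow, Complex.ofReal_cpow (by positivity)]
  push_cast; rfl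

lemma gauss_integrable {δ : ℝ} (hδ : 0 < δ) : Integrable (fun y : ℝ => Real.exp (-δ * y ^ 2)) :=
  integrable_exp_neg_mul_sq hδ

lemma gauss2_integral {δ : ℝ} (hδ : 0 < δ) :
    ∫ y : ℝ, Real.sqrt (Real.pi / δ) * Real.exp (-y ^ 2 / (4 * δ)) = 2 * Real.pi := by
  have h := integral_gaussian (1 / (4 * δ))
  rw [integral_const_mul]
  have e : ∀ y : ℝ, -y ^ 2 / (4 * δ) = -(1 / (4 * δ)) * y ^ 2 := fun y => by ring
  simp_rw [e, h, ← Real.sqrt_mul (show 0 ≤ Real.pi / δ by positivity)]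
  rw [show Real.pi / δ * (Real.pi / (1 / (4 * δ))) = (2 * Real.pi) ^ 2 by field_simp; ring]
  exact Real.sqrt_sq (by positivity)

lemma gauss2_integrable {δ : ℝ} (hδ : 0 < δ) :
    Integrable fun y : ℝ => Real.sqrt (Real.pi / δ) * Real.exp (-y ^ 2 / (4 * δ)) := by
  have e : ∀ y : ℝ, -y ^ 2 / (4 * δ) = -(1 / (4 * δ)) * y ^ 2 := fun y => by ring
  simp_rw [e]
  exact (gauss_integrable (by positivity)).const_mul _

/-- `u(y) = ∫ h(t) e^{ity} dt` -/
def ift (h : ℝ → ℂ) (y : ℝ) : ℂ := ∫ t : ℝ, h t * Complex.exp (Complex.I * t * y)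

lemma norm_expI (a b : ℝ) : ‖Complex.exp (Complex.I * a * b)‖ = 1 := by
  rw [Complex.norm_exp]; simp

lemma plancherel_le {h : ℝ → ℂ} (hi : Integrable h) (h2 : Integrable fun t => ‖h t‖ ^ 2) {δ : ℝ}
    (hδ : 0 < δ) :
    ∫ y, ‖ift h y‖ ^ 2 * Real.exp (-δ * y ^ 2) ≤ 2 * Real.pi * ∫ t, ‖h t‖ ^ 2 := by
  set g : ℝ → ℝ := fun y => Real.sqrt (Real.pi / δ) * Real.exp (-y ^ 2 / (4 * δ)) with hg
  have hginteg : Integrable g := gauss2_integrable hδ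
  -- expand the square
  have e1 : ∀ y : ℝ, ((‖ift h y‖ ^ 2 * Real.exp (-δ * y ^ 2) : ℝ) : ℂ) =
      ∫ p : ℝ × ℝ, (h p.1 * (starRingEnd ℂ) (h p.2)) *
        (Complex.exp (Complex.I * ((p.1 - p.2 : ℝ) : ℂ) * y) * (Real.exp (-δ * y ^ 2) : ℂ)) := by
    intro y
    have a1 : (starRingEnd ℂ) (ift h y) = ∫ t : ℝ, (starRingEnd ℂ) (h t) * Complex.exp (-(Complex.I * t * y)) := by
      rw [ift, ← integral_conj]
      congr 1; ext t
      rw [map_mul, ← Complex.exp_conj]; simp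
    have a2 : ((‖ift h y‖ ^ 2 : ℝ) : ℂ) = ift h y * (starRingEnd ℂ) (ift h y) := by
      rw [Complex.mul_conj, Complex.normSq_eq_norm_sq]
    rw [Complex.ofReal_mul, a2, a1, ift, ← integral_prod_mul, ← integral_mul_const]
    congr 1; ext p
    have : Complex.exp (Complex.I * ((p.1 - p.2 : ℝ) : ℂ) * y) =
      Complex.exp (Complex.I * p.1 * y) * Complex.exp (-(Complex.I * p.2 * y)) := by
      rw [← Complex.exp_add]; congr 1; push_cast; ring
    rw [this]; ring
  have hhh : Integrable (fun p : ℝ × ℝ => h p.1 * (starRingEnd ℂ) (h p.2)) (volume.prod volume) := by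
    refine hi.mul_prod (g := fun s => (starRingEnd ℂ) (h s)) ?_
    exact (Complex.conjLIE.toContinuousLinearEquiv.toContinuousLinearMap.integrable_comp hi)
  have hbig : Integrable (Function.uncurry fun (y : ℝ) (p : ℝ × ℝ) => (h p.1 * (starRingEnd ℂ) (h p.2)) *
        (Complex.exp (Complex.I * ((p.1 - p.2 : ℝ) : ℂ) * y) * (Real.exp (-δ * y ^ 2) : ℂ)))
        (volume.prod (volume.prod volume)) := by
    have b1 : Integrable (fun q : ℝ × (ℝ × ℝ) => (Real.exp (-δ * q.1 ^ 2) : ℂ) * (h q.2.1 * (starRingEnd ℂ) (h q.2.2)))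
        (volume.prod (volume.prod volume)) :=
      Integrable.mul_prod (f := fun y : ℝ => (Real.exp (-δ * y ^ 2) : ℂ)) ((gauss_integrable hδ).ofReal) hhh
    have b2 := b1.bdd_mul (c := 1) (f := fun q : ℝ × (ℝ × ℝ) => Complex.exp (Complex.I * ((q.2.1 - q.2.2 : ℝ) : ℂ) * q.1))
      (Continuous.aestronglyMeasurable (by fun_prop)) (Eventually.of_forall fun q => (norm_expI _ _).le)
    refine b2.congr (Eventually.of_forall fun q => ?_)
    simp only [Function.uncurry]; ring
  have e2 : ((∫ y, ‖ift h y‖ ^ 2 * Real.exp (-δ * y ^ 2) : ℝ) : ℂ) =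
      ∫ p : ℝ × ℝ, (h p.1 * (starRingEnd ℂ) (h p.2)) * (g (p.1 - p.2) : ℂ) := by
    rw [← integral_complex_ofReal]
    simp_rw [e1]
    rw [Measure.volume_eq_prod, integral_integral_swap hbig]
    congr 1; ext p
    rw [integral_const_mul, gauss_ft hδ]
  have c1 : Integrable (fun p : ℝ × ℝ => ‖h p.2‖ ^ 2 * g (p.1 - p.2)) (volume.prod volume) :=
    Integrable.convolution_integrand (ContinuousLinearMap.mul ℝ ℝ) h2 hginteg
  have hgsymm : ∀ a b : ℝ, g (a - b) = g (b - a) := by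
    intro a b; simp only [hg]; ring_nf
  have c2 : Integrable (fun p : ℝ × ℝ => ‖h p.1‖ ^ 2 * g (p.1 - p.2)) (volume.prod volume) := by
    refine c1.swap.congr (Eventually.of_forall fun p => ?_)
    simp only [Function.comp, Prod.fst_swap, Prod.snd_swap]
    rw [hgsymm]
  have c3 : ∫ p : ℝ × ℝ, ‖h p.1‖ ^ 2 * g (p.1 - p.2) = 2 * Real.pi * ∫ t, ‖h t‖ ^ 2 := by
    rw [Measure.volume_eq_prod, integral_prod _ c2]
    simp_rw [integral_const_mul]
    have : ∀ x, ∫ y, g (y - x) = 2 * Real.pi := fun x => by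
      rw [integral_sub_right_eq_self]; exact gauss2_integral hδ
    have hx : ∀ x, ∫ y, g (x - y) = 2 * Real.pi := fun x => by
      simp_rw [hgsymm x]; exact this x
    simp_rw [hx]
    rw [integral_mul_const, mul_comm]
  have c4 : ∫ p : ℝ × ℝ, ‖h p.2‖ ^ 2 * g (p.1 - p.2) = 2 * Real.pi * ∫ t, ‖h t‖ ^ 2 := by
    rw [← c3, Measure.volume_eq_prod, ← integral_prod_swap]
    congr 1; ext p
    simp only [Prod.fst_swap, Prod.snd_swap]; rw [hgsymm]
  have hg0 : ∀ y, 0 ≤ g y := fun y => by simp only [hg]; positivity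
  calc ∫ y, ‖ift h y‖ ^ 2 * Real.exp (-δ * y ^ 2) ≤ ‖((∫ y, ‖ift h y‖ ^ 2 * Real.exp (-δ * y ^ 2) : ℝ) : ℂ)‖ := by
        rw [Complex.norm_real]; exact Real.le_norm_self _
    _ = ‖∫ p : ℝ × ℝ, (h p.1 * (starRingEnd ℂ) (h p.2)) * (g (p.1 - p.2) : ℂ)‖ := by rw [e2]
    _ ≤ ∫ p : ℝ × ℝ, ((1/2) * (‖h p.1‖ ^ 2 * g (p.1 - p.2)) + (1/2) * (‖h p.2‖ ^ 2 * g (p.1 - p.2))) := by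
        refine norm_integral_le_of_norm_le ((c2.const_mul _).add (c1.const_mul _)) (Eventually.of_forall fun p => ?_)
        rw [norm_mul, norm_mul, RCLike.norm_conj, Complex.norm_real, Real.norm_of_nonneg (hg0 _)]
        have := two_mul_le_add_sq ‖h p.1‖ ‖h p.2‖
        nlinarith [hg0 (p.1 - p.2)]
    _ = 2 * Real.pi * ∫ t, ‖h t‖ ^ 2 := by
        rw [Measure.volume_eq_prod] at c3 c4 ⊢
        rw [integral_add (c2.const_mul _) (c1.const_mul _), integral_const_mul, integral_const_mul, c3, c4]
        ring

/-- contour shift -/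
lemma contour_shift {F : ℂ → ℂ} {a b : ℝ} {h : ℝ → ℝ} (hab : a ≤ b)
    (hF : DifferentiableOn ℂ F {z | a ≤ z.re ∧ z.re ≤ b})
    (hh : Integrable h) (h0 : Tendsto h atTop (𝓝 0)) (h1 : Tendsto h atBot (𝓝 0))
    (hb : ∀ x t : ℝ, a ≤ x → x ≤ b → ‖F (x + t * Complex.I)‖ ≤ h t) :
    ∫ t : ℝ, F (a + t * Complex.I) = ∫ t : ℝ, F (b + t * Complex.I) := by
  have hcont : ∀ x, a ≤ x → x ≤ b → Continuous fun t : ℝ => F (x + t * Complex.I) := by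
    intro x hx1 hx2
    refine hF.continuousOn.comp_continuous (by fun_prop) fun t => ?_
    simp [hx1, hx2]
  have hIntg : ∀ x, a ≤ x → x ≤ b → Integrable fun t : ℝ => F (x + t * Complex.I) := by
    intro x hx1 hx2
    exact hh.mono' (hcont x hx1 hx2).aestronglyMeasurable (Eventually.of_forall fun t => hb x t hx1 hx2)
  have hrect : ∀ T : ℝ, (∫ t in (-T)..T, F (b + t * Complex.I)) - (∫ t in (-T)..T, F (a + t * Complex.I)) =
      Complex.I * ((∫ x in a..b, F (x + (-T : ℝ) * Complex.I)) - ∫ x in a..b, F (x + T * Complex.I)) := by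
    intro T
    have := Complex.integral_boundary_rect_eq_zero_of_differentiableOn F (a + (-T:ℝ) * Complex.I) (b + T * Complex.I)
      (hF.mono ?_)
    · simp only [Complex.add_re, Complex.ofReal_re, Complex.mul_re, Complex.I_re, mul_zero, Complex.ofReal_im, Complex.I_im,
        mul_one, sub_self, add_zero, Complex.add_im, Complex.mul_im, zero_add, smul_eq_mul] at this
      linear_combination (-Complex.I) * this + ((∫ t in (-T)..T, F (b + t * Complex.I)) - (∫ t in (-T)..T, F (a + t * Complex.I))) * (Complex.I_sq)
    · intro z hz
      have := hz.1
      simp [Set.uIcc_of_le hab] at this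
      exact this
  have hlim1 : Tendsto (fun T : ℝ => (∫ t in (-T)..T, F (b + t * Complex.I)) - (∫ t in (-T)..T, F (a + t * Complex.I))) atTop
      (𝓝 ((∫ t : ℝ, F (b + t * Complex.I)) - ∫ t : ℝ, F (a + t * Complex.I))) :=
    (intervalIntegral_tendsto_integral (hIntg b hab le_rfl) tendsto_neg_atTop_atBot tendsto_id).sub
    (intervalIntegral_tendsto_integral (hIntg a le_rfl hab) tendsto_neg_atTop_atBot tendsto_id)
  have hhor : ∀ T : ℝ, ‖∫ x in a..b, F (x + T * Complex.I)‖ ≤ h T * |b - a| := by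
    intro T
    refine intervalIntegral.norm_integral_le_of_norm_le_const fun x hx => ?_
    rw [Set.uIoc_of_le hab] at hx
    exact hb x T hx.1.le hx.2
  have hz : ∀ {l : Filter ℝ}, Tendsto h l (𝓝 0) → Tendsto (fun T : ℝ => ∫ x in a..b, F (x + T * Complex.I)) l (𝓝 0) := by
    intro l hl
    refine squeeze_zero_norm hhor ?_
    simpa using hl.mul_const |b - a|
  have hlim2 : Tendsto (fun T : ℝ => Complex.I * ((∫ x in a..b, F (x + (-T : ℝ) * Complex.I)) - ∫ x in a..b, F (x + T * Complex.I)))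
      atTop (𝓝 0) := by
    have := (((hz h1).comp tendsto_neg_atTop_atBot).sub (hz h0)).const_mul Complex.I
    simpa using this
  simp_rw [← hrect] at hlim2
  have := tendsto_nhds_unique hlim1 hlim2
  exact (sub_eq_zero.1 this).symm

end RS

namespace RS

lemma ell_le (t : ℝ) : ell t ≤ 3 * (1 + |t|) := by
  have h0 := abs_nonneg t
  have := Real.log_le_sub_one_of_pos (show 0 < |t| + 4 by positivity)
  unfold ell; linarith

lemma ell_sq_le (t : ℝ) : ell t ^ 2 ≤ 32 * (1 + |t|) ^ (1/2 : ℝ) := by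
  have h0 := abs_nonneg t
  have h1 : ell t ≤ 4 * (|t| + 4) ^ (1/4 : ℝ) := by
    have := Real.log_le_rpow_div (show 0 ≤ |t| + 4 by positivity) (show (0:ℝ) < 1/4 by norm_num)
    unfold ell; linarith
  have h2 : 0 ≤ ell t := by linarith [one_le_ell t]
  calc ell t ^ 2 ≤ (4 * (|t| + 4) ^ (1/4 : ℝ)) ^ 2 := by gcongr
    _ = 16 * (|t| + 4) ^ (1/2 : ℝ) := by
        rw [mul_pow, ← Real.rpow_natCast ((|t| + 4) ^ (1/4 : ℝ)) 2, ← Real.rpow_mul (by positivity)]; norm_num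
    _ ≤ 16 * (4 * (1 + |t|)) ^ (1/2 : ℝ) := by gcongr; linarith
    _ = _ := by
        rw [Real.mul_rpow (by norm_num) (by positivity)]
        rw [show (4:ℝ) = 2 ^ (2:ℝ) by norm_num, ← Real.rpow_mul (by norm_num)]; norm_num; ring

lemma summable_ell : Summable fun n : ℤ => ell n ^ 2 / (1 + |(n:ℝ)|) ^ 2 := by
  have hmain : Summable fun n : ℤ => 32 * (1 + |(n:ℝ)|) ^ (-(3/2) : ℝ) := by
    refine Summable.mul_left _ ?_
    have hN : Summable fun n : ℕ => (1 + (n:ℝ)) ^ (-(3/2) : ℝ) := by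
      have := (summable_nat_add_iff 1).2 (Real.summable_nat_rpow.2 (show -(3/2 : ℝ) < -1 by norm_num))
      refine this.congr fun n => ?_
      push_cast; rw [add_comm]
    refine Summable.of_nat_of_neg ?_ ?_
    · simpa using hN
    · simpa using hN
  refine Summable.of_nonneg_of_le (fun n => by positivity) (fun n => ?_) hmain
  have hp : 0 < 1 + |(n:ℝ)| := by positivity
  rw [div_le_iff₀ (by positivity), mul_assoc, ← Real.rpow_natCast (1 + |(n:ℝ)|) 2, ← Real.rpow_add hp]
  norm_num
  have := ell_sq_le n
  norm_num at this
  exact this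

lemma norm_s_ge (w : ℂ) (hw : 0 ≤ w.re) : 1 + |w.im| ≤ 3 * ‖w + 1/2‖ := by
  have h1 := Complex.abs_re_le_norm (w + 1/2)
  have h2 := Complex.abs_im_le_norm (w + 1/2)
  simp at h1 h2
  have := le_abs_self (w.re + 2⁻¹)
  rw [one_div]
  linarith

lemma Lf_diffOn (hRH : RHyp) : DifferentiableOn ℂ Lf {w | 0 < w.re} := by
  intro w hw
  have hw' : 0 < w.re := hw
  have h1 : riemannZeta₁ (w + 1/2) ≠ 0 := zeta1_ne_zero_of_half hRH (by simp; linarith)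
  have h2 : w + 1/2 ≠ 0 := by
    intro h; have := congrArg Complex.re h; simp at this; linarith
  have h3 : DifferentiableAt ℂ (fun z => logDeriv riemannZeta₁ (z + 1/2)) w := by
    have a1 : DifferentiableAt ℂ (logDeriv riemannZeta₁) (w + 1/2) := by
      have := (differentiable_riemannZeta₁.analyticAt (w + 1/2)).deriv.differentiableAt
      exact this.div (differentiable_riemannZeta₁ _) h1
    exact DifferentiableAt.fun_comp' w a1 (by fun_prop)
  refine DifferentiableAt.differentiableWithinAt ?_
  unfold Lf
  exact ((h3.add_const 1).neg).fun_div (by fun_prop) h2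

lemma Lf_cont (hRH : RHyp) {σ : ℝ} (hσ : 0 < σ) : Continuous fun t : ℝ => Lf (σ + t * Complex.I) :=
  (Lf_diffOn hRH).continuousOn.comp_continuous (by fun_prop) fun t => by simp [hσ]

/-- general window bound: -/
lemma norm_logDeriv_le (hRH : RHyp) : ∃ C > 0, ∀ T σ t : ℝ, 0 < σ → σ ≤ 1 → |t - T| ≤ 1/2 →
    ‖logDeriv riemannZeta₁ (σ + t * Complex.I + 1/2)‖ ≤
      ∑ γ ∈ zs (T - 1) (T + 1), (mz γ : ℝ) / Real.sqrt (σ ^ 2 + (t - γ) ^ 2) + C * ell T := by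
  obtain ⟨C, hC, h⟩ := local_bound hRH
  refine ⟨C, hC, fun T σ t hσ hσ1 ht => ?_⟩
  have h1 := h T (σ + t * Complex.I + 1/2) (by simp [hσ]) (by simp; linarith) (by simpa using ht)
  have h2 := norm_le_norm_add_norm_sub (∑ γ ∈ zs (T - 1) (T + 1), (mz γ : ℂ) / ((σ + t * Complex.I + 1/2) - rp γ))
    (logDeriv riemannZeta₁ (σ + t * Complex.I + 1/2))
  rw [norm_sub_rev] at h2
  refine h2.trans (add_le_add ?_ h1)
  refine (norm_sum_le _ _).trans (Finset.sum_le_sum fun γ _ => ?_)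
  rw [norm_div]
  have : ‖(σ + t * Complex.I + 1/2) - rp γ‖ = Real.sqrt (σ ^ 2 + (t - γ) ^ 2) := by
    rw [Complex.norm_def, Complex.normSq_apply]; simp; ring_nf
  rw [this]; simp

lemma Lf_pointwise (hRH : RHyp) : ∃ C > 0, ∀ σ t : ℝ, 0 < σ → σ ≤ 1 →
    ‖Lf (σ + t * Complex.I)‖ ≤ C / σ := by
  obtain ⟨C₀, hC₀, hc⟩ := count_bound
  obtain ⟨C, hC, h⟩ := norm_logDeriv_le hRH
  refine ⟨9 * (C₀ + C + 1), by positivity, fun σ t hσ hσ1 => ?_⟩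
  have h1 := h t σ t hσ hσ1 (by simp)
  have h2 : ∑ γ ∈ zs (t - 1) (t + 1), (mz γ : ℝ) / Real.sqrt (σ ^ 2 + (t - γ) ^ 2) ≤ C₀ * ell t / σ := by
    refine le_trans (Finset.sum_le_sum (g := fun γ => (mz γ : ℝ) / σ) fun γ _ => ?_) ?_
    · gcongr
      exact Real.le_sqrt_of_sq_le (by nlinarith [sq_nonneg (t - γ)])
    · rw [← Finset.sum_div]; gcongr; exact hc t
  have he := one_le_ell t
  have h3 : ‖logDeriv riemannZeta₁ (σ + t * Complex.I + 1/2) + 1‖ ≤ (C₀ + C + 1) * ell t / σ := by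
    refine (norm_add_le _ _).trans ?_
    have a1 : C * ell t ≤ C * ell t / σ := by
      rw [le_div_iff₀ hσ]; exact mul_le_of_le_one_right (by positivity) hσ1
    have a2 : 1 ≤ ell t / σ := by
      rw [le_div_iff₀ hσ]; linarith
    simp only [norm_one]
    calc _ ≤ C₀ * ell t / σ + C * ell t / σ + ell t / σ := by linarith
      _ = _ := by ring
  have h4 := norm_s_ge (σ + t * Complex.I) (by simp [hσ.le])
  simp only [Complex.add_im, Complex.ofReal_im, Complex.mul_im, Complex.ofReal_re, Complex.I_im, mul_one, Complex.I_re, mul_zero, add_zero, zero_add] at h4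
  have h5 := ell_le t
  have h6 : 0 < ‖(σ + t * Complex.I : ℂ) + 1/2‖ := by
    have := abs_nonneg t; linarith
  rw [Lf, norm_div, norm_neg, div_le_iff₀ h6]
  refine h3.trans ?_
  calc (C₀ + C + 1) * ell t / σ ≤ (C₀ + C + 1) * (9 * ‖(σ + t * Complex.I : ℂ) + 1/2‖) / σ := by
        gcongr; linarith
    _ = _ := by ring

lemma integral_poisson {σ : ℝ} (hσ : 0 < σ) (γ : ℝ) :
    Integrable (fun t : ℝ => 1 / (σ ^ 2 + (t - γ) ^ 2)) ∧
    ∫ t : ℝ, 1 / (σ ^ 2 + (t - γ) ^ 2) = Real.pi / σ := by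
  have e : ∀ t : ℝ, 1 / (σ ^ 2 + t ^ 2) = (1 / σ ^ 2) * (1 + (t / σ) ^ 2)⁻¹ := by
    intro t; field_simp
  constructor
  · have : Integrable (fun t : ℝ => 1 / (σ ^ 2 + t ^ 2)) := by
      simp_rw [e]
      exact (integrable_inv_one_add_sq.comp_div hσ.ne').const_mul _
    exact this.comp_sub_right γ
  · rw [integral_sub_right_eq_self (fun t : ℝ => 1 / (σ ^ 2 + t ^ 2))]
    simp_rw [e]
    rw [integral_const_mul, Measure.integral_comp_div (fun t : ℝ => (1 + t ^ 2)⁻¹), integral_univ_inv_one_add_sq]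
    rw [abs_of_pos hσ]; simp; field_simp

lemma Lf_window (hRH : RHyp) : ∃ C > 0, ∀ σ : ℝ, ∀ n : ℤ, 0 < σ → σ ≤ 1 →
    ∫⁻ t in Set.Icc ((n:ℝ) - 1/2) (n + 1/2), ENNReal.ofReal (‖Lf (σ + t * Complex.I)‖ ^ 2) ≤
      ENNReal.ofReal (C / σ * (ell n ^ 2 / (1 + |(n:ℝ)|) ^ 2)) := by
  obtain ⟨C₀, hC₀, hc⟩ := count_bound
  obtain ⟨C, hC, h⟩ := norm_logDeriv_le hRH
  refine ⟨72 * (2 * Real.pi * C₀ ^ 2 + 2 * C ^ 2 + 1), by positivity, fun σ n hσ hσ1 => ?_⟩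
  set S := zs ((n:ℝ) - 1) (n + 1) with hS
  set N : ℝ := ∑ γ ∈ S, (mz γ : ℝ) with hN
  have hN0 : 0 ≤ N := Finset.sum_nonneg fun _ _ => by positivity
  have hNle : N ≤ C₀ * ell n := hc n
  have hell := one_le_ell n
  set B : ℝ := 72 / (1 + |(n:ℝ)|) ^ 2 with hB
  have hB0 : 0 < B := by positivity
  let G : ℝ → ℝ := fun t => B * (2 * N * (∑ γ ∈ S, (mz γ : ℝ) * (1 / (σ ^ 2 + (t - γ) ^ 2))) + (2 * C ^ 2 * ell n ^ 2 + 1))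
  have hpt : ∀ t ∈ Set.Icc ((n:ℝ) - 1/2) (n + 1/2), ‖Lf (σ + t * Complex.I)‖ ^ 2 ≤ G t := by
    intro t ht
    have htn : |t - n| ≤ 1/2 := by rw [abs_le]; constructor <;> linarith [ht.1, ht.2]
    have h1 := h n σ t hσ hσ1 htn
    have hcs : (∑ γ ∈ S, (mz γ : ℝ) / Real.sqrt (σ ^ 2 + (t - γ) ^ 2)) ^ 2 ≤
        N * ∑ γ ∈ S, (mz γ : ℝ) * (1 / (σ ^ 2 + (t - γ) ^ 2)) := by
      refine Finset.sum_sq_le_sum_mul_sum_of_sq_eq_mul _ (fun _ _ => by positivity) (fun _ _ => by positivity) fun γ _ => ?_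
      rw [div_pow, Real.sq_sqrt (by positivity)]; ring
    have h4 := norm_s_ge (σ + t * Complex.I) (by simp [hσ.le])
    simp only [Complex.add_im, Complex.ofReal_im, Complex.mul_im, Complex.ofReal_re, Complex.I_im, mul_one, Complex.I_re, mul_zero, add_zero, zero_add] at h4
    have h6 : 0 < ‖(σ + t * Complex.I : ℂ) + 1/2‖ := by
      have := abs_nonneg t; linarith
    have h7 : 1 + |(n:ℝ)| ≤ 6 * ‖(σ + t * Complex.I : ℂ) + 1/2‖ := by
      have : |(n:ℝ)| ≤ |t| + 1/2 := by
        have := abs_sub_abs_le_abs_sub (n:ℝ) t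
        rw [abs_sub_comm] at this; linarith
      linarith [abs_nonneg t]
    have hld : ‖logDeriv riemannZeta₁ (σ + t * Complex.I + 1/2)‖ ^ 2 ≤
        2 * (N * ∑ γ ∈ S, (mz γ : ℝ) * (1 / (σ ^ 2 + (t - γ) ^ 2))) + 2 * (C * ell n) ^ 2 := by
      have : ‖logDeriv riemannZeta₁ (σ + t * Complex.I + 1/2)‖ ^ 2 ≤ (∑ γ ∈ S, (mz γ : ℝ) / Real.sqrt (σ ^ 2 + (t - γ) ^ 2) + C * ell n) ^ 2 := by
        gcongr
      nlinarith [sq_nonneg ((∑ γ ∈ S, (mz γ : ℝ) / Real.sqrt (σ ^ 2 + (t - γ) ^ 2)) - C * ell n)]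
    have hadd : ‖logDeriv riemannZeta₁ (σ + t * Complex.I + 1/2) + 1‖ ^ 2 ≤ 2 * ‖logDeriv riemannZeta₁ (σ + t * Complex.I + 1/2)‖ ^ 2 + 2 := by
      have a1 := norm_add_le (logDeriv riemannZeta₁ (σ + t * Complex.I + 1/2)) 1
      rw [norm_one] at a1
      have : ‖logDeriv riemannZeta₁ (σ + t * Complex.I + 1/2) + 1‖ ^ 2 ≤ (‖logDeriv riemannZeta₁ (σ + t * Complex.I + 1/2)‖ + 1) ^ 2 := by gcongr
      nlinarith [sq_nonneg (‖logDeriv riemannZeta₁ (σ + t * Complex.I + 1/2)‖ - 1)]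
    rw [Lf, norm_div, norm_neg, div_pow]
    have hD : (1 + |(n:ℝ)|) ^ 2 ≤ 36 * ‖(σ + t * Complex.I : ℂ) + 1/2‖ ^ 2 := by
      have : (1 + |(n:ℝ)|) ^ 2 ≤ (6 * ‖(σ + t * Complex.I : ℂ) + 1/2‖) ^ 2 := by gcongr
      nlinarith
    calc ‖logDeriv riemannZeta₁ (σ + t * Complex.I + 1/2) + 1‖ ^ 2 / ‖(σ + t * Complex.I : ℂ) + 1/2‖ ^ 2
        ≤ ‖logDeriv riemannZeta₁ (σ + t * Complex.I + 1/2) + 1‖ ^ 2 / ((1 + |(n:ℝ)|) ^ 2 / 36) := by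
          gcongr; linarith
      _ = (B / 2) * ‖logDeriv riemannZeta₁ (σ + t * Complex.I + 1/2) + 1‖ ^ 2 := by rw [hB]; field_simp; ring
      _ ≤ (B / 2) * (2 * (2 * (N * ∑ γ ∈ S, (mz γ : ℝ) * (1 / (σ ^ 2 + (t - γ) ^ 2))) + 2 * (C * ell n) ^ 2) + 2) := by
          gcongr; linarith
      _ = G t := by simp only [G]; ring
  have hG1 : IntegrableOn (fun t : ℝ => ∑ γ ∈ S, (mz γ : ℝ) * (1 / (σ ^ 2 + (t - γ) ^ 2))) (Set.Icc ((n:ℝ) - 1/2) (n + 1/2)) :=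
    (integrable_finsetSum _ fun γ _ => ((integral_poisson hσ γ).1.const_mul _)).integrableOn
  have hc1 : IntegrableOn (fun _ : ℝ => (2 * C ^ 2 * ell n ^ 2 + 1)) (Set.Icc ((n:ℝ) - 1/2) (n + 1/2)) :=
    integrableOn_const (by simp)
  have hGi : IntegrableOn G (Set.Icc ((n:ℝ) - 1/2) (n + 1/2)) :=
    ((hG1.const_mul _).add hc1).const_mul _
  have hGn : ∀ t, 0 ≤ G t := fun t => by
    have : 0 ≤ ∑ γ ∈ S, (mz γ : ℝ) * (1 / (σ ^ 2 + (t - γ) ^ 2)) := Finset.sum_nonneg fun _ _ => by positivity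
    simp only [G]; positivity
  calc ∫⁻ t in Set.Icc ((n:ℝ) - 1/2) (n + 1/2), ENNReal.ofReal (‖Lf (σ + t * Complex.I)‖ ^ 2)
      ≤ ∫⁻ t in Set.Icc ((n:ℝ) - 1/2) (n + 1/2), ENNReal.ofReal (G t) :=
        setLIntegral_mono' measurableSet_Icc fun t ht => ENNReal.ofReal_le_ofReal (hpt t ht)
    _ = ENNReal.ofReal (∫ t in Set.Icc ((n:ℝ) - 1/2) (n + 1/2), G t) :=
        (ofReal_integral_eq_lintegral_ofReal hGi (Eventually.of_forall hGn)).symm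
    _ ≤ _ := by
        refine ENNReal.ofReal_le_ofReal ?_
        simp only [G]
        rw [integral_const_mul, integral_add (hG1.const_mul _) hc1, integral_const_mul, integral_finsetSum _ (fun γ _ => ((integral_poisson hσ γ).1.const_mul _).integrableOn)]
        have hs : ∑ γ ∈ S, ∫ t in Set.Icc ((n:ℝ) - 1/2) (n + 1/2), (mz γ : ℝ) * (1 / (σ ^ 2 + (t - γ) ^ 2)) ≤ N * (Real.pi / σ) := by
          rw [hN, Finset.sum_mul]
          refine Finset.sum_le_sum fun γ _ => ?_
          rw [integral_const_mul]
          gcongr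
          rw [← (integral_poisson hσ γ).2]
          exact setIntegral_le_integral (integral_poisson hσ γ).1 (Eventually.of_forall fun t => by positivity)
        have hv : ∫ t in Set.Icc ((n:ℝ) - 1/2) (n + 1/2), (2 * C ^ 2 * ell n ^ 2 + 1) = (2 * C ^ 2 * ell n ^ 2 + 1) := by
          simp [Measure.real]; norm_num
        rw [hv]
        have hq : 2 * C ^ 2 * ell n ^ 2 + 1 ≤ (2 * C ^ 2 + 1) * ell n ^ 2 / σ := by
          rw [le_div_iff₀ hσ]
          have : 2 * C ^ 2 * ell n ^ 2 + 1 ≤ (2 * C ^ 2 + 1) * ell n ^ 2 := by nlinarith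
          refine le_trans ?_ this
          exact mul_le_of_le_one_right (by positivity) hσ1
        calc _ ≤ B * (2 * N * (N * (Real.pi / σ)) + (2 * C ^ 2 + 1) * ell n ^ 2 / σ) := by
              gcongr
          _ ≤ B * (2 * (C₀ * ell n) * ((C₀ * ell n) * (Real.pi / σ)) + (2 * C ^ 2 + 1) * ell n ^ 2 / σ) := by
              gcongr
          _ = _ := by rw [hB]; field_simp; ring

lemma Lf_L2 (hRH : RHyp) : ∃ C > 0, ∀ σ : ℝ, 0 < σ → σ ≤ 1 →
    Integrable (fun t : ℝ => ‖Lf (σ + t * Complex.I)‖ ^ 2) ∧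
    ∫ t : ℝ, ‖Lf (σ + t * Complex.I)‖ ^ 2 ≤ C / σ := by
  obtain ⟨C, hC, h⟩ := Lf_window hRH
  set D := ∑' n : ℤ, ell n ^ 2 / (1 + |(n:ℝ)|) ^ 2 with hD
  have hD0 : 0 ≤ D := tsum_nonneg fun n => by positivity
  refine ⟨C * (D + 1), by positivity, fun σ hσ hσ1 => ?_⟩
  have hcov : ⋃ n : ℤ, Set.Icc ((n:ℝ) - 1/2) (n + 1/2) = Set.univ := by
    rw [Set.eq_univ_iff_forall]; intro x
    refine Set.mem_iUnion.2 ⟨round x, ?_⟩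
    have := abs_sub_round x
    rw [abs_le] at this
    constructor <;> linarith
  have hle : ∫⁻ t : ℝ, ENNReal.ofReal (‖Lf (σ + t * Complex.I)‖ ^ 2) ≤ ENNReal.ofReal (C / σ * D) := by
    rw [← setLIntegral_univ, ← hcov]
    refine (lintegral_iUnion_le _ _).trans ?_
    rw [hD, ← tsum_mul_left, ENNReal.ofReal_tsum_of_nonneg (fun n => by positivity) (summable_ell.mul_left _)]
    exact ENNReal.tsum_le_tsum fun n => h σ n hσ hσ1
  have hcont := Lf_cont hRH hσ
  have hmeas : AEStronglyMeasurable (fun t : ℝ => ‖Lf (σ + t * Complex.I)‖ ^ 2) :=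
    (by fun_prop : Continuous (fun t : ℝ => ‖Lf (σ + t * Complex.I)‖ ^ 2)).aestronglyMeasurable
  refine ⟨⟨hmeas, ?_⟩, ?_⟩
  · rw [hasFiniteIntegral_iff_ofReal (Eventually.of_forall fun t => by positivity)]
    exact hle.trans_lt ENNReal.ofReal_lt_top
  · rw [integral_eq_lintegral_of_nonneg_ae (Eventually.of_forall fun t => by positivity) hmeas]
    refine ENNReal.toReal_le_of_le_ofReal (by positivity) (hle.trans (ENNReal.ofReal_le_ofReal ?_))
    calc C / σ * D ≤ C / σ * (D + 1) := by gcongr; linarith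
      _ = _ := by ring

end RS

namespace RS

lemma ift_cont {h : ℝ → ℂ} (hi : Integrable h) : Continuous (ift h) := by
  unfold ift
  refine continuous_of_dominated (bound := fun t => ‖h t‖) (fun y => ?_) (fun y => ?_) hi.norm ?_
  · exact hi.1.mul (Continuous.aestronglyMeasurable (by fun_prop))
  · refine Eventually.of_forall fun t => ?_
    rw [norm_mul, norm_expI, mul_one]
  · exact Eventually.of_forall fun t => by fun_prop

lemma ift_norm_le (h : ℝ → ℂ) (y : ℝ) : ‖ift h y‖ ≤ ∫ t, ‖h t‖ := by
  unfold ift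
  refine (norm_integral_le_integral_norm _).trans (le_of_eq ?_)
  simp_rw [norm_mul, norm_expI, mul_one]

lemma ift_sq_integrable {h : ℝ → ℂ} (hi : Integrable h) {δ : ℝ} (hδ : 0 < δ) :
    Integrable fun y => ‖ift h y‖ ^ 2 * Real.exp (-δ * y ^ 2) := by
  refine (gauss_integrable hδ).bdd_mul (c := (∫ t, ‖h t‖) ^ 2) ?_ ?_
  · exact ((ift_cont hi).norm.pow 2).aestronglyMeasurable
  · refine Eventually.of_forall fun y => ?_
    rw [norm_pow, norm_norm]
    exact pow_le_pow_left₀ (norm_nonneg _) (ift_norm_le h y) 2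

/-- smoothed function -/
def Jf (ε y : ℝ) : ℝ := ∫ v, fF v * (Real.sqrt (Real.pi / ε) * Real.exp (-(y - v) ^ 2 / (4 * ε)))

lemma norm_gw {ε : ℝ} (σ t : ℝ) : ‖Complex.exp (ε * (σ + t * Complex.I) ^ 2)‖ =
    Real.exp (ε * σ ^ 2) * Real.exp (-ε * t ^ 2) := by
  rw [Complex.norm_exp, ← Real.exp_add]
  congr 1
  simp [pow_two]; ring

lemma gw_cont (ε σ : ℝ) : Continuous fun t : ℝ => Complex.exp (ε * (σ + t * Complex.I) ^ 2) := by
  fun_prop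

lemma hh_integrable (hRH : RHyp) {ε σ : ℝ} (hε : 0 < ε) (hσ : 0 < σ) (hσ1 : σ ≤ 1) :
    Integrable fun t : ℝ => Lf (σ + t * Complex.I) * Complex.exp (ε * (σ + t * Complex.I) ^ 2) := by
  obtain ⟨C, hC, h⟩ := Lf_pointwise hRH
  refine Integrable.bdd_mul (c := C / σ) ?_ ?_ ?_
  · refine (((gauss_integrable hε).const_mul (Real.exp (ε * σ ^ 2))).mono' (gw_cont ε σ).aestronglyMeasurable ?_)
    exact Eventually.of_forall fun t => (norm_gw σ t).le
  · exact (Lf_cont hRH hσ).aestronglyMeasurable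
  · exact Eventually.of_forall fun t => h σ t hσ hσ1

lemma Jf_eq1 {ε : ℝ} (hε : 0 < ε) (y : ℝ) :
    (Jf ε y : ℂ) = ∫ t : ℝ, Lf ((1:ℝ) + t * Complex.I) * Complex.exp (ε * ((1:ℝ) + t * Complex.I) ^ 2) *
      Complex.exp (((1:ℝ) + t * Complex.I) * y) := by
  have e1 : ∀ t : ℝ, Lf ((1:ℝ) + t * Complex.I) * Complex.exp (ε * ((1:ℝ) + t * Complex.I) ^ 2) *
      Complex.exp (((1:ℝ) + t * Complex.I) * y) = ∫ v : ℝ, (fF v : ℂ) * Complex.exp (-(1:ℂ) * v) * 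
        (Complex.exp (ε * ((1:ℝ) + t * Complex.I) ^ 2) * Complex.exp (((1:ℝ) + t * Complex.I) * y)
         * Complex.exp (Complex.I * ((-t:ℝ):ℂ) * v)) := by
    intro t
    rw [← fF_laplace1 (w := (1:ℝ) + t * Complex.I) (by simp; norm_num), mul_assoc, ← integral_mul_const]
    congr 1; ext v
    rw [show (-(((1:ℝ):ℂ) + t * Complex.I) * v) = -(1:ℂ) * v + Complex.I * ((-t:ℝ):ℂ) * v by push_cast; ring, Complex.exp_add]
    ring
  simp_rw [e1]
  rw [integral_integral_swap]
  · rw [Jf, ← integral_complex_ofReal]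
    congr 1; ext v
    rw [integral_const_mul]
    have : ∀ t : ℝ, (Complex.exp (ε * ((1:ℝ) + t * Complex.I) ^ 2) * Complex.exp (((1:ℝ) + t * Complex.I) * y)
         * Complex.exp (Complex.I * ((-t:ℝ):ℂ) * v)) = (Real.exp (ε + y) : ℂ) *
         (Complex.exp (Complex.I * ((2 * ε + y - v : ℝ) : ℂ) * t) * (Real.exp (-ε * t ^ 2) : ℂ)) := by
      intro t
      push_cast
      rw [← Complex.exp_add, ← Complex.exp_add, ← Complex.exp_add, ← Complex.exp_add]
      congr 1
      linear_combination (ε * t ^ 2 : ℂ) * Complex.I_sq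
    simp_rw [this]
    rw [integral_const_mul, gauss_ft hε]
    rw [show (-(1:ℂ) * v) = ((-v : ℝ) : ℂ) by push_cast; ring, ← Complex.ofReal_exp]
    norm_cast
    have : Real.exp (-(y-v)^2/(4*ε)) = Real.exp (-v) * Real.exp (ε + y) * Real.exp (-(2 * ε + y - v) ^ 2 / (4 * ε)) := by
      rw [← Real.exp_add, ← Real.exp_add]; congr 1; field_simp; ring
    rw [this]; ring
  · have a1 : Integrable fun t : ℝ => Complex.exp (ε * ((1:ℝ) + t * Complex.I) ^ 2) * Complex.exp (((1:ℝ) + t * Complex.I) * y) := by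
      refine ((gauss_integrable hε).const_mul (Real.exp ε * Real.exp y)).mono' (Continuous.aestronglyMeasurable (by fun_prop)) ?_
      refine Eventually.of_forall fun t => ?_
      rw [norm_mul, norm_gw]
      have : ‖Complex.exp ((((1:ℝ):ℂ) + t * Complex.I) * y)‖ = Real.exp y := by
        rw [Complex.norm_exp]; simp
      rw [this]; simp; ring_nf; rfl
    have a2 := fF_laplace_integrable (w := 1) (by simp; norm_num)
    have a3 := Integrable.mul_prod a1 a2
    have a4 := a3.bdd_mul (c := 1) (f := fun q : ℝ × ℝ => Complex.exp (Complex.I * ((-q.1 : ℝ) : ℂ) * q.2))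
      (Continuous.aestronglyMeasurable (by fun_prop)) (Eventually.of_forall fun q => (norm_expI _ _).le)
    refine a4.congr (Eventually.of_forall fun q => ?_)
    simp only [Function.uncurry]; ring

lemma Jf_eq (hRH : RHyp) {ε σ : ℝ} (hε : 0 < ε) (hσ : 0 < σ) (hσ1 : σ ≤ 1) (y : ℝ) :
    (Jf ε y : ℂ) = Complex.exp (σ * y) *
      ift (fun t : ℝ => Lf (σ + t * Complex.I) * Complex.exp (ε * (σ + t * Complex.I) ^ 2)) y := by
  obtain ⟨C, hC, h⟩ := Lf_pointwise hRH
  rw [Jf_eq1 hε, ift, ← integral_const_mul]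
  have := contour_shift (F := fun w => Lf w * Complex.exp (ε * w ^ 2) * Complex.exp (w * y)) (a := σ) (b := 1)
    (h := fun t => (C / σ * Real.exp ε * Real.exp |y|) * Real.exp (-ε * t ^ 2)) hσ1 ?_ ?_ ?_ ?_ ?_
  · rw [← this]
    congr 1; ext t
    rw [show ((σ:ℂ) + t * Complex.I) * y = σ * y + Complex.I * t * y by ring, Complex.exp_add]
    ring
  · have : DifferentiableOn ℂ Lf {z | σ ≤ z.re ∧ z.re ≤ 1} := (Lf_diffOn hRH).mono fun z hz => lt_of_lt_of_le hσ hz.1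
    fun_prop
  · exact (gauss_integrable hε).const_mul _
  · have : Tendsto (fun t : ℝ => Real.exp (-ε * t ^ 2)) atTop (𝓝 0) := by
      refine Real.tendsto_exp_atBot.comp ?_
      exact (tendsto_pow_atTop (by norm_num)).const_mul_atTop_of_neg (by linarith)
    simpa using this.const_mul (C / σ * Real.exp ε * Real.exp |y|)
  · have : Tendsto (fun t : ℝ => Real.exp (-ε * t ^ 2)) atBot (𝓝 0) := by
      refine Real.tendsto_exp_atBot.comp ?_
      have h2 : Tendsto (fun t : ℝ => t ^ 2) atBot atTop := by
        have := (tendsto_pow_atTop (α := ℝ) (n := 2) (by norm_num)).comp tendsto_neg_atBot_atTop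
        refine this.congr fun t => by simp
      exact h2.const_mul_atTop_of_neg (by linarith)
    simpa using this.const_mul (C / σ * Real.exp ε * Real.exp |y|)
  · intro x t hx hx1
    have hx0 : 0 < x := by linarith
    rw [norm_mul, norm_mul, norm_gw]
    have e1 : ‖Complex.exp (((x:ℂ) + t * Complex.I) * y)‖ ≤ Real.exp |y| := by
      rw [Complex.norm_exp]; simp
      calc x * y ≤ x * |y| := by gcongr; exact le_abs_self y
        _ ≤ 1 * |y| := by gcongr
        _ = |y| := one_mul _
    have e2 : ‖Lf (x + t * Complex.I)‖ ≤ C / σ := (h x t hx0 hx1).trans (by gcongr)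
    have e3 : Real.exp (ε * x ^ 2) ≤ Real.exp ε := by
      gcongr
      nlinarith [mul_nonneg hε.le (show 0 ≤ 1 - x^2 by nlinarith)]
    calc _ ≤ (C / σ) * (Real.exp ε * Real.exp (-ε * t ^ 2)) * Real.exp |y| := by gcongr
      _ = _ := by ring

lemma fF_cont_ae : ∀ᵐ y : ℝ, ContinuousAt fF y := by
  have hm : Monotone fun y : ℝ => Chebyshev.psi (Real.exp y) :=
    fun a b hab => Chebyshev.psi_mono (Real.exp_le_exp.2 hab)
  have hc := hm.countable_not_continuousAt
  have h2 : ({x : ℝ | ¬ ContinuousAt (fun y : ℝ => Chebyshev.psi (Real.exp y)) x} ∪ {0}).Countable :=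
    hc.union (Set.countable_singleton 0)
  have := h2.ae_notMem volume
  filter_upwards [this] with y hy
  simp at hy
  rcases lt_or_gt_of_ne hy.1 with h | h
  · have : fF =ᶠ[𝓝 y] fun _ => 0 := by
      filter_upwards [Iio_mem_nhds h] with z hz using fF_nonpos hz.le
    exact continuousAt_const.congr this.symm
  · have : fF =ᶠ[𝓝 y] fun y => Real.exp (-y / 2) * (Chebyshev.psi (Real.exp y) - Real.exp y) := by
      filter_upwards [Ioi_mem_nhds h] with z hz
      have : 0 < z := hz
      simp [fF, this]
    refine ContinuousAt.congr ?_ this.symm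
    have h1 := hy.2
    fun_prop

lemma Jf_subst {ε : ℝ} (hε : 0 < ε) (y : ℝ) :
    Jf ε y = 2 * Real.sqrt Real.pi * ∫ z, fF (y + 2 * Real.sqrt ε * z) * Real.exp (-1 * z ^ 2) := by
  have hs : 0 < Real.sqrt ε := Real.sqrt_pos.2 hε
  have hs2 : Real.sqrt ε ^ 2 = ε := Real.sq_sqrt hε.le
  set G : ℝ → ℝ := fun v => fF v * (Real.sqrt (Real.pi / ε) * Real.exp (-(y - v) ^ 2 / (4 * ε))) with hG
  have h1 : Jf ε y = ∫ u, G (y + u) := by rw [integral_add_left_eq_self]; rfl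
  have h2 := Measure.integral_comp_mul_left (fun u => G (y + u)) (2 * Real.sqrt ε)
  rw [h1]
  rw [abs_of_pos (by positivity), smul_eq_mul] at h2
  have h3 : ∫ u, G (y + u) = (2 * Real.sqrt ε) * ∫ z, G (y + 2 * Real.sqrt ε * z) := by
    rw [h2]; field_simp
  rw [h3]
  rw [← integral_const_mul, ← integral_const_mul]
  congr 1; ext z
  simp only [hG]
  rw [Real.sqrt_div Real.pi_pos.le]
  rw [show -(y - (y + 2 * Real.sqrt ε * z)) ^ 2 / (4 * ε) = -1 * z ^ 2 by
    rw [show y - (y + 2 * Real.sqrt ε * z) = -(2 * Real.sqrt ε * z) by ring, neg_sq, mul_pow, mul_pow, hs2]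
    field_simp; ring]
  field_simp

lemma Jf_tendsto {y : ℝ} (hy : ContinuousAt fF y) {e : ℕ → ℝ} (he : ∀ n, 0 < e n) (he1 : ∀ n, e n ≤ 1)
    (hl : Tendsto e atTop (𝓝 0)) : Tendsto (fun n => Jf (e n) y) atTop (𝓝 (2 * Real.pi * fF y)) := by
  simp_rw [fun n => Jf_subst (he n) y]
  have e0 : 2 * Real.pi * fF y = 2 * Real.sqrt Real.pi * ∫ z, fF y * Real.exp (-1 * z ^ 2) := by
    rw [integral_const_mul, integral_gaussian, div_one]
    have := Real.mul_self_sqrt Real.pi_pos.le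
    linear_combination (-2 * fF y) * this
  rw [e0]
  refine Tendsto.const_mul _ ?_
  refine tendsto_integral_of_dominated_convergence
    (fun z => 6 * Real.exp (y / 2) * Real.exp (1/2) * Real.exp (-(1/2) * z ^ 2)) ?_ ?_ ?_ ?_
  · intro n
    have := fF_meas
    exact Measurable.aestronglyMeasurable (by fun_prop)
  · exact (gauss_integrable (by norm_num)).const_mul _
  · intro n
    refine Eventually.of_forall fun z => ?_
    rw [norm_mul, Real.norm_eq_abs, Real.norm_of_nonneg (Real.exp_pos _).le]
    calc _ ≤ 6 * Real.exp ((y + 2 * Real.sqrt (e n) * z) / 2) * Real.exp (-1 * z ^ 2) := by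
          gcongr; exact abs_fF_le _
      _ = 6 * Real.exp (y/2) * Real.exp (Real.sqrt (e n) * z - z ^ 2) := by
          rw [mul_assoc 6, mul_assoc 6, ← Real.exp_add, ← Real.exp_add]; ring_nf
      _ ≤ 6 * Real.exp (y/2) * Real.exp (1/2 + (-(1/2)) * z ^ 2) := by
          gcongr
          have h1 : Real.sqrt (e n) ^ 2 ≤ 1 := by rw [Real.sq_sqrt (he n).le]; exact he1 n
          nlinarith [sq_nonneg (Real.sqrt (e n) - z)]
      _ = _ := by rw [Real.exp_add]; ring
  · refine Eventually.of_forall fun z => ?_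
    refine Tendsto.mul_const _ ?_
    refine hy.tendsto.comp ?_
    have : Tendsto (fun n => y + 2 * Real.sqrt (e n) * z) atTop (𝓝 (y + 2 * Real.sqrt 0 * z)) := by
      have := (Real.continuous_sqrt.tendsto 0).comp hl
      exact ((this.const_mul 2).mul_const z).const_add y
    simpa using this

lemma fF_L2w (hRH : RHyp) : ∃ C > 0, ∀ σ : ℝ, 0 < σ → σ ≤ 1 →
    Integrable (fun y => fF y ^ 2 * Real.exp (-2 * σ * y)) ∧
    ∫ y, fF y ^ 2 * Real.exp (-2 * σ * y) ≤ C / σ := by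
  obtain ⟨C, hC, h⟩ := Lf_L2 hRH
  refine ⟨2 * Real.pi * Real.exp 2 * C, by positivity, fun σ hσ hσ1 => ?_⟩
  set e : ℕ → ℝ := fun n => 1 / ((n:ℝ) + 1) with hedef
  have he : ∀ n, 0 < e n := fun n => by simp only [hedef]; positivity
  have he1 : ∀ n, e n ≤ 1 := fun n => by
    simp only [hedef]; rw [div_le_one (by positivity)]; linarith [Nat.cast_nonneg (α := ℝ) n]
  have hl : Tendsto e atTop (𝓝 0) := tendsto_one_div_add_atTop_nhds_zero_nat
  set hn : ℕ → ℝ → ℂ := fun n t => Lf (σ + t * Complex.I) * Complex.exp (e n * (σ + t * Complex.I) ^ 2) with hhn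
  have hi : ∀ n, Integrable (hn n) := fun n => hh_integrable hRH (he n) hσ hσ1
  have hle : ∀ n t, ‖hn n t‖ ^ 2 ≤ Real.exp 2 * ‖Lf (σ + t * Complex.I)‖ ^ 2 := by
    intro n t
    simp only [hhn]
    rw [norm_mul, norm_gw, mul_pow, mul_comm]
    gcongr
    rw [← Real.exp_add, ← Real.exp_nat_mul, Real.exp_le_exp]
    have : e n * σ ^ 2 ≤ 1 := by
      have := he n; have := he1 n
      nlinarith [show σ ^ 2 ≤ 1 by nlinarith]
    have : 0 ≤ e n * t ^ 2 := by have := he n; positivity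
    push_cast; linarith
  have hi2 : ∀ n, Integrable fun t => ‖hn n t‖ ^ 2 := by
    intro n
    refine ((h σ hσ hσ1).1.const_mul (Real.exp 2)).mono' ?_ ?_
    · exact ((hi n).1.norm.pow 2)
    · refine Eventually.of_forall fun t => ?_
      rw [Real.norm_of_nonneg (by positivity)]; exact hle n t
  set B := 2 * Real.pi * Real.exp 2 * C / σ with hB
  have hB0 : 0 ≤ B := by positivity
  have key : ∀ n, ∫⁻ y, ENNReal.ofReal (‖ift (hn n) y‖ ^ 2 * Real.exp (-(e n) * y ^ 2)) ≤ ENNReal.ofReal B := by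
    intro n
    rw [← ofReal_integral_eq_lintegral_ofReal (ift_sq_integrable (hi n) (he n))
      (Eventually.of_forall fun y => by simp only [Pi.zero_apply]; positivity)]
    refine ENNReal.ofReal_le_ofReal ((plancherel_le (hi n) (hi2 n) (he n)).trans ?_)
    have : ∫ t, ‖hn n t‖ ^ 2 ≤ Real.exp 2 * (C / σ) := by
      calc _ ≤ ∫ t : ℝ, Real.exp 2 * ‖Lf (σ + t * Complex.I)‖ ^ 2 :=
            integral_mono (hi2 n) ((h σ hσ hσ1).1.const_mul _) (hle n)
        _ ≤ _ := by rw [integral_const_mul]; gcongr; exact (h σ hσ hσ1).2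
    calc _ ≤ 2 * Real.pi * (Real.exp 2 * (C / σ)) := by gcongr
      _ = B := by rw [hB]; ring
  have hfatou : ∫⁻ y, ENNReal.ofReal (fF y ^ 2 * Real.exp (-2 * σ * y)) ≤ ENNReal.ofReal B := by
    calc _ ≤ ∫⁻ y, liminf (fun n => ENNReal.ofReal (‖ift (hn n) y‖ ^ 2 * Real.exp (-(e n) * y ^ 2))) atTop := by
          refine lintegral_mono_ae ?_
          filter_upwards [fF_cont_ae] with y hy
          have t1 := Jf_tendsto hy he he1 hl
          have t2 : ∀ n, ‖ift (hn n) y‖ ^ 2 = (Jf (e n) y * Real.exp (-σ * y)) ^ 2 := by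
            intro n
            have := Jf_eq hRH (he n) hσ hσ1 y
            have h3 : ‖ift (hn n) y‖ = |Jf (e n) y| * Real.exp (-σ * y) := by
              rw [← Real.norm_eq_abs, ← Complex.norm_real, this, norm_mul, Complex.norm_exp, mul_right_comm, ← Real.exp_add]
              simp [hhn]
            rw [h3, mul_pow, mul_pow, sq_abs]
          have t3 : Tendsto (fun n => ENNReal.ofReal (‖ift (hn n) y‖ ^ 2 * Real.exp (-(e n) * y ^ 2))) atTop
              (𝓝 (ENNReal.ofReal ((2 * Real.pi * fF y * Real.exp (-σ * y)) ^ 2 * Real.exp (-0 * y ^ 2)))) := by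
            refine ENNReal.tendsto_ofReal ?_
            simp_rw [t2]
            refine ((t1.mul_const _).pow 2).mul ?_
            exact (Real.continuous_exp.tendsto _).comp ((hl.neg).mul_const _)
          rw [t3.liminf_eq]
          refine ENNReal.ofReal_le_ofReal ?_
          simp only [neg_zero, zero_mul, Real.exp_zero, mul_one]
          rw [show Real.exp (-2 * σ * y) = Real.exp (-σ * y) ^ 2 by rw [← Real.exp_nat_mul]; ring_nf]
          rw [← mul_pow]
          rw [show 2 * Real.pi * fF y * Real.exp (-σ * y) = (2 * Real.pi) * (fF y * Real.exp (-σ * y)) by ring, mul_pow (2 * Real.pi)]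
          have : 1 ≤ (2 * Real.pi) ^ 2 := by nlinarith [Real.pi_gt_three]
          nlinarith [sq_nonneg (fF y * Real.exp (-σ * y))]
      _ ≤ liminf (fun n => ∫⁻ y, ENNReal.ofReal (‖ift (hn n) y‖ ^ 2 * Real.exp (-(e n) * y ^ 2))) atTop := by
          refine lintegral_liminf_le fun n => ?_
          have := (ift_cont (hi n)).measurable
          fun_prop
      _ ≤ ENNReal.ofReal B := by
          refine (liminf_le_liminf (Eventually.of_forall key)).trans ?_
          simp
  have hIntg : Integrable (fun y => fF y ^ 2 * Real.exp (-2 * σ * y)) := by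
    refine ⟨?_, ?_⟩
    · have := fF_meas
      exact Measurable.aestronglyMeasurable (by fun_prop)
    · rw [hasFiniteIntegral_iff_ofReal (Eventually.of_forall fun y => by simp only [Pi.zero_apply]; positivity)]
      exact lt_of_le_of_lt hfatou ENNReal.ofReal_lt_top
  refine ⟨hIntg, ?_⟩
  rw [← ofReal_integral_eq_lintegral_ofReal hIntg (Eventually.of_forall fun y => by simp only [Pi.zero_apply]; positivity)] at hfatou
  exact (ENNReal.ofReal_le_ofReal_iff hB0).1 hfatou

end RS

namespace RS

lemma fF_sq_locint (a b : ℝ) : IntegrableOn (fun y => fF y ^ 2) (Set.Icc a b) := by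
  refine Measure.integrableOn_of_bounded (M := (6 * Real.exp (b/2)) ^ 2) (by simp) ?_ ?_
  · have := fF_meas
    exact Measurable.aestronglyMeasurable (by fun_prop)
  · refine (ae_restrict_iff' measurableSet_Icc).2 (Eventually.of_forall fun y hy => ?_)
    rw [norm_pow, Real.norm_eq_abs]
    have := abs_fF_le y
    gcongr
    refine this.trans ?_
    gcongr; exact hy.2

lemma fF_locint (a b : ℝ) : IntegrableOn fF (Set.Icc a b) := by
  refine Measure.integrableOn_of_bounded (M := (6 * Real.exp (b/2))) (by simp) fF_meas.aestronglyMeasurable ?_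
  refine (ae_restrict_iff' measurableSet_Icc).2 (Eventually.of_forall fun y hy => ?_)
  rw [Real.norm_eq_abs]
  refine (abs_fF_le y).trans ?_
  gcongr; exact hy.2

lemma fF_L2 (hRH : RHyp) : ∃ C > 0, ∀ Y : ℝ, 1 ≤ Y → ∫ y in Set.Icc 0 Y, fF y ^ 2 ≤ C * Y := by
  obtain ⟨C, hC, h⟩ := fF_L2w hRH
  refine ⟨Real.exp 2 * C, by positivity, fun Y hY => ?_⟩
  obtain ⟨h1, h2⟩ := h (1 / Y) (by positivity) (by rw [div_le_one (by linarith)]; exact hY)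
  calc ∫ y in Set.Icc 0 Y, fF y ^ 2 ≤ ∫ y in Set.Icc 0 Y, Real.exp 2 * (fF y ^ 2 * Real.exp (-2 * (1/Y) * y)) := by
        refine setIntegral_mono_on (fF_sq_locint 0 Y) ((h1.const_mul _).integrableOn) measurableSet_Icc fun y hy => ?_
        have : 1 ≤ Real.exp 2 * Real.exp (-2 * (1/Y) * y) := by
          rw [← Real.exp_add]
          refine Real.one_le_exp ?_
          have : y / Y ≤ 1 := by rw [div_le_one (by linarith)]; exact hy.2
          rw [show -2 * (1/Y) * y = -2 * (y / Y) by ring]; linarith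
        nlinarith [sq_nonneg (fF y)]
    _ ≤ ∫ y, Real.exp 2 * (fF y ^ 2 * Real.exp (-2 * (1/Y) * y)) :=
        setIntegral_le_integral (h1.const_mul _) (Eventually.of_forall fun y => by simp only [Pi.zero_apply]; positivity)
    _ ≤ Real.exp 2 * (C / (1/Y)) := by rw [integral_const_mul]; gcongr
    _ = _ := by field_simp

lemma fF_abs_exp_int (hRH : RHyp) {σ : ℝ} (hσ : 0 < σ) : Integrable fun y => |fF y| * Real.exp (-σ * y) := by
  obtain ⟨C, hC, h⟩ := fF_L2w hRH
  set τ := min (σ/2) 1 with hτ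
  have hτ0 : 0 < τ := lt_min (by linarith) one_pos
  obtain ⟨h1, -⟩ := h τ hτ0 (min_le_right _ _)
  have hI : IntegrableOn (fun y => |fF y| * Real.exp (-σ * y)) (Set.Ioi 0) := by
    refine Integrable.mono' (g := fun y => fF y ^ 2 * Real.exp (-2 * τ * y) + Real.exp (-(σ) * y)) ?_ ?_ ?_
    · exact h1.integrableOn.add (integrableOn_exp_mul_Ioi (by linarith) 0)
    · have := fF_meas
      exact Measurable.aestronglyMeasurable (by fun_prop)
    · refine (ae_restrict_iff' measurableSet_Ioi).2 (Eventually.of_forall fun y hy => ?_)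
      have hy : 0 < y := hy
      rw [Real.norm_of_nonneg (by positivity)]
      have e1 : Real.exp (-σ * y) ≤ Real.exp (-2 * τ * y) := by
        gcongr; linarith [min_le_left (σ/2) 1]
      have e2 : |fF y| ≤ fF y ^ 2 + 1 := by
        rw [← sq_abs]; nlinarith [sq_nonneg (|fF y| - 1), abs_nonneg (fF y)]
      calc |fF y| * Real.exp (-σ * y) ≤ (fF y ^ 2 + 1) * Real.exp (-σ * y) := by gcongr
        _ = fF y ^ 2 * Real.exp (-σ * y) + Real.exp (-σ * y) := by ring
        _ ≤ _ := by gcongr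
  refine IntegrableOn.integrable_of_forall_notMem_eq_zero hI fun y hy => ?_
  rw [fF_nonpos (by simpa using hy)]; simp

lemma fF_int (hRH : RHyp) {w : ℂ} (hw : 0 < w.re) : Integrable fun y : ℝ => (fF y : ℂ) * Complex.exp (-w * y) := by
  refine (fF_abs_exp_int hRH hw).mono' ?_ ?_
  · have := fF_meas
    exact Measurable.aestronglyMeasurable (by fun_prop)
  · refine Eventually.of_forall fun y => ?_
    rw [norm_mul, norm_cexp_neg, Complex.norm_real, Real.norm_eq_abs]

lemma fF_laplace_hasDeriv (hRH : RHyp) {w : ℂ} (hw : 0 < w.re) :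
    DifferentiableAt ℂ (fun w : ℂ => ∫ y : ℝ, (fF y : ℂ) * Complex.exp (-w * y)) w := by
  have := fF_meas
  have key := hasDerivAt_integral_of_dominated_loc_of_deriv_le (μ := (volume : Measure ℝ)) (𝕜 := ℂ)
    (bound := fun y => (4 / w.re) * (|fF y| * Real.exp (-(w.re/4) * y)))
    (F := fun (w : ℂ) (y : ℝ) => (fF y : ℂ) * Complex.exp (-w * y)) (x₀ := w) (s := {z | w.re / 2 < z.re})
    ((isOpen_lt continuous_const Complex.continuous_re).mem_nhds (by simp; linarith))
    (Eventually.of_forall fun z => Measurable.aestronglyMeasurable (by fun_prop)) (fF_int hRH hw)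
    (F' := fun (w : ℂ) (y : ℝ) => (fF y : ℂ) * (Complex.exp (-w * y) * (-y)))
    (Measurable.aestronglyMeasurable (by fun_prop)) ?_ ((fF_abs_exp_int hRH (by linarith)).const_mul _) ?_
  · exact key.2.differentiableAt
  · refine Eventually.of_forall fun y z hz => ?_
    have hz : w.re / 2 < z.re := hz
    rcases le_or_gt y 0 with hy | hy
    · simp [fF_nonpos hy]
    rw [norm_mul, norm_mul, norm_cexp_neg, Complex.norm_real, norm_neg, Complex.norm_real, Real.norm_eq_abs,
      Real.norm_of_nonneg hy.le]
    have e1 : Real.exp (-z.re * y) ≤ Real.exp (-(w.re/4)*y) * Real.exp (-(w.re / 4) * y) := by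
      rw [← Real.exp_add]; gcongr; nlinarith
    have e2 : Real.exp (-(w.re / 4) * y) * y ≤ 4 / w.re := by
      have := Real.add_one_le_exp (w.re/4*y)
      rw [show -(w.re/4)*y = -(w.re/4*y) by ring, Real.exp_neg, le_div_iff₀ hw, inv_mul_eq_div, div_mul_eq_mul_div, div_le_iff₀ (Real.exp_pos _)]
      nlinarith
    calc |fF y| * (Real.exp (-z.re * y) * y) ≤ |fF y| * (Real.exp (-(w.re/4)*y) * Real.exp (-(w.re / 4) * y) * y) := by gcongr
      _ = |fF y| * Real.exp (-(w.re/4)*y) * (Real.exp (-(w.re / 4) * y) * y) := by ring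
      _ ≤ |fF y| * Real.exp (-(w.re/4)*y) * (4 / w.re) := by gcongr
      _ = _ := by ring
  · refine Eventually.of_forall fun y z hz => ?_
    refine HasDerivAt.const_mul _ ?_
    refine HasDerivAt.cexp ?_
    simpa using ((hasDerivAt_id z).neg.mul_const (y:ℂ))

lemma fF_laplace (hRH : RHyp) {w : ℂ} (hw : 0 < w.re) :
    ∫ y : ℝ, (fF y : ℂ) * Complex.exp (-w * y) = Lf w := by
  have ho : IsOpen {z : ℂ | 0 < z.re} := isOpen_lt continuous_const Complex.continuous_re
  have h1 : AnalyticOnNhd ℂ (fun w : ℂ => ∫ y : ℝ, (fF y : ℂ) * Complex.exp (-w * y)) {z | 0 < z.re} :=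
    DifferentiableOn.analyticOnNhd (fun z hz => (fF_laplace_hasDeriv hRH hz).differentiableWithinAt) ho
  have h2 : AnalyticOnNhd ℂ Lf {z | 0 < z.re} := (Lf_diffOn hRH).analyticOnNhd ho
  have hc : IsPreconnected {z : ℂ | 0 < z.re} := (convex_halfSpace_re_gt 0).isPreconnected
  refine h1.eqOn_of_preconnected_of_eventuallyEq h2 hc (z₀ := 1) (by simp) ?_ hw
  filter_upwards [(isOpen_lt continuous_const Complex.continuous_re).mem_nhds (show (1/2 : ℝ) < (1:ℂ).re by norm_num)] with z hz
  exact fF_laplace1 hz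

end RS

namespace RS

set_option maxHeartbeats 2000000 in
lemma gterm {y h : ℝ} (hh : 0 < h) (hh1 : h ≤ 1) (k : ℕ) :
    Real.log (‖((1/4 : ℝ) : ℂ) + y * Complex.I + h + k‖ / ‖((1/4 : ℝ) : ℂ) + y * Complex.I + k‖) ≤
      h * ((1/2) * (Real.log (((k+1 : ℕ):ℝ) ^ 2 + 1 + y ^ 2) - Real.log ((k:ℝ) ^ 2 + 1 + y ^ 2)) + 60 / ((k:ℝ) + 1) ^ 2) := by
  have hk : (0:ℝ) ≤ k := Nat.cast_nonneg k
  set D : ℝ := ((k:ℝ) + 1/4) ^ 2 + y ^ 2 with hD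
  have hD0 : 0 < D := by positivity
  have n1 : ‖((1/4 : ℝ) : ℂ) + y * Complex.I + k‖ = Real.sqrt D := by
    rw [Complex.norm_def, Complex.normSq_apply]; congr 1; simp [hD]; ring
  have n2 : ‖((1/4 : ℝ) : ℂ) + y * Complex.I + h + k‖ = Real.sqrt (D + h * (2 * k + 1/2 + h)) := by
    rw [Complex.norm_def, Complex.normSq_apply]; congr 1; simp [hD]; ring
  rw [n1, n2, ← Real.sqrt_div (by positivity), Real.log_sqrt (by positivity)]
  have e1 : (D + h * (2 * k + 1/2 + h)) / D = 1 + h * (2 * k + 1/2 + h) / D := by field_simp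
  rw [e1]
  have e2 : Real.log (1 + h * (2 * k + 1/2 + h) / D) ≤ h * (2 * k + 1/2 + h) / D := by
    have := Real.log_le_sub_one_of_pos (show 0 < 1 + h * (2 * k + 1/2 + h) / D by positivity)
    linarith
  have e3 : h * (2 * k + 1/2 + h) / D ≤ h * ((2 * k + 2) / D) := by
    rw [mul_div_assoc]; exact mul_le_mul_of_nonneg_left (div_le_div_of_nonneg_right (by linarith) hD0.le) hh.le
  set q : ℝ := (k:ℝ) ^ 2 + 1 + y ^ 2 with hq
  have hq0 : 0 < q := by positivity
  have e4 : ((k+1 : ℕ):ℝ) ^ 2 + 1 + y ^ 2 = q + (2 * k + 1) := by push_cast; rw [hq]; ring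
  have e5 : (2 * k + 1) / q - ((2 * k + 1) / q) ^ 2 ≤ Real.log (q + (2 * k + 1)) - Real.log q := by
    rw [← Real.log_div (by positivity) (by positivity)]
    have h1 := Real.one_sub_inv_le_log_of_pos (show 0 < (q + (2 * k + 1)) / q by positivity)
    refine le_trans ?_ h1
    rw [inv_div, show 1 - q / (q + (2 * k + 1)) = (2 * k + 1) / (q + (2 * k + 1)) by field_simp; ring]
    rw [show (2 * (k:ℝ) + 1) / q - ((2 * k + 1) / q) ^ 2 = (2 * k + 1) * (q - (2 * k + 1)) / q ^ 2 by field_simp,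
      div_le_div_iff₀ (by positivity) (by positivity)]
    have : (q - (2 * k + 1)) * (q + (2 * k + 1)) ≤ q ^ 2 := by nlinarith [sq_nonneg (2 * (k:ℝ) + 1)]
    have h2 := mul_le_mul_of_nonneg_left this (show 0 ≤ 2 * (k:ℝ) + 1 by positivity)
    linarith
  have hDk : ((k:ℝ) + 1) ^ 2 / 16 ≤ D := by rw [hD]; nlinarith [sq_nonneg y]
  have hqk : ((k:ℝ) + 1) ^ 2 / 2 ≤ q := by rw [hq]; nlinarith [sq_nonneg y, sq_nonneg ((k:ℝ) - 1)]
  set m : ℝ := (k:ℝ) + 1 with hm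
  have hm1 : 1 ≤ m := by linarith
  have e6 : ((2 * k + 1) / q) ^ 2 ≤ 16 / m ^ 2 := by
    have : (2 * k + 1) / q ≤ 4 / m := by
      rw [div_le_div_iff₀ hq0 (by linarith)]
      nlinarith
    calc ((2 * k + 1) / q) ^ 2 ≤ (4 / m) ^ 2 := by gcongr
      _ = _ := by ring
  have e7 : (2 * k + 2) / D ≤ (2 * k + 1) / q + 80 / m ^ 2 := by
    have : (2 * k + 2) / D - (2 * k + 1) / q = 1 / D + (2 * k + 1) * (q - D) / (D * q) := by
      clear_value D q
      field_simp; ring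
    have h1 : 1 / D ≤ 16 / m ^ 2 := by rw [div_le_div_iff₀ hD0 (by positivity)]; linarith
    have h2 : (2 * k + 1) * (q - D) / (D * q) ≤ 64 / m ^ 2 := by
      have h3 : (2 * k + 1) * (q - D) ≤ 2 * m := by
        have : q - D ≤ 1 := by rw [hq, hD]; nlinarith
        nlinarith
      calc _ ≤ 2 * m / (D * q) := by gcongr
        _ ≤ 2 * m / ((m ^ 2 / 16) * (m ^ 2 / 2)) := by gcongr
        _ = 64 / m ^ 2 * (1 / m) := by clear_value m; field_simp; norm_num
        _ ≤ 64 / m ^ 2 * 1 := by gcongr; rw [div_le_one (by linarith)]; exact hm1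
        _ = _ := mul_one _
    have h5 : 16 / m ^ 2 + 64 / m ^ 2 = 80 / m ^ 2 := by ring
    linarith
  rw [e4]
  have e8 : (2 * k + 2) / D ≤ (Real.log (q + (2 * k + 1)) - Real.log q) + 120 / m ^ 2 := by
    have : 16 / m ^ 2 + 80 / m ^ 2 ≤ 120 / m ^ 2 := by rw [← add_div]; gcongr; norm_num
    linarith
  have e9 := mul_le_mul_of_nonneg_left e8 hh.le
  have e10 : 120 / m ^ 2 = 2 * (60 / m ^ 2) := by ring
  rw [e10] at e9
  clear_value D q m
  linarith

lemma gamma_diff : ∃ C > 0, ∀ y h : ℝ, 0 < h → h ≤ 1 →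
    h * ((1/2) * Real.log (1 + y ^ 2) - C) ≤
      Real.log (‖Complex.Gamma (((1/4 : ℝ) : ℂ) + y * Complex.I + h)‖ / ‖Complex.Gamma (((1/4 : ℝ) : ℂ) + y * Complex.I)‖) := by
  have hs : Summable fun k : ℕ => 60 / ((k:ℝ) + 1) ^ 2 := by
    have := ((summable_nat_add_iff 1).2 (Real.summable_one_div_nat_pow.2 (show 1 < 2 by norm_num))).mul_left 60
    refine this.congr fun k => ?_
    push_cast; ring
  set S := ∑' k : ℕ, 60 / ((k:ℝ) + 1) ^ 2 with hS
  have hS0 : 0 ≤ S := tsum_nonneg fun k => by positivity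
  refine ⟨S + 1, by positivity, fun y h hh hh1 => ?_⟩
  set s : ℂ := ((1/4 : ℝ) : ℂ) + y * Complex.I with hsdef
  have hre : 0 < s.re := by simp [hsdef]
  have hre2 : 0 < (s + h).re := by simp [hsdef]; linarith
  have g1 := Complex.Gamma_ne_zero_of_re_pos hre
  have g2 := Complex.Gamma_ne_zero_of_re_pos hre2
  have lim1 : Tendsto (fun n => Real.log (‖Complex.GammaSeq (s + h) n‖ / ‖Complex.GammaSeq s n‖)) atTop
      (𝓝 (Real.log (‖Complex.Gamma (s + h)‖ / ‖Complex.Gamma s‖))) := by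
    refine Tendsto.log ?_ (by positivity)
    exact ((Complex.GammaSeq_tendsto_Gamma (s + h)).norm).div ((Complex.GammaSeq_tendsto_Gamma s).norm) (by positivity)
  have hne : ∀ k : ℕ, s + k ≠ 0 := by
    intro k hk; have := congrArg Complex.re hk; simp at this
    have : (0:ℝ) ≤ k := Nat.cast_nonneg k
    linarith
  have hne2 : ∀ k : ℕ, s + h + k ≠ 0 := by
    intro k hk; have := congrArg Complex.re hk; simp at this hre2
    have : (0:ℝ) ≤ k := Nat.cast_nonneg k
    linarith
  have key : ∀ n : ℕ, n ≠ 0 → h * (Real.log n - (1/2) * (Real.log (((n+1 : ℕ):ℝ) ^ 2 + 1 + y ^ 2) - Real.log (1 + y ^ 2)) - S) ≤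
      Real.log (‖Complex.GammaSeq (s + h) n‖ / ‖Complex.GammaSeq s n‖) := by
    intro n hn
    have hn0 : (0:ℝ) < n := by positivity
    have e1 : ‖Complex.GammaSeq (s + h) n‖ / ‖Complex.GammaSeq s n‖ =
        (n:ℝ) ^ h * ∏ k ∈ Finset.range (n+1), (‖s + h + k‖ / ‖s + k‖)⁻¹ := by
      have hp1 : ∏ k ∈ Finset.range (n+1), ‖s + k‖ ≠ 0 := Finset.prod_ne_zero_iff.2 fun k _ => by simpa using hne k
      have hp2 : ∏ k ∈ Finset.range (n+1), ‖s + h + k‖ ≠ 0 := Finset.prod_ne_zero_iff.2 fun k _ => by simpa using hne2 k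
      have hf : (n.factorial : ℝ) ≠ 0 := by positivity
      have hr : (n:ℝ) ^ (s.re) ≠ 0 := (Real.rpow_pos_of_pos hn0 _).ne'
      simp only [Complex.GammaSeq, norm_div, norm_mul, norm_prod, inv_div, Finset.prod_div_distrib]
      have a1 : ‖(n:ℂ) ^ (s + h)‖ = (n:ℝ) ^ s.re * (n:ℝ) ^ h := by
        rw [← Real.rpow_add hn0, ← Complex.ofReal_natCast, Complex.norm_cpow_eq_rpow_re_of_pos hn0]; simp
      have a2 : ‖(n:ℂ) ^ s‖ = (n:ℝ) ^ s.re := by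
        rw [← Complex.ofReal_natCast, Complex.norm_cpow_eq_rpow_re_of_pos hn0]
      rw [a1, a2]
      simp only [Complex.norm_natCast]
      field_simp
    rw [e1, Real.log_mul (Real.rpow_pos_of_pos hn0 _).ne' (Finset.prod_ne_zero_iff.2 fun k _ => by
      have := hne k; have := hne2 k; positivity), Real.log_rpow hn0, Real.log_prod (fun k _ => by
      have := hne k; have := hne2 k; positivity)]
    simp_rw [Real.log_inv]
    rw [Finset.sum_neg_distrib]
    have e2 : ∑ k ∈ Finset.range (n+1), Real.log (‖s + h + k‖ / ‖s + k‖) ≤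
        h * ((1/2) * (Real.log (((n+1 : ℕ):ℝ) ^ 2 + 1 + y ^ 2) - Real.log (1 + y ^ 2)) + S) := by
      refine (Finset.sum_le_sum fun k _ => gterm (y := y) hh hh1 k).trans ?_
      rw [← Finset.mul_sum]
      gcongr
      rw [Finset.sum_add_distrib, ← Finset.mul_sum,
        Finset.sum_range_sub (fun k : ℕ => Real.log ((k:ℝ) ^ 2 + 1 + y ^ 2)) (n+1)]
      have := hs.sum_le_tsum (Finset.range (n+1)) (fun k _ => by positivity)
      simp only [Nat.cast_zero]
      norm_num
      exact this
    linarith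
  have lim2 : Tendsto (fun n : ℕ => h * (Real.log n - (1/2) * (Real.log (((n+1 : ℕ):ℝ) ^ 2 + 1 + y ^ 2) - Real.log (1 + y ^ 2)) - S)) atTop
      (𝓝 (h * (0 + (1/2) * Real.log (1 + y ^ 2) - S))) := by
    refine Tendsto.const_mul _ ?_
    refine Tendsto.sub_const ?_ _
    have l0 : Tendsto (fun n : ℕ => -(1/2) * Real.log ((1 + 1 / (n:ℝ)) ^ 2 + (1 + y ^ 2) * (1 / (n:ℝ)) ^ 2)) atTop (𝓝 (-(1/2) * Real.log ((1 + 0) ^ 2 + (1 + y ^ 2) * 0 ^ 2))) := by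
      have := tendsto_one_div_atTop_nhds_zero_nat (𝕜 := ℝ)
      refine Tendsto.const_mul _ (Tendsto.log ?_ (by norm_num))
      exact ((this.const_add 1).pow 2).add ((this.pow 2).const_mul _)
    norm_num at l0
    refine ((l0.add_const ((1/2) * Real.log (1 + y ^ 2))).congr' ?_)
    filter_upwards [eventually_gt_atTop 0] with n hn
    have hn0 : (0:ℝ) < n := by positivity
    have : ((n+1 : ℕ):ℝ) ^ 2 + 1 + y ^ 2 = (n:ℝ) ^ 2 * ((1 + (n:ℝ)⁻¹) ^ 2 + (1 + y ^ 2) * ((n:ℝ) ^ 2)⁻¹) := by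
      push_cast; field_simp; ring
    rw [this, Real.log_mul (by positivity) (by positivity), Real.log_pow]
    push_cast; ring
  have := le_of_tendsto_of_tendsto lim2 lim1 (by
    filter_upwards [eventually_ne_atTop 0] with n hn using key n hn)
  refine le_trans ?_ this
  exact mul_le_mul_of_nonneg_left (by linarith) hh.le

lemma re_digamma_ge : ∃ C > 0, ∀ y : ℝ, (1/2) * Real.log (1 + y ^ 2) - C ≤
    (Complex.digamma (((1/4 : ℝ) : ℂ) + y * Complex.I)).re := by
  obtain ⟨C, hC, h⟩ := gamma_diff
  refine ⟨C, hC, fun y => ?_⟩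
  set s : ℂ := ((1/4 : ℝ) : ℂ) + y * Complex.I with hsdef
  have hre : 0 < s.re := by simp [hsdef]
  have g1 := Complex.Gamma_ne_zero_of_re_pos hre
  have hd : DifferentiableAt ℂ Complex.Gamma s := by
    refine Complex.differentiableAt_Gamma s fun m hm => ?_
    rw [hm] at hre; simp at hre
    have : (0:ℝ) ≤ m := Nat.cast_nonneg m
    linarith
  have d1 : HasDerivAt (fun x : ℝ => Complex.Gamma (s + x) / Complex.Gamma s) (Complex.digamma s) 0 := by
    have h1 : HasDerivAt (fun z : ℂ => Complex.Gamma (s + z)) (deriv Complex.Gamma s) ((0:ℝ):ℂ) := by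
      have : HasDerivAt Complex.Gamma (deriv Complex.Gamma s) (s + ((0:ℝ):ℂ)) := by simpa using hd.hasDerivAt
      exact this.comp_const_add s _
    have h2 := h1.comp_ofReal.div_const (Complex.Gamma s)
    exact h2
  have d2 : HasDerivAt (fun x : ℝ => Complex.log (Complex.Gamma (s + x) / Complex.Gamma s)) (Complex.digamma s) 0 := by
    have := d1.clog_real (by simp [g1])
    simpa [g1] using this
  have d3 : HasDerivAt (fun x : ℝ => Real.log (‖Complex.Gamma (s + x)‖ / ‖Complex.Gamma s‖)) (Complex.digamma s).re 0 := by
    have := Complex.reCLM.hasFDerivAt.comp_hasDerivAt (0:ℝ) d2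
    refine this.congr_of_eventuallyEq (Eventually.of_forall fun x => ?_)
    simp [Complex.log_re]
  have d4 := d3.hasDerivWithinAt (s := Set.Ioi 0)
  rw [hasDerivWithinAt_iff_tendsto_slope' (by simp)] at d4
  refine ge_of_tendsto d4 ?_
  filter_upwards [Ioc_mem_nhdsGT (show (0:ℝ) < 1 by norm_num)] with x hx
  rw [slope_def_field]
  simp only [Complex.ofReal_zero, add_zero, sub_zero, div_self (norm_ne_zero_iff.2 g1), Real.log_one]
  rw [le_div_iff₀ hx.1, mul_comm]
  exact h y x hx.1 hx.2

end RS

namespace RS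

lemma logDeriv_conj {g : ℂ → ℂ} (hg : ∀ z, g ((starRingEnd ℂ) z) = (starRingEnd ℂ) (g z)) (z : ℂ) :
    logDeriv g ((starRingEnd ℂ) z) = (starRingEnd ℂ) (logDeriv g z) := by
  have h1 : (starRingEnd ℂ) ∘ g ∘ (starRingEnd ℂ) = g := by
    ext w; simp [hg]
  have h2 := congrFun (deriv_conj_conj (f := g)) ((starRingEnd ℂ) z)
  rw [h1] at h2
  simp only [Function.comp_apply, Complex.conj_conj] at h2
  rw [logDeriv_apply, logDeriv_apply, h2, hg, map_div₀]

lemma logDeriv_completed {s : ℂ} (h0 : 0 < s.re) (h1 : s.re < 1) (hz : riemannZeta₁ s ≠ 0) :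
    logDeriv completedRiemannZeta s = -(1/2) * Complex.log Real.pi + (1/2) * Complex.digamma (s/2) +
      logDeriv riemannZeta₁ s - 1 / (s - 1) := by
  have hs0 : s ≠ 0 := by intro h; rw [h] at h0; simp at h0
  have hs1 : s ≠ 1 := by intro h; rw [h] at h1; simp at h1
  have hpi : (Real.pi : ℂ) ≠ 0 := by exact_mod_cast Real.pi_pos.ne'
  have hev : completedRiemannZeta =ᶠ[𝓝 s] fun z => ((Real.pi : ℂ) ^ (-z/2) * Complex.Gamma (z/2)) * (riemannZeta₁ z / (z - 1)) := by
    have o1 : IsOpen {z : ℂ | 0 < z.re} := isOpen_lt continuous_const Complex.continuous_re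
    filter_upwards [o1.mem_nhds h0, isOpen_ne.mem_nhds hs1] with z hz0 hz1
    have hz00 : z ≠ 0 := by intro h; rw [h] at hz0; simp at hz0
    have hz1' : z ≠ 1 := hz1
    have := sub_ne_zero.2 hz1'
    rw [zeta1_eq_of_ne hz1, mul_div_cancel_left₀ _ this, riemannZeta_def_of_ne_zero hz00, ← Complex.Gammaℝ_def,
      mul_div_cancel₀ _ (Complex.Gammaℝ_ne_zero_of_re_pos hz0)]
  have hl : logDeriv completedRiemannZeta s = logDeriv (fun z => ((Real.pi : ℂ) ^ (-z/2) * Complex.Gamma (z/2)) * (riemannZeta₁ z / (z - 1))) s := by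
    rw [logDeriv_apply, logDeriv_apply, hev.deriv_eq, hev.eq_of_nhds]
  have hG : Complex.Gamma (s/2) ≠ 0 := Complex.Gamma_ne_zero_of_re_pos (by
    rw [show s / 2 = s * ((1/2:ℝ):ℂ) by push_cast; ring, Complex.re_mul_ofReal]; positivity)
  have hGd : DifferentiableAt ℂ Complex.Gamma (s/2) := by
    refine Complex.differentiableAt_Gamma _ fun m hm => ?_
    have := congrArg Complex.re hm
    rw [show s / 2 = s * ((1/2:ℝ):ℂ) by push_cast; ring, Complex.re_mul_ofReal] at this
    simp at this
    have : (0:ℝ) ≤ m := Nat.cast_nonneg m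
    linarith
  have hGd2 : DifferentiableAt ℂ (fun z : ℂ => Complex.Gamma (z/2)) s := DifferentiableAt.fun_comp' s hGd (by fun_prop)
  have hpd : HasDerivAt (fun z : ℂ => (Real.pi : ℂ) ^ (-z/2)) ((Real.pi : ℂ) ^ (-s/2) * Complex.log Real.pi * (-1/2)) s := by
    have : HasDerivAt (fun z : ℂ => -z/2) (-1/2) s := ((hasDerivAt_id s).neg).div_const 2
    exact this.const_cpow (Or.inl hpi)
  have hp0 : (Real.pi : ℂ) ^ (-s/2) ≠ 0 := by simp [Complex.cpow_eq_zero_iff, hpi]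
  have hz1 : s - 1 ≠ 0 := sub_ne_zero.2 hs1
  have hzd : DifferentiableAt ℂ riemannZeta₁ s := differentiable_riemannZeta₁ s
  rw [hl, logDeriv_mul (f := fun z : ℂ => (Real.pi : ℂ) ^ (-z/2) * Complex.Gamma (z/2)) (g := fun z : ℂ => riemannZeta₁ z / (z - 1)) s (mul_ne_zero hp0 hG) (div_ne_zero hz hz1) (hpd.differentiableAt.fun_mul hGd2) (hzd.fun_div (by fun_prop) hz1),
    logDeriv_mul (f := fun z : ℂ => (Real.pi : ℂ) ^ (-z/2)) (g := fun z : ℂ => Complex.Gamma (z/2)) s hp0 hG hpd.differentiableAt hGd2, logDeriv_div (f := riemannZeta₁) (g := fun z : ℂ => z - 1) s hz hz1 hzd (by fun_prop)]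
  have l1 : logDeriv (fun z : ℂ => (Real.pi : ℂ) ^ (-z/2)) s = -(1/2) * Complex.log Real.pi := by
    rw [logDeriv_apply, hpd.deriv]; field_simp
  have l2 : logDeriv (fun z : ℂ => Complex.Gamma (z/2)) s = (1/2) * Complex.digamma (s/2) := by
    have := logDeriv_comp (f := Complex.Gamma) (g := fun z : ℂ => z / 2) (x := s) hGd (by fun_prop)
    have d : deriv (fun z : ℂ => z / 2) s = 1/2 := by simp
    rw [d] at this
    rw [Complex.digamma_def, mul_comm, ← this]; rfl
  have l3 : logDeriv (fun z : ℂ => z - 1) s = 1 / (s - 1) := by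
    rw [logDeriv_apply]; simp
  rw [l1, l2, l3]; ring

lemma re_logDeriv_zeta1_le : ∃ C > 0, ∀ t : ℝ, riemannZeta₁ (rp t) ≠ 0 →
    (logDeriv riemannZeta₁ (rp t)).re ≤ C - (1/2) * Real.log (1 + |t|) := by
  obtain ⟨C, hC, h⟩ := re_digamma_ge
  refine ⟨(1/2) * Real.log Real.pi + (1/2) * C + Real.log 4, ?_, fun t ht => ?_⟩
  · have := Real.log_pos (show 1 < Real.pi by linarith [Real.pi_gt_three])
    have := Real.log_pos (show (1:ℝ) < 4 by norm_num)
    positivity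
  set s := rp t with hs
  have hcs : (starRingEnd ℂ) s = 1 - s := by
    apply Complex.ext <;> simp [hs] <;> norm_num
  have A1 := logDeriv_completed (s := s) (by simp [hs]) (by simp [hs]; norm_num) ht
  have A2 := logDeriv_completed (s := (starRingEnd ℂ) s) (by simp [hs]) (by simp [hs]; norm_num) (by rw [zeta1_conj]; simpa using ht)
  have A3 : logDeriv completedRiemannZeta ((starRingEnd ℂ) s) = (starRingEnd ℂ) (logDeriv completedRiemannZeta s) := by
    rw [A1, A2, logDeriv_conj zeta1_conj]
    have c2 : (starRingEnd ℂ) 2 = 2 := map_ofNat _ 2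
    have : (starRingEnd ℂ) s / 2 = (starRingEnd ℂ) (s/2) := by simp [c2]
    rw [this, Complex.digamma_def, logDeriv_conj Complex.Gamma_conj, ← Complex.ofReal_log Real.pi_pos.le]
    simp [c2]
  have A4 : logDeriv completedRiemannZeta (1 - s) = - logDeriv completedRiemannZeta s := by
    have hfe : (fun z => completedRiemannZeta (1 - z)) = completedRiemannZeta := funext completedRiemannZeta_one_sub
    have : deriv completedRiemannZeta s = - deriv completedRiemannZeta (1 - s) := by
      conv_lhs => rw [← hfe]
      rw [deriv_comp_const_sub]
    rw [logDeriv_apply, logDeriv_apply, this, completedRiemannZeta_one_sub]; ring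
  rw [hcs, A4] at A3
  have A5 : (logDeriv completedRiemannZeta s).re = 0 := by
    have := congrArg Complex.re A3
    simp at this; linarith
  rw [A1] at A5
  have hs2 : s / 2 = ((1/4 : ℝ) : ℂ) + ((t/2 : ℝ) : ℂ) * Complex.I := by
    simp only [hs, rp]; push_cast; ring
  rw [hs2, ← Complex.ofReal_log Real.pi_pos.le] at A5
  have e1 : (1 / (s - 1)).re ≤ 0 := by
    rw [one_div, Complex.inv_re]
    apply div_nonpos_of_nonpos_of_nonneg
    · simp [hs]; norm_num
    · exact Complex.normSq_nonneg _
  have e2 := h (t/2)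
  have e3 : Real.log (1 + |t|) - Real.log 4 ≤ (1/2) * Real.log (1 + (t/2)^2) := by
    rw [← Real.log_div (by positivity) (by norm_num)]
    rw [show (1/2) * Real.log (1 + (t/2)^2) = Real.log (Real.sqrt (1 + (t/2)^2)) by rw [Real.log_sqrt (by positivity)]; ring]
    apply Real.log_le_log (by positivity)
    apply Real.le_sqrt_of_sq_le
    have := sq_abs t
    nlinarith [sq_nonneg (|t| - 1)]
  have e4 : (-(1/2) * ((Real.log Real.pi : ℝ):ℂ)).re = -(1/2) * Real.log Real.pi := by
    rw [Complex.re_mul_ofReal]; norm_num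
  have e5 : ∀ z : ℂ, ((1/2) * z).re = (1/2) * z.re := by
    intro z
    rw [show (1/2 : ℂ) = ((1/2 : ℝ) : ℂ) by push_cast; rfl, Complex.re_ofReal_mul]
  rw [Complex.sub_re, Complex.add_re, Complex.add_re, e4, e5] at A5
  have := Real.log_pos (show (1:ℝ) < 4 by norm_num)
  linarith

end RS

namespace RS

lemma tail_lint {h : ℝ → ℝ} (h0 : ∀ v, 0 ≤ h v) (hi : ∀ Y, IntegrableOn h (Set.Icc 0 Y)) {C : ℝ}
    (hC : 0 ≤ C) (hb : ∀ Y ≥ 1, ∫ v in Set.Icc 0 Y, h v ≤ C * Y) {X : ℝ} (hX : 1 ≤ X) :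
    ∫⁻ v in Set.Ioi X, ENNReal.ofReal (h v / v^2) ≤ ENNReal.ofReal (4 * C / X) := by
  have X0 : 0 < X := by linarith
  have cov : Set.Ioi X ⊆ ⋃ n : ℕ, Set.Ioc (2^n * X) (2^(n+1) * X) := by
    intro v hv
    have hv : X < v := hv
    obtain ⟨n, hn1, hn2⟩ := exists_mem_Ioc_zpow (x := v / X) (y := 2) (div_pos (X0.trans hv) X0) (by norm_num)
    have hn0 : 0 ≤ n := by
      by_contra hcon
      have : n + 1 ≤ 0 := by omega
      have h2 : (2:ℝ)^(n+1) ≤ 1 := zpow_le_one_of_nonpos₀ (by norm_num) this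
      have : 1 < v / X := by rw [lt_div_iff₀ X0]; linarith
      linarith
    lift n to ℕ using hn0
    refine Set.mem_iUnion.2 ⟨n, ?_, ?_⟩
    · rw [lt_div_iff₀ X0] at hn1; exact_mod_cast hn1
    · rw [div_le_iff₀ X0] at hn2; exact_mod_cast hn2
  calc ∫⁻ v in Set.Ioi X, ENNReal.ofReal (h v / v^2)
      ≤ ∫⁻ v in ⋃ n : ℕ, Set.Ioc (2^n * X) (2^(n+1) * X), ENNReal.ofReal (h v / v^2) :=
        lintegral_mono_set cov
    _ ≤ ∑' n : ℕ, ∫⁻ v in Set.Ioc (2^n * X) (2^(n+1) * X), ENNReal.ofReal (h v / v^2) :=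
        lintegral_iUnion_le _ _
    _ ≤ ∑' n : ℕ, ENNReal.ofReal (2 * C / X * (1/2)^n) := by
        refine ENNReal.tsum_le_tsum fun n => ?_
        have p2 : (1:ℝ) ≤ 2^n := one_le_pow₀ (by norm_num)
        have a0 : 0 < 2^n * X := by positivity
        have hsub : Set.Ioc (2^n * X) (2^(n+1) * X) ⊆ Set.Icc 0 (2^(n+1)*X) := fun v hv => ⟨a0.le.trans hv.1.le, hv.2⟩
        calc ∫⁻ v in Set.Ioc (2^n * X) (2^(n+1) * X), ENNReal.ofReal (h v / v^2)
            ≤ ∫⁻ v in Set.Ioc (2^n * X) (2^(n+1) * X), ENNReal.ofReal (h v / (2^n*X)^2) := by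
              refine setLIntegral_mono' measurableSet_Ioc fun v hv => ?_
              apply ENNReal.ofReal_le_ofReal
              apply div_le_div_of_nonneg_left (h0 v) (by positivity)
              exact pow_le_pow_left₀ a0.le hv.1.le 2
          _ ≤ ∫⁻ v in Set.Icc 0 (2^(n+1) * X), ENNReal.ofReal (h v / (2^n*X)^2) := lintegral_mono_set hsub
          _ = ENNReal.ofReal (∫ v in Set.Icc 0 (2^(n+1) * X), h v / (2^n*X)^2) := by
              rw [ofReal_integral_eq_lintegral_ofReal ((hi _).div_const _)]
              exact ae_of_all _ fun v => div_nonneg (h0 v) (by positivity)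
          _ ≤ _ := by
              apply ENNReal.ofReal_le_ofReal
              rw [integral_div]
              calc _ ≤ C * (2^(n+1) * X) / (2^n*X)^2 := by
                    apply div_le_div_of_nonneg_right (hb _ _) (by positivity)
                    rw [pow_succ]; nlinarith
                _ = _ := by rw [one_div, inv_pow]; field_simp; ring
    _ = ENNReal.ofReal (∑' n : ℕ, 2 * C / X * (1/2)^n) := by
        rw [ENNReal.ofReal_tsum_of_nonneg (fun n => by positivity) (summable_geometric_two.mul_left _)]
    _ = _ := by rw [tsum_mul_left, tsum_geometric_two]; congr 1; ring

lemma fF_tail (hRH : RHyp) : ∃ C > 0, ∀ X ≥ 1,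
    IntegrableOn (fun v => (fF v^2 + 1) / v^2) (Set.Ioi X) ∧ ∫ v in Set.Ioi X, (fF v^2 + 1) / v^2 ≤ C / X := by
  obtain ⟨C, hC, h⟩ := fF_L2 hRH
  refine ⟨4 * (C + 1), by positivity, fun X hX => ?_⟩
  have hi : ∀ Y, IntegrableOn (fun v => fF v^2 + 1) (Set.Icc 0 Y) := fun Y =>
    (fF_sq_locint 0 Y).add (integrableOn_const (by simp))
  have hb : ∀ Y ≥ 1, ∫ v in Set.Icc 0 Y, (fF v^2 + 1) ≤ (C + 1) * Y := by
    intro Y hY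
    rw [integral_add (fF_sq_locint 0 Y) (integrableOn_const (by simp))]
    have := h Y hY
    have h2 : ∫ v in Set.Icc (0:ℝ) Y, (1:ℝ) = Y := by simp; linarith
    rw [h2]; linarith
  have key := tail_lint (fun v => by positivity) hi (by positivity) hb hX
  have hm : Measurable (fun v => (fF v^2 + 1) / v^2) :=
    ((fF_meas.pow_const 2).add_const 1).div (measurable_id.pow_const 2)
  have nn : ∀ v, 0 ≤ (fF v^2 + 1) / v^2 := fun v => by positivity
  have hIntg : IntegrableOn (fun v => (fF v^2 + 1) / v^2) (Set.Ioi X) := by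
    refine ⟨hm.aestronglyMeasurable, ?_⟩
    rw [hasFiniteIntegral_iff_ofReal (ae_of_all _ nn)]
    exact key.trans_lt ENNReal.ofReal_lt_top
  refine ⟨hIntg, ?_⟩
  rw [← ENNReal.ofReal_le_ofReal_iff (by positivity), ofReal_integral_eq_lintegral_ofReal hIntg (ae_of_all _ nn)]
  exact key

lemma abs_le_sq1 (x : ℝ) : |x| ≤ (x^2+1)/2 := by
  nlinarith [sq_abs x, sq_nonneg (|x| - 1)]

/-- decaying envelope -/
lemma fF_env (hRH : RHyp) : Integrable (fun v => (|fF v| + 1) / (1 + v^2)) := by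
  obtain ⟨C, hC, h⟩ := fF_tail hRH
  have hm : Measurable (fun v => |fF v| / (1+v^2)) :=
    (fF_meas.abs).div ((measurable_id.pow_const 2).const_add 1)
  have i1 : Integrable (fun v : ℝ => |fF v| / (1+v^2)) := by
    rw [← integrableOn_univ, ← Set.Iic_union_Ioi (a := (1:ℝ))]
    refine IntegrableOn.union ?_ ?_
    · rw [← Set.Iio_union_Icc_eq_Iic (a := (0:ℝ)) (by norm_num)]
      refine IntegrableOn.union ?_ ?_
      · refine (integrableOn_zero (ε' := ℝ)).congr_fun (fun v hv => ?_) measurableSet_Iio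
        simp [fF_nonpos (le_of_lt hv)]
      · refine ((fF_locint 0 1).abs).mono' hm.aestronglyMeasurable (ae_of_all _ fun v => ?_)
        rw [Real.norm_eq_abs, abs_div, abs_abs, abs_of_pos (by positivity : 0 < 1 + v^2)]
        exact div_le_self (abs_nonneg _) (by nlinarith [sq_nonneg v])
    · refine ((h 1 le_rfl).1).mono' hm.aestronglyMeasurable ?_
      filter_upwards [ae_restrict_mem measurableSet_Ioi] with v hv
      have hv : 1 < v := hv
      rw [Real.norm_eq_abs, abs_div, abs_abs, abs_of_pos (by positivity : 0 < 1 + v^2)]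
      apply div_le_div₀ (by positivity) _ (by positivity) (by linarith)
      have := abs_le_sq1 (fF v); nlinarith [sq_nonneg (fF v)]
  refine (i1.add integrable_inv_one_add_sq).congr (ae_of_all _ fun v => ?_)
  simp only [Pi.add_apply]; ring

end RS

namespace RS

def wT (T t : ℝ) : ℝ := max 0 (1 - |t| / T)
def kT (T u : ℝ) : ℝ := T * Real.sinc (T * u / 2) ^ 2

lemma wT_cont (T : ℝ) : Continuous (wT T) := by unfold wT; fun_prop
lemma wT_nonneg (T t : ℝ) : 0 ≤ wT T t := le_max_left _ _
lemma wT_le_one {T : ℝ} (hT : 0 < T) (t : ℝ) : wT T t ≤ 1 :=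
  max_le (by norm_num) (by have : 0 ≤ |t| / T := by positivity
                           linarith)
lemma wT_zero {T t : ℝ} (hT : 0 < T) (h : T ≤ |t|) : wT T t = 0 := by
  unfold wT; apply max_eq_left
  have : 1 ≤ |t| / T := by rwa [le_div_iff₀ hT, one_mul]
  linarith
lemma wT_half {T t : ℝ} (hT : 0 < T) (h : |t| ≤ T / 2) : 1/2 ≤ wT T t := by
  unfold wT; apply le_max_of_le_right
  have : |t| / T ≤ 1/2 := by rw [div_le_iff₀ hT]; linarith
  linarith
lemma wT_zero_notMem {T t : ℝ} (hT : 0 < T) (h : t ∉ Set.Icc (-T) T) : wT T t = 0 := by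
  apply wT_zero hT
  by_contra hc
  push Not at hc
  exact h ⟨by linarith [neg_abs_le t], by linarith [le_abs_self t]⟩
lemma wT_integrable {T : ℝ} (hT : 0 < T) : Integrable (wT T) :=
  (((wT_cont T).continuousOn.integrableOn_compact isCompact_Icc)).integrable_of_forall_notMem_eq_zero
    fun _ ht => wT_zero_notMem hT ht
lemma wT_integrableC {T : ℝ} (hT : 0 < T) : Integrable (fun t => (wT T t : ℂ)) := (wT_integrable hT).ofReal

lemma kT_cont (T : ℝ) : Continuous (kT T) := by
  unfold kT; have := Real.continuous_sinc; fun_prop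
lemma kT_nonneg {T : ℝ} (hT : 0 < T) (u : ℝ) : 0 ≤ kT T u := by unfold kT; positivity
lemma kT_neg (T u : ℝ) : kT T (-u) = kT T u := by
  unfold kT; rw [show T * -u / 2 = -(T * u / 2) by ring, Real.sinc_neg]
lemma kT_le {T : ℝ} (hT : 0 < T) (u : ℝ) : kT T u ≤ T := by
  unfold kT
  have h := Real.abs_sinc_le_one (T * u / 2)
  have : Real.sinc (T * u / 2) ^ 2 ≤ 1 := by
    rw [← sq_abs]; exact pow_le_one₀ (abs_nonneg _) h
  nlinarith
lemma kT_eq {T u : ℝ} (hT : 0 < T) (hu : u ≠ 0) : kT T u = 4 * Real.sin (T * u / 2)^2 / (T * u^2) := by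
  unfold kT
  rw [Real.sinc_of_ne_zero (by have := hT.ne'; positivity)]
  field_simp; ring
lemma kT_le2 {T u : ℝ} (hT : 1 ≤ T) : kT T u * u^2 ≤ 4 := by
  have hT0 : 0 < T := by linarith
  rcases eq_or_ne u 0 with rfl | hu
  · simp
  rw [kT_eq hT0 hu]
  have h1 := Real.sin_sq_le_one (T * u / 2)
  have : 4 * Real.sin (T * u / 2)^2 / (T * u^2) * u^2 = 4 * Real.sin (T * u / 2)^2 / T := by field_simp
  rw [this, div_le_iff₀ hT0]; nlinarith
lemma kT_le3 {T : ℝ} (hT : 1 ≤ T) (u : ℝ) : kT T u ≤ (T + 4) / (1 + u^2) := by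
  rw [le_div_iff₀ (by positivity)]
  have := kT_le (by linarith : 0 < T) u
  have := kT_le2 (u := u) hT
  linarith
lemma kT_env {T : ℝ} (hT : 1 ≤ T) (y v : ℝ) : kT T (y - v) ≤ 2 * (T + 4) * (1 + y^2) / (1 + v^2) := by
  refine (kT_le3 hT (y - v)).trans ?_
  rw [div_le_div_iff₀ (by positivity) (by positivity)]
  have : 1 + v^2 ≤ 2 * (1 + y^2) * (1 + (y - v)^2) := by
    nlinarith [sq_nonneg (y + (y - v)), sq_nonneg (y * (y - v)), sq_nonneg (y), sq_nonneg (y-v)]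
  nlinarith
lemma kT_integrable {T : ℝ} (hT : 1 ≤ T) : Integrable (kT T) := by
  refine ((integrable_inv_one_add_sq).const_mul (T + 4)).mono' (kT_cont T).aestronglyMeasurable (ae_of_all _ fun u => ?_)
  rw [Real.norm_eq_abs, abs_of_nonneg (kT_nonneg (by linarith) u), ← div_eq_mul_inv]
  exact kT_le3 hT u

lemma ift_wT {T : ℝ} (hT : 0 < T) : ift (fun t => (wT T t : ℂ)) = fun u => (kT T u : ℂ) := by
  refine Continuous.ext_on (dense_compl_singleton (0:ℝ)) (ift_cont (wT_integrableC hT))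
    (Complex.continuous_ofReal.comp (kT_cont T)) fun u hu => ?_
  have hu : u ≠ 0 := hu
  unfold ift
  have hT' : (T:ℂ) ≠ 0 := by exact_mod_cast hT.ne'
  have hu' : (u:ℂ) ≠ 0 := by exact_mod_cast hu
  set a : ℂ := Complex.I * u with ha
  have ha0 : a ≠ 0 := mul_ne_zero Complex.I_ne_zero hu'
  have e1 : ∀ t : ℝ, (wT T t : ℂ) * Complex.exp (Complex.I * t * u) = (wT T t : ℂ) * Complex.exp (a * t) := by
    intro t; rw [ha]; ring_nf
  simp_rw [e1]
  have hc : Continuous fun t : ℝ => (wT T t : ℂ) * Complex.exp (a * t) := by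
    have := wT_cont T; fun_prop
  have hs : ∫ t : ℝ, (wT T t : ℂ) * Complex.exp (a * t) = ∫ t in (-T)..T, (wT T t : ℂ) * Complex.exp (a * t) := by
    rw [intervalIntegral.integral_of_le (by linarith), ← integral_Icc_eq_integral_Ioc,
      setIntegral_eq_integral_of_forall_compl_eq_zero]
    intro t ht; simp [wT_zero_notMem hT ht]
  rw [hs, ← intervalIntegral.integral_add_adjacent_intervals (b := 0) (hc.intervalIntegrable _ _) (hc.intervalIntegrable _ _)]
  have hexp : ∀ t : ℝ, HasDerivAt (fun t : ℝ => Complex.exp (a * t)) (a * Complex.exp (a * t)) t := by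
    intro t
    have := ((hasDerivAt_id (t:ℂ)).const_mul a).cexp.comp_ofReal
    exact this.congr_deriv (by simp; ring)
  have hid : ∀ t : ℝ, HasDerivAt (fun t : ℝ => (t:ℂ)/T) (1/T) t := fun t => (hasDerivAt_id (t:ℂ)).comp_ofReal.div_const _
  have A : ∫ t in (0:ℝ)..T, (wT T t : ℂ) * Complex.exp (a * t) = Complex.exp (a*T)/(T*a^2) - 1/a - 1/(T*a^2) := by
    rw [intervalIntegral.integral_congr (g := fun t : ℝ => (1 - (t:ℂ)/T) * Complex.exp (a * t))]
    · rw [intervalIntegral.integral_eq_sub_of_hasDerivAt (f := fun t : ℝ => (1 - (t:ℂ)/T) * Complex.exp (a * t) / a + Complex.exp (a * t)/(T*a^2))]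
      · simp [hT']; ring
      · intro t _
        have := ((((hid t).const_sub 1).mul (hexp t)).div_const a).add ((hexp t).div_const (T * a^2))
        refine this.congr_deriv ?_
        field_simp; ring
      · apply Continuous.intervalIntegrable; fun_prop
    · intro t ht
      rw [Set.uIcc_of_le hT.le] at ht
      have : wT T t = 1 - t / T := by
        unfold wT; rw [abs_of_nonneg ht.1]; apply max_eq_right
        have : t / T ≤ 1 := by rw [div_le_iff₀ hT]; linarith [ht.2]
        linarith
      simp [this]
  have B : ∫ t in (-T)..0, (wT T t : ℂ) * Complex.exp (a * t) = Complex.exp (-(a*T))/(T*a^2) + 1/a - 1/(T*a^2) := by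
    rw [intervalIntegral.integral_congr (g := fun t : ℝ => (1 + (t:ℂ)/T) * Complex.exp (a * t))]
    · rw [intervalIntegral.integral_eq_sub_of_hasDerivAt (f := fun t : ℝ => (1 + (t:ℂ)/T) * Complex.exp (a * t) / a - Complex.exp (a * t)/(T*a^2))]
      · simp [hT', neg_div]; ring
      · intro t _
        have := ((((hid t).const_add 1).mul (hexp t)).div_const a).sub ((hexp t).div_const (T * a^2))
        refine this.congr_deriv ?_
        field_simp; ring
      · apply Continuous.intervalIntegrable; fun_prop
    · intro t ht
      rw [Set.uIcc_of_le (by linarith)] at ht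
      have : wT T t = 1 + t / T := by
        unfold wT; rw [abs_of_nonpos ht.2, neg_div, sub_neg_eq_add]; apply max_eq_right
        have : -1 ≤ t / T := by rw [le_div_iff₀ hT]; linarith [ht.1]
        linarith
      simp [this]
  rw [A, B, kT_eq hT hu]
  push_cast
  have hsin : Complex.sin ((T:ℂ) * u / 2) = (Complex.exp (-(a*T/2)) - Complex.exp (a*T/2)) * Complex.I / 2 := by
    rw [Complex.sin, ha]; ring_nf
  have x1 : Complex.exp (a*T) = Complex.exp (a*T/2)^2 := by rw [← Complex.exp_nat_mul]; ring_nf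
  have x2 : Complex.exp (-(a*T)) = Complex.exp (-(a*T/2))^2 := by rw [← Complex.exp_nat_mul]; ring_nf
  have x3 : Complex.exp (-(a*T/2)) * Complex.exp (a*T/2) = 1 := by rw [← Complex.exp_add]; simp
  have hu2 : (u:ℂ)^2 = -a^2 := by rw [ha, mul_pow, Complex.I_sq]; ring
  rw [hsin, x1, x2, hu2]
  generalize Complex.exp (a*T/2) = p at *
  generalize Complex.exp (-(a*T/2)) = q at *
  have hI := Complex.I_sq
  field_simp
  rw [hI]
  linear_combination (8:ℂ) * x3

lemma kT_ft {T : ℝ} (hT : 1 ≤ T) (γ : ℝ) :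
    ∫ u : ℝ, (kT T u : ℂ) * Complex.exp (Complex.I * γ * u) = 2 * Real.pi * wT T γ := by
  have hT0 : 0 < T := by linarith
  have hF : ∀ ξ : ℝ, FourierTransform.fourier (fun t => (wT T t : ℂ)) ξ = (kT T (2 * Real.pi * ξ) : ℂ) := by
    intro ξ
    rw [Real.fourier_real_eq_integral_exp_smul]
    have := congrFun (ift_wT hT0) (-(2 * Real.pi * ξ))
    rw [kT_neg] at this
    rw [← this]; unfold ift
    congr 1; ext t
    rw [smul_eq_mul, mul_comm]; congr 2; push_cast; ring
  have hpi := Real.pi_pos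
  have hi : Integrable (FourierTransform.fourier (fun t => (wT T t : ℂ))) := by
    rw [show FourierTransform.fourier (fun t => (wT T t : ℂ)) = fun ξ : ℝ => (kT T (2 * Real.pi * ξ) : ℂ) from funext hF]
    exact ((kT_integrable hT).comp_mul_left' (by positivity)).ofReal
  have h := congrFun (Continuous.fourierInv_fourier_eq (Complex.continuous_ofReal.comp (wT_cont T)) (wT_integrableC hT0) hi) γ
  change FourierTransformInv.fourierInv (FourierTransform.fourier (fun t => (wT T t : ℂ))) γ = _ at h
  rw [Real.fourierInv_eq'] at h
  simp only [hF, Function.comp_apply] at h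
  have e : ∀ v : ℝ, Complex.exp (((2 * Real.pi * inner ℝ v γ : ℝ):ℂ) * Complex.I) • (kT T (2 * Real.pi * v) : ℂ) =
      (fun u : ℝ => (kT T u : ℂ) * Complex.exp (Complex.I * γ * u)) (2 * Real.pi * v) := by
    intro v
    simp only [smul_eq_mul]
    rw [mul_comm]; congr 2; simp; ring
  simp_rw [e] at h
  rw [Measure.integral_comp_mul_left (fun u : ℝ => (kT T u : ℂ) * Complex.exp (Complex.I * γ * u))] at h
  rw [← h, abs_of_pos (by positivity), Complex.real_smul]
  push_cast
  have : (Real.pi : ℂ) ≠ 0 := by exact_mod_cast hpi.ne'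
  field_simp

lemma kT_integral {T : ℝ} (hT : 1 ≤ T) : ∫ u : ℝ, kT T u = 2 * Real.pi := by
  have h := kT_ft hT 0
  simp at h
  rw [integral_complex_ofReal] at h
  have w0 : wT T 0 = 1 := by simp [wT]
  rw [w0] at h
  have h' := congrArg Complex.re h
  simpa using h'

end RS

namespace RS

lemma swapFT {G w : ℝ → ℂ} (hG : Integrable G) (hw : Integrable w) (y : ℝ) :
    ∫ t : ℝ, w t * (∫ v : ℝ, G v * Complex.exp (-(Complex.I * t * v))) * Complex.exp (Complex.I * t * y) =
      ∫ v : ℝ, G v * ift w (y - v) := by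
  have hp : Integrable (Function.uncurry fun t v : ℝ => w t * Complex.exp (Complex.I * t * y) * (G v * Complex.exp (-(Complex.I * t * v))))
      (volume.prod volume) := by
    have := (hw.mul_prod hG).bdd_mul (c := 1) (f := fun p : ℝ × ℝ => Complex.exp (Complex.I * p.1 * y) * Complex.exp (-(Complex.I * p.1 * p.2)))
      (Continuous.aestronglyMeasurable (by fun_prop)) (ae_of_all _ fun p => by
        rw [norm_mul, norm_expI, Complex.exp_neg, norm_inv, norm_expI]; norm_num)
    refine this.congr (ae_of_all _ fun p => ?_)
    simp only [Function.uncurry]; ring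
  have h := integral_integral_swap hp
  calc _ = ∫ t : ℝ, ∫ v : ℝ, w t * Complex.exp (Complex.I * t * y) * (G v * Complex.exp (-(Complex.I * t * v))) := by
        congr 1; ext t
        rw [integral_const_mul]; ring
    _ = _ := h
    _ = _ := by
        congr 1; ext v
        unfold ift
        rw [← integral_const_mul]
        congr 1; ext t
        have : Complex.exp (Complex.I * t * ((y - v : ℝ):ℂ)) = Complex.exp (Complex.I * t * y) * Complex.exp (-(Complex.I * t * v)) := by
          rw [← Complex.exp_add]; congr 1; push_cast; ring
        rw [this]; ring

lemma RL (h : ℝ → ℂ) : Tendsto (fun y : ℝ => ∫ t : ℝ, h t * Complex.exp (Complex.I * t * y)) atTop (𝓝 0) := by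
  have h1 := Real.tendsto_integral_exp_smul_cocompact h
  have h2 : Tendsto (fun y : ℝ => -(y / (2 * Real.pi))) atTop (cocompact ℝ) := by
    have : Tendsto (fun y : ℝ => -(y / (2 * Real.pi))) atTop atBot :=
      tendsto_neg_atTop_atBot.comp (tendsto_id.atTop_div_const (by positivity))
    exact this.mono_right atBot_le_cocompact
  refine (h1.comp h2).congr fun y => ?_
  simp only [Function.comp_apply]
  congr 1; ext t
  rw [Circle.smul_def, Real.fourierChar_apply, smul_eq_mul, mul_comm]
  congr 2
  have : (Real.pi : ℂ) ≠ 0 := by exact_mod_cast Real.pi_pos.ne'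
  push_cast; field_simp

lemma smoothed {F : ℝ → ℂ} (hm : AEStronglyMeasurable F volume) (h0 : ∀ v < 0, F v = 0)
    (hi : ∀ σ : ℝ, 0 < σ → Integrable fun v : ℝ => F v * Complex.exp (-(σ * v)))
    (henv : Integrable fun v => ‖F v‖ / (1 + v^2)) {H : ℂ → ℂ} {T : ℝ} (hT : 1 ≤ T)
    (hL : ∀ σ t : ℝ, 0 < σ → |t| ≤ T → ∫ v : ℝ, F v * Complex.exp (-(σ + t * Complex.I) * v) = H (σ + t * Complex.I))
    (hH : ContinuousOn H (Set.Icc 0 1 ×ℂ Set.Icc (-T) T)) :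
    (∀ y, Integrable fun v => F v * kT T (y - v)) ∧
    Tendsto (fun y : ℝ => ∫ v : ℝ, F v * kT T (y - v)) atTop (𝓝 0) := by
  have hT0 : 0 < T := by linarith
  have cK : IsCompact (Set.Icc (0:ℝ) 1 ×ℂ Set.Icc (-T) T) := isCompact_Icc.reProdIm isCompact_Icc
  obtain ⟨M, hM⟩ := cK.exists_bound_of_continuousOn hH
  have bd : ∀ y v, ‖F v * kT T (y - v)‖ ≤ (2 * (T + 4) * (1 + y^2)) * (‖F v‖ / (1 + v^2)) := by
    intro y v
    rw [norm_mul, Complex.norm_real, Real.norm_eq_abs, abs_of_nonneg (kT_nonneg hT0 _)]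
    calc _ ≤ ‖F v‖ * (2 * (T + 4) * (1 + y^2) / (1 + v^2)) := mul_le_mul_of_nonneg_left (kT_env hT y v) (norm_nonneg _)
      _ = _ := by ring
  have hkm : ∀ y, AEStronglyMeasurable (fun v => F v * (kT T (y - v) : ℂ)) volume := fun y =>
    hm.mul (Continuous.aestronglyMeasurable (by have := kT_cont T; fun_prop))
  have hIntg : ∀ y, Integrable fun v => F v * (kT T (y - v) : ℂ) := fun y =>
    (henv.const_mul _).mono' (hkm y) (ae_of_all _ (bd y))
  refine ⟨hIntg, ?_⟩
  -- step 1
  have step1 : ∀ σ : ℝ, 0 < σ → ∀ y, ∫ v : ℝ, F v * Complex.exp (-(σ * v)) * kT T (y - v) =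
      ∫ t : ℝ, (wT T t : ℂ) * H (σ + t * Complex.I) * Complex.exp (Complex.I * t * y) := by
    intro σ hσ y
    have h := swapFT (hi σ hσ) (wT_integrableC hT0) y
    rw [ift_wT hT0] at h
    rw [← h]
    congr 1; ext t
    by_cases ht : |t| ≤ T
    · rw [← hL σ t hσ ht]
      congr 2
      congr 1; ext v
      rw [mul_assoc, ← Complex.exp_add]; congr 2; ring
    · rw [wT_zero hT0 (by linarith)]; simp
  -- step 2
  have step2 : ∀ y, ∫ v : ℝ, F v * (kT T (y - v) : ℂ) =
      ∫ t : ℝ, ((wT T t : ℂ) * H (t * Complex.I)) * Complex.exp (Complex.I * t * y) := by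
    intro y
    set s : ℕ → ℝ := fun n => 1 / ((n:ℝ) + 1) with hs
    have s0 : ∀ n, 0 < s n := fun n => by simp only [hs]; positivity
    have s1 : ∀ n, s n ≤ 1 := fun n => by
      simp only [hs]; rw [div_le_one (by positivity)]; have : (0:ℝ) ≤ n := Nat.cast_nonneg n
      linarith
    have slim : Tendsto s atTop (𝓝 0) := tendsto_one_div_add_atTop_nhds_zero_nat
    have L1 : Tendsto (fun n => ∫ v : ℝ, F v * Complex.exp (-(s n * v)) * kT T (y - v)) atTop (𝓝 (∫ v : ℝ, F v * (kT T (y - v) : ℂ))) := by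
      refine tendsto_integral_of_dominated_convergence (fun v => (2 * (T + 4) * (1 + y^2)) * (‖F v‖ / (1 + v^2))) ?_ (henv.const_mul _) ?_ ?_
      · intro n
        exact ((hi (s n) (s0 n)).1).mul (Continuous.aestronglyMeasurable (by have := kT_cont T; fun_prop))
      · intro n
        refine ae_of_all _ fun v => ?_
        rcases lt_or_ge v 0 with hv | hv
        · simp [h0 v hv]
        · refine le_trans ?_ (bd y v)
          rw [norm_mul, norm_mul, norm_mul]
          have : ‖Complex.exp (-(s n * v))‖ ≤ 1 := by
            rw [Complex.norm_exp]; apply Real.exp_le_one_iff.2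
            simp; exact mul_nonneg (s0 n).le hv
          calc _ ≤ ‖F v‖ * 1 * ‖(kT T (y - v) : ℂ)‖ := by gcongr
            _ = _ := by ring
      · refine ae_of_all _ fun v => ?_
        have : Tendsto (fun n => Complex.exp (-(s n * v))) atTop (𝓝 (Complex.exp (-((0:ℝ) * v)))) := by
          have hc : Continuous fun x : ℝ => Complex.exp (-((x:ℂ) * v)) := by fun_prop
          exact (hc.tendsto 0).comp slim
        have := (this.const_mul (F v)).mul_const (kT T (y - v) : ℂ)
        simpa using this
    have L2 : Tendsto (fun n => ∫ t : ℝ, (wT T t : ℂ) * H (s n + t * Complex.I) * Complex.exp (Complex.I * t * y)) atTop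
        (𝓝 (∫ t : ℝ, ((wT T t : ℂ) * H (t * Complex.I)) * Complex.exp (Complex.I * t * y))) := by
      have memK : ∀ x t : ℝ, 0 ≤ x → x ≤ 1 → t ∈ Set.Icc (-T) T → ((x:ℂ) + t * Complex.I) ∈ (Set.Icc (0:ℝ) 1 ×ℂ Set.Icc (-T) T) := by
        intro x t hx hx1 ht
        rw [Complex.mem_reProdIm]; simpa using ⟨⟨hx, hx1⟩, ht⟩
      refine tendsto_integral_of_dominated_convergence (fun t => wT T t * M) ?_ ((wT_integrable hT0).mul_const M) ?_ ?_
      · intro n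
        have hcon : ContinuousOn (fun t : ℝ => (wT T t : ℂ) * H (s n + t * Complex.I) * Complex.exp (Complex.I * t * y)) (Set.Icc (-T) T) := by
          refine ContinuousOn.mul (ContinuousOn.mul (Complex.continuous_ofReal.comp (wT_cont T)).continuousOn ?_) (by fun_prop)
          exact hH.comp (by fun_prop) fun t ht => memK _ t (s0 n).le (s1 n) ht
        exact ((hcon.integrableOn_compact isCompact_Icc).integrable_of_forall_notMem_eq_zero (fun t ht => by
          simp [wT_zero_notMem hT0 ht])).1
      · intro n
        refine ae_of_all _ fun t => ?_
        by_cases ht : t ∈ Set.Icc (-T) T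
        · rw [norm_mul, norm_mul, norm_expI, mul_one, Complex.norm_real, Real.norm_eq_abs, abs_of_nonneg (wT_nonneg T t)]
          exact mul_le_mul_of_nonneg_left (hM _ (memK _ t (s0 n).le (s1 n) ht)) (wT_nonneg T t)
        · simp [wT_zero_notMem hT0 ht]
      · refine ae_of_all _ fun t => ?_
        by_cases ht : t ∈ Set.Icc (-T) T
        · refine Tendsto.mul_const _ (Tendsto.const_mul _ ?_)
          have h1 := hH _ (by simpa using memK 0 t le_rfl zero_le_one ht : ((t:ℂ) * Complex.I) ∈ _)
          refine h1.tendsto.comp (tendsto_nhdsWithin_iff.2 ⟨?_, Eventually.of_forall fun n => memK _ t (s0 n).le (s1 n) ht⟩)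
          have hc : Continuous fun x : ℝ => (x:ℂ) + t * Complex.I := by fun_prop
          have := (hc.tendsto 0).comp slim
          simpa [Function.comp_def] using this
        · simp [wT_zero_notMem hT0 ht]
    refine tendsto_nhds_unique L1 ?_
    refine L2.congr fun n => ?_
    rw [step1 (s n) (s0 n) y]
  simp_rw [step2]
  exact RL _

end RS

namespace RS

def eP (γ v : ℝ) : ℂ := Set.indicator (Set.Ioi (0:ℝ)) (fun v : ℝ => Complex.exp (Complex.I * γ * v)) v

lemma eP_meas (γ : ℝ) : Measurable (eP γ) := by
  unfold eP
  exact (Continuous.measurable (by fun_prop)).indicator measurableSet_Ioi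

lemma norm_eP_le (γ v : ℝ) : ‖eP γ v‖ ≤ 1 := by
  unfold eP
  by_cases hv : v ∈ Set.Ioi (0:ℝ)
  · rw [Set.indicator_of_mem hv, norm_expI]
  · rw [Set.indicator_of_notMem hv]; simp

lemma eP_laplace (γ : ℝ) {w : ℂ} (hw : 0 < w.re) :
    Integrable (fun v : ℝ => eP γ v * Complex.exp (-w * v)) ∧
    ∫ v : ℝ, eP γ v * Complex.exp (-w * v) = 1 / (w - γ * Complex.I) := by
  have e : (fun v : ℝ => eP γ v * Complex.exp (-w * v)) =
      Set.indicator (Set.Ioi (0:ℝ)) (fun v : ℝ => Complex.exp ((Complex.I * γ - w) * v)) := by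
    ext v
    unfold eP
    by_cases hv : v ∈ Set.Ioi (0:ℝ)
    · rw [Set.indicator_of_mem hv, Set.indicator_of_mem hv, ← Complex.exp_add]; congr 1; ring
    · rw [Set.indicator_of_notMem hv, Set.indicator_of_notMem hv, zero_mul]
  have hre : (Complex.I * γ - w).re < 0 := by simp [hw]
  rw [e, integrable_indicator_iff measurableSet_Ioi, integral_indicator measurableSet_Ioi]
  refine ⟨integrableOn_exp_mul_complex_Ioi hre 0, ?_⟩
  rw [integral_exp_mul_complex_Ioi hre]
  simp only [Complex.ofReal_zero, mul_zero, Complex.exp_zero]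
  rw [← neg_div_neg_eq]; congr 1 <;> ring

lemma eP_smooth {T : ℝ} (hT : 1 ≤ T) (γ : ℝ) :
    (∀ y, Integrable fun v => eP γ v * (kT T (y - v) : ℂ)) ∧
    Tendsto (fun y : ℝ => (∫ v : ℝ, eP γ v * (kT T (y - v) : ℂ)) - 2 * Real.pi * wT T γ * Complex.exp (Complex.I * γ * y))
      atTop (𝓝 0) := by
  have hT0 : 0 < T := by linarith
  have kc := kT_cont T
  have ik : ∀ y, Integrable fun v => (kT T (y - v) : ℂ) := fun y => ((kT_integrable hT).comp_sub_left y).ofReal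
  have i1 : ∀ y, Integrable fun v => eP γ v * (kT T (y - v) : ℂ) := fun y =>
    (ik y).bdd_mul (c := 1) (eP_meas γ).aestronglyMeasurable (ae_of_all _ (norm_eP_le γ))
  refine ⟨i1, ?_⟩
  have i2 : ∀ y, Integrable fun v : ℝ => Complex.exp (Complex.I * γ * v) * (kT T (y - v) : ℂ) := fun y =>
    (ik y).bdd_mul (c := 1) (Continuous.aestronglyMeasurable (by fun_prop)) (ae_of_all _ fun v => by rw [norm_expI])
  have full : ∀ y, ∫ v : ℝ, Complex.exp (Complex.I * γ * v) * (kT T (y - v) : ℂ) = 2 * Real.pi * wT T γ * Complex.exp (Complex.I * γ * y) := by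
    intro y
    rw [← integral_sub_left_eq_self _ volume y]
    have h := kT_ft hT (-γ)
    have w' : wT T (-γ) = wT T γ := by simp [wT]
    rw [w'] at h
    rw [← h, ← integral_mul_const]
    congr 1; ext u
    have : Complex.exp (Complex.I * γ * ((y - u : ℝ):ℂ)) = Complex.exp (Complex.I * ((-γ : ℝ):ℂ) * u) * Complex.exp (Complex.I * γ * y) := by
      rw [← Complex.exp_add]; congr 1; push_cast; ring
    rw [sub_sub_cancel, this]; ring
  have e : ∀ y, (∫ v : ℝ, eP γ v * (kT T (y - v) : ℂ)) - 2 * Real.pi * wT T γ * Complex.exp (Complex.I * γ * y) =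
      ∫ v : ℝ, (eP γ v - Complex.exp (Complex.I * γ * v)) * (kT T (y - v) : ℂ) := by
    intro y
    rw [← full y, ← integral_sub (i1 y) (i2 y)]
    congr 1; ext v; ring
  simp_rw [e]
  have z : (0:ℂ) = ∫ v : ℝ, (0:ℂ) := by simp
  rw [z]
  refine tendsto_integral_filter_of_dominated_convergence (fun v => 2 * ((T + 4) * (1 + v^2)⁻¹)) ?_ ?_ ((integrable_inv_one_add_sq.const_mul _).const_mul _) ?_
  · refine Eventually.of_forall fun y => ?_
    exact (((eP_meas γ).sub (Continuous.measurable (by fun_prop))).mul (Continuous.measurable (by fun_prop))).aestronglyMeasurable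
  · filter_upwards [eventually_ge_atTop 0] with y hy
    refine ae_of_all _ fun v => ?_
    by_cases hv : v ∈ Set.Ioi (0:ℝ)
    · unfold eP; rw [Set.indicator_of_mem hv]; simp; positivity
    · have hv' : v ≤ 0 := by simpa using hv
      rw [norm_mul]
      refine mul_le_mul ?_ ?_ (norm_nonneg _) (by norm_num)
      · calc _ ≤ ‖eP γ v‖ + ‖Complex.exp (Complex.I * γ * v)‖ := norm_sub_le _ _
          _ ≤ 2 := by rw [norm_expI]; linarith [norm_eP_le γ v]
      · rw [Complex.norm_real, Real.norm_eq_abs, abs_of_nonneg (kT_nonneg hT0 _), ← div_eq_mul_inv]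
        refine (kT_le3 hT _).trans ?_
        apply div_le_div_of_nonneg_left (by positivity) (by positivity)
        nlinarith
  · refine ae_of_all _ fun v => ?_
    have hk : Tendsto (fun y => kT T (y - v)) atTop (𝓝 0) := by
      have b : Tendsto (fun y : ℝ => (T + 4) / (1 + (y - v)^2)) atTop (𝓝 0) := by
        apply Tendsto.const_div_atTop
        apply tendsto_atTop_add_const_left
        exact (tendsto_pow_atTop two_ne_zero).comp (tendsto_atTop_add_const_right _ (-v) tendsto_id)
      exact squeeze_zero (fun y => kT_nonneg hT0 _) (fun y => kT_le3 hT _) b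
    have hk' : Tendsto (fun y => (kT T (y - v) : ℂ)) atTop (𝓝 0) := by
      have := (Complex.continuous_ofReal.tendsto 0).comp hk
      simpa [Function.comp_def] using this
    have := hk'.const_mul (eP γ v - Complex.exp (Complex.I * γ * v))
    simpa using this

lemma rp_ne_zero (γ : ℝ) : rp γ ≠ 0 := by
  intro h; have := congrArg Complex.re h; simp at this

lemma g_ne_zero (hRH : RHyp) {T : ℝ} {g : ℂ → ℂ}
    (hf : ∀ s, riemannZeta₁ s = (∏ γ ∈ zs (-T) T, (s - rp γ) ^ mz γ) * g s)
    (hn : ∀ γ ∈ zs (-T) T, g (rp γ) ≠ 0) {s : ℂ} (h1 : 1/2 ≤ s.re) (h2 : |s.im| ≤ T) : g s ≠ 0 := by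
  intro h
  have hz : riemannZeta₁ s = 0 := by rw [hf, h, mul_zero]
  have he := zeta1_zero_of_re hRH (by linarith) hz
  have : s.im ∈ zs (-T) T := mem_zs.2 ⟨abs_le.1 h2, by rw [← he]; exact hz⟩
  exact hn _ this (by rw [← he]; exact h)

def Pr (T y : ℝ) : ℝ := -∑ γ ∈ zs (-T) T, (mz γ : ℝ) * wT T γ * ((1/2 * Real.cos (γ * y) + γ * Real.sin (γ * y)) / (1/4 + γ^2))

lemma Pr_re (T y : ℝ) : Pr T y = -(∑ γ ∈ zs (-T) T, (mz γ : ℂ) / rp γ * (wT T γ * Complex.exp (Complex.I * γ * y))).re := by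
  unfold Pr
  rw [Complex.re_sum]
  congr 1
  refine Finset.sum_congr rfl fun γ _ => ?_
  have h1 : Complex.exp (Complex.I * γ * y) = ((Real.cos (γ*y) : ℝ) : ℂ) + ((Real.sin (γ*y) : ℝ):ℂ) * Complex.I := by
    rw [show Complex.I * γ * y = ((γ*y : ℝ):ℂ) * Complex.I by push_cast; ring, Complex.exp_mul_I]; push_cast; rfl
  have h2 : (1 / rp γ) = (((1/2) / (1/4+γ^2) : ℝ):ℂ) - ((γ / (1/4+γ^2) : ℝ):ℂ) * Complex.I := by
    have hd : (1/4 + (γ:ℂ)^2) ≠ 0 := by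
      have : (1/4 + γ^2) ≠ 0 := by positivity
      intro h; apply this
      have h2 : ((1/4 + γ^2 : ℝ):ℂ) = 0 := by push_cast; exact h
      exact_mod_cast h2
    rw [div_eq_iff (rp_ne_zero γ)]
    have : ((((1/2) / (1/4+γ^2) : ℝ):ℂ) - ((γ / (1/4+γ^2) : ℝ):ℂ) * Complex.I) * rp γ = (1/4 - (γ:ℂ)^2 * Complex.I^2) / (1/4 + (γ:ℂ)^2) := by
      unfold rp; push_cast; ring
    rw [this, Complex.I_sq, show (1/4 - (γ:ℂ)^2 * -1) = 1/4 + (γ:ℂ)^2 by ring, div_self hd]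
  have : (mz γ : ℂ) / rp γ * (wT T γ * Complex.exp (Complex.I * γ * y)) = ((mz γ * wT T γ : ℝ):ℂ) * ((1 / rp γ) * Complex.exp (Complex.I * γ * y)) := by
    push_cast; ring
  rw [this, Complex.re_ofReal_mul, h1, h2]
  congr 1
  simp only [Complex.mul_re, Complex.sub_re, Complex.sub_im, Complex.add_re, Complex.add_im, Complex.ofReal_re, Complex.ofReal_im, Complex.I_re, Complex.I_im, Complex.mul_im]
  have : (1/4 + γ^2) ≠ 0 := by positivity
  field_simp; ring

lemma asymp (hRH : RHyp) {T : ℝ} (hT : 1 ≤ T) :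
    (∀ y, Integrable fun v => fF v * kT T (y - v)) ∧
    Tendsto (fun y : ℝ => (∫ v : ℝ, fF v * kT T (y - v)) - 2 * Real.pi * Pr T y) atTop (𝓝 0) := by
  have hT0 : 0 < T := by linarith
  obtain ⟨g, hg, hf, hn⟩ := factor_zs (-T) T
  set S := zs (-T) T with hS
  set F : ℝ → ℂ := fun v => (fF v : ℂ) + ∑ γ ∈ S, (mz γ : ℂ) / rp γ * eP γ v with hF
  set H : ℂ → ℂ := fun w => (∑ γ ∈ S, (mz γ : ℂ) / rp γ) / (w + 1/2) - (logDeriv g (w + 1/2) + 1) / (w + 1/2) with hH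
  have mF : Measurable F := by
    refine (Complex.measurable_ofReal.comp fF_meas).add ?_
    exact Finset.measurable_sum _ fun γ _ => (eP_meas γ).const_mul _
  have hF0 : ∀ v < 0, F v = 0 := by
    intro v hv
    have : ∀ γ, eP γ v = 0 := fun γ => by
      unfold eP; rw [Set.indicator_of_notMem]; simpa using hv.le
    simp [hF, fF_nonpos hv.le, this]
  have hLi : ∀ w : ℂ, 0 < w.re → Integrable (fun v : ℝ => F v * Complex.exp (-w * v)) ∧
      ∫ v : ℝ, F v * Complex.exp (-w * v) = Lf w + ∑ γ ∈ S, (mz γ : ℂ) / rp γ * (1 / (w - γ * Complex.I)) := by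
    intro w hw
    have e : (fun v : ℝ => F v * Complex.exp (-w * v)) = fun v : ℝ => (fF v : ℂ) * Complex.exp (-w * v) + ∑ γ ∈ S, (mz γ : ℂ) / rp γ * (eP γ v * Complex.exp (-w * v)) := by
      ext v; simp only [hF]; rw [add_mul, Finset.sum_mul]; congr 1
      exact Finset.sum_congr rfl fun γ _ => by ring
    have i1 := fF_int hRH hw
    have i2 : ∀ γ ∈ S, Integrable (fun v : ℝ => (mz γ : ℂ) / rp γ * (eP γ v * Complex.exp (-w * v))) := fun γ _ => (eP_laplace γ hw).1.const_mul _
    rw [e]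
    refine ⟨i1.add (integrable_finsetSum S i2), ?_⟩
    rw [integral_add i1 (integrable_finsetSum S i2), fF_laplace hRH hw, integral_finsetSum S i2]
    congr 1
    refine Finset.sum_congr rfl fun γ _ => ?_
    rw [integral_const_mul, (eP_laplace γ hw).2]
  have hi : ∀ σ : ℝ, 0 < σ → Integrable fun v : ℝ => F v * Complex.exp (-(σ * v)) := by
    intro σ hσ
    have := (hLi σ (by simpa using hσ)).1
    simpa [neg_mul] using this
  have henv : Integrable fun v => ‖F v‖ / (1 + v^2) := by
    set M := ∑ γ ∈ S, ‖(mz γ : ℂ) / rp γ‖ with hM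
    have M0 : 0 ≤ M := Finset.sum_nonneg fun _ _ => norm_nonneg _
    refine ((fF_env hRH).const_mul (1 + M)).mono' ((mF.norm.div (by fun_prop)).aestronglyMeasurable) (ae_of_all _ fun v => ?_)
    rw [Real.norm_eq_abs, abs_of_nonneg (by positivity), ← mul_div_assoc]
    apply div_le_div_of_nonneg_right _ (by positivity)
    have h1 : ‖F v‖ ≤ |fF v| + M := by
      refine (norm_add_le _ _).trans (add_le_add (by rw [Complex.norm_real, Real.norm_eq_abs]) ?_)
      refine (norm_sum_le _ _).trans (Finset.sum_le_sum fun γ _ => ?_)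
      rw [norm_mul]
      calc _ ≤ ‖(mz γ : ℂ) / rp γ‖ * 1 := by gcongr; exact norm_eP_le γ v
        _ = _ := mul_one _
    have := abs_nonneg (fF v)
    nlinarith
  have wre : ∀ w : ℂ, (w + 1/2).re = w.re + 1/2 := by intro w; simp
  have wim : ∀ w : ℂ, (w + 1/2).im = w.im := by intro w; simp
  have hL : ∀ σ t : ℝ, 0 < σ → |t| ≤ T → ∫ v : ℝ, F v * Complex.exp (-(σ + t * Complex.I) * v) = H (σ + t * Complex.I) := by
    intro σ t hσ ht
    set w : ℂ := σ + t * Complex.I with hw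
    have hwre : w.re = σ := by simp [hw]
    have hwim : w.im = t := by simp [hw]
    rw [(hLi w (by rw [hwre]; exact hσ)).2]
    have s0 : w + 1/2 ≠ 0 := by
      intro h; have := congrArg Complex.re h; rw [wre, hwre] at this; simp at this; linarith
    have sr : ∀ γ ∈ S, w + 1/2 ≠ rp γ := by
      intro γ _ h; have := congrArg Complex.re h; rw [wre, hwre, rp_re] at this; linarith
    have gs : g (w + 1/2) ≠ 0 := g_ne_zero hRH hf hn (by rw [wre, hwre]; linarith) (by rw [wim, hwim]; exact ht)
    unfold Lf
    rw [logDeriv_factor hg hf sr gs]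
    simp only [hH]
    have : ∀ γ ∈ S, (mz γ : ℂ) / rp γ * (1 / (w - γ * Complex.I)) = (mz γ : ℂ) / (w + 1/2 - rp γ) / (w + 1/2) + (mz γ : ℂ) / rp γ / (w + 1/2) := by
      intro γ hγ
      have a1 := sub_ne_zero.2 (sr γ hγ)
      have a2 := rp_ne_zero γ
      have a3 : w - γ * Complex.I = w + 1/2 - rp γ := by unfold rp; push_cast; ring
      rw [a3]
      generalize w + 1/2 = s at *
      field_simp
      ring
    rw [Finset.sum_congr rfl this, Finset.sum_add_distrib, ← Finset.sum_div, ← Finset.sum_div]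
    ring
  have hHc : ContinuousOn H (Set.Icc 0 1 ×ℂ Set.Icc (-T) T) := by
    intro w hw
    rw [Complex.mem_reProdIm] at hw
    have s0 : w + 1/2 ≠ 0 := by
      intro h; have := congrArg Complex.re h; rw [wre] at this; simp at this; linarith [hw.1.1]
    have gs : g (w + 1/2) ≠ 0 := g_ne_zero hRH hf hn (by rw [wre]; linarith [hw.1.1]) (by rw [wim]; exact abs_le.2 hw.2)
    apply ContinuousAt.continuousWithinAt
    have c1 : ContinuousAt (fun w : ℂ => w + 1/2) w := by fun_prop
    have c2 : ContinuousAt (logDeriv g) (w + 1/2) := by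
      have : ContinuousAt (deriv g) (w + 1/2) := (hg.deriv).continuous.continuousAt
      exact this.div hg.continuous.continuousAt gs
    have c3 : ContinuousAt (fun w => logDeriv g (w + 1/2)) w := ContinuousAt.comp (f := fun w : ℂ => w + 1/2) c2 c1
    exact (continuousAt_const.div c1 s0).sub ((c3.add continuousAt_const).div c1 s0)
  obtain ⟨j1, j2⟩ := smoothed mF.aestronglyMeasurable hF0 hi henv hT hL hHc
  have jf : ∀ y, Integrable fun v => fF v * kT T (y - v) := by
    intro y
    refine ((fF_env hRH).const_mul (2 * (T + 4) * (1 + y^2))).mono' (fF_meas.mul (Continuous.measurable (by have := kT_cont T; fun_prop))).aestronglyMeasurable (ae_of_all _ fun v => ?_)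
    rw [norm_mul, Real.norm_eq_abs, Real.norm_eq_abs, abs_of_nonneg (kT_nonneg hT0 _)]
    calc _ ≤ |fF v| * (2 * (T + 4) * (1 + y^2) / (1 + v^2)) := mul_le_mul_of_nonneg_left (kT_env hT y v) (abs_nonneg _)
      _ = (2 * (T + 4) * (1 + y^2)) * (|fF v| / (1 + v^2)) := by ring
      _ ≤ _ := by gcongr; linarith
  refine ⟨jf, ?_⟩
  have split : ∀ y, ∫ v : ℝ, F v * (kT T (y - v) : ℂ) = ((∫ v : ℝ, fF v * kT T (y - v) : ℝ) : ℂ) + ∑ γ ∈ S, (mz γ : ℂ) / rp γ * ∫ v : ℝ, eP γ v * (kT T (y - v) : ℂ) := by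
    intro y
    have e : (fun v : ℝ => F v * (kT T (y - v) : ℂ)) = fun v : ℝ => ((fF v * kT T (y - v) : ℝ) : ℂ) + ∑ γ ∈ S, (mz γ : ℂ) / rp γ * (eP γ v * (kT T (y - v) : ℂ)) := by
      ext v; simp only [hF]; rw [add_mul, Finset.sum_mul, Complex.ofReal_mul]; congr 1
      exact Finset.sum_congr rfl fun γ _ => by ring
    have i2 : ∀ γ ∈ S, Integrable (fun v : ℝ => (mz γ : ℂ) / rp γ * (eP γ v * (kT T (y - v) : ℂ))) := fun γ _ => ((eP_smooth hT γ).1 y).const_mul _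
    have jc : Integrable (fun v => ((fF v * kT T (y - v) : ℝ) : ℂ)) := (jf y).ofReal
    rw [e, integral_add jc (integrable_finsetSum S i2), integral_finsetSum S i2, integral_complex_ofReal]
    congr 1
    exact Finset.sum_congr rfl fun γ _ => integral_const_mul _ _
  have lim2 : Tendsto (fun y : ℝ => ∑ γ ∈ S, (mz γ : ℂ) / rp γ * ((∫ v : ℝ, eP γ v * (kT T (y - v) : ℂ)) - 2 * Real.pi * wT T γ * Complex.exp (Complex.I * γ * y))) atTop (𝓝 0) := by
    have := tendsto_finsetSum S (f := fun (γ : ℝ) (y : ℝ) => (mz γ : ℂ) / rp γ * ((∫ v : ℝ, eP γ v * (kT T (y - v) : ℂ)) - 2 * Real.pi * wT T γ * Complex.exp (Complex.I * γ * y))) (a := fun _ => (0:ℂ)) (x := atTop) (fun γ _ => by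
      have := ((eP_smooth hT γ).2).const_mul ((mz γ : ℂ) / rp γ)
      simpa using this)
    simpa using this
  have lim3 := j2.sub lim2
  have lim4 := (Complex.continuous_re.tendsto _).comp lim3
  simp only [sub_zero, Complex.zero_re] at lim4
  refine lim4.congr fun y => ?_
  simp only [Function.comp_apply]
  rw [split y, Pr_re, ← hS]
  have : ∑ γ ∈ S, (mz γ : ℂ) / rp γ * ((∫ v : ℝ, eP γ v * (kT T (y - v) : ℂ)) - 2 * Real.pi * wT T γ * Complex.exp (Complex.I * γ * y)) =
      ∑ γ ∈ S, (mz γ : ℂ) / rp γ * (∫ v : ℝ, eP γ v * (kT T (y - v) : ℂ)) - ((2 * Real.pi : ℝ):ℂ) * ∑ γ ∈ S, (mz γ : ℂ) / rp γ * (wT T γ * Complex.exp (Complex.I * γ * y)) := by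
    rw [Finset.mul_sum, ← Finset.sum_sub_distrib]
    refine Finset.sum_congr rfl fun γ _ => ?_
    push_cast; ring
  rw [this, Complex.sub_re, Complex.add_re, Complex.sub_re, Complex.re_ofReal_mul, Complex.ofReal_re]
  ring

end RS

namespace RS

lemma wH_integrable {H : ℂ → ℂ} {T : ℝ} (hT0 : 0 < T) (hH : ContinuousOn H (Set.Icc 0 1 ×ℂ Set.Icc (-T) T))
    {σ : ℝ} (h0 : 0 ≤ σ) (h1 : σ ≤ 1) : Integrable fun t : ℝ => (wT T t : ℂ) * H (σ + t * Complex.I) := by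
  have hcon : ContinuousOn (fun t : ℝ => (wT T t : ℂ) * H (σ + t * Complex.I)) (Set.Icc (-T) T) := by
    refine ContinuousOn.mul (Complex.continuous_ofReal.comp (wT_cont T)).continuousOn ?_
    refine hH.comp (by fun_prop) fun t ht => ?_
    rw [Complex.mem_reProdIm]; simpa using ⟨⟨h0, h1⟩, ht⟩
  exact (hcon.integrableOn_compact isCompact_Icc).integrable_of_forall_notMem_eq_zero (fun t ht => by
    simp [wT_zero_notMem hT0 ht])

lemma wH_lim {H : ℂ → ℂ} {T : ℝ} (hT0 : 0 < T) (hH : ContinuousOn H (Set.Icc 0 1 ×ℂ Set.Icc (-T) T))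
    {s : ℕ → ℝ} (s0 : ∀ n, 0 < s n) (s1 : ∀ n, s n ≤ 1) (slim : Tendsto s atTop (𝓝 0)) :
    Tendsto (fun n => ∫ t : ℝ, (wT T t : ℂ) * H (s n + t * Complex.I)) atTop
        (𝓝 (∫ t : ℝ, ((wT T t : ℂ) * H (t * Complex.I)))) := by
  have cK : IsCompact (Set.Icc (0:ℝ) 1 ×ℂ Set.Icc (-T) T) := isCompact_Icc.reProdIm isCompact_Icc
  obtain ⟨M, hM⟩ := cK.exists_bound_of_continuousOn hH
  have memK : ∀ x t : ℝ, 0 ≤ x → x ≤ 1 → t ∈ Set.Icc (-T) T → ((x:ℂ) + t * Complex.I) ∈ (Set.Icc (0:ℝ) 1 ×ℂ Set.Icc (-T) T) := by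
    intro x t hx hx1 ht
    rw [Complex.mem_reProdIm]; simpa using ⟨⟨hx, hx1⟩, ht⟩
  refine tendsto_integral_of_dominated_convergence (fun t => wT T t * M) ?_ ((wT_integrable hT0).mul_const M) ?_ ?_
  · intro n
    exact (wH_integrable hT0 hH (s0 n).le (s1 n)).1
  · intro n
    refine ae_of_all _ fun t => ?_
    by_cases ht : t ∈ Set.Icc (-T) T
    · rw [norm_mul, Complex.norm_real, Real.norm_eq_abs, abs_of_nonneg (wT_nonneg T t)]
      exact mul_le_mul_of_nonneg_left (hM _ (memK _ t (s0 n).le (s1 n) ht)) (wT_nonneg T t)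
    · simp [wT_zero_notMem hT0 ht]
  · refine ae_of_all _ fun t => ?_
    by_cases ht : t ∈ Set.Icc (-T) T
    · refine (Tendsto.const_mul _ ?_)
      have h1 := hH _ (by simpa using memK 0 t le_rfl zero_le_one ht : ((t:ℂ) * Complex.I) ∈ _)
      refine h1.tendsto.comp (tendsto_nhdsWithin_iff.2 ⟨?_, Eventually.of_forall fun n => memK _ t (s0 n).le (s1 n) ht⟩)
      have hc : Continuous fun x : ℝ => (x:ℂ) + t * Complex.I := by fun_prop
      have := (hc.tendsto 0).comp slim
      simpa [Function.comp_def] using this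
    · simp [wT_zero_notMem hT0 ht]

def kd (T u : ℝ) : ℝ := (ift (fun t => (wT T t : ℂ) * (Complex.I * t)) u).re

lemma wit_int {T : ℝ} (hT : 0 < T) : Integrable (fun t : ℝ => (wT T t : ℂ) * (Complex.I * t)) := by
  have := wT_cont T
  exact (Continuous.integrableOn_Icc (by fun_prop) (a := -T) (b := T)).integrable_of_forall_notMem_eq_zero (fun t ht => by
    simp [wT_zero_notMem hT ht])

lemma kd_cont {T : ℝ} (hT : 0 < T) : Continuous (kd T) :=
  Complex.continuous_re.comp (ift_cont (wit_int hT))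

lemma kd_deriv {T : ℝ} (hT : 0 < T) (u : ℝ) : HasDerivAt (kT T) (kd T u) u := by
  have hw := wT_cont T
  have key := hasDerivAt_integral_of_dominated_loc_of_deriv_le (μ := volume) (x₀ := u) (s := Set.univ)
    (F := fun (u : ℝ) (t : ℝ) => (wT T t : ℂ) * Complex.exp (Complex.I * t * u))
    (F' := fun (u : ℝ) (t : ℝ) => (wT T t : ℂ) * (Complex.I * t) * Complex.exp (Complex.I * t * u))
    (bound := fun t => ‖(wT T t : ℂ) * (Complex.I * t)‖) univ_mem
    (Eventually.of_forall fun x => Continuous.aestronglyMeasurable (by fun_prop))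
    ?_ (Continuous.aestronglyMeasurable (by fun_prop)) ?_ (wit_int hT).norm ?_
  · have h2 := Complex.reCLM.hasFDerivAt.comp_hasDerivAt u key.2
    have e : (Complex.reCLM ∘ fun u : ℝ => ∫ t : ℝ, (wT T t : ℂ) * Complex.exp (Complex.I * t * u)) = kT T := by
      ext x
      have := congrFun (ift_wT hT) x
      unfold ift at this
      simp only [Function.comp_apply, this]; simp
    rw [e] at h2
    exact h2
  · refine ((wT_integrableC hT).bdd_mul (c := 1) (f := fun t : ℝ => Complex.exp (Complex.I * t * u)) (Continuous.aestronglyMeasurable (by fun_prop)) (ae_of_all _ fun t => by rw [norm_expI])).congr (ae_of_all _ fun t => by ring)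
  · exact ae_of_all _ fun t x _ => by rw [norm_mul, norm_expI, mul_one]
  · refine ae_of_all _ fun t x _ => ?_
    have h1 : HasDerivAt (fun x : ℝ => Complex.I * t * (x:ℂ)) (Complex.I * t) x := by
      simpa using ((hasDerivAt_id (x:ℂ)).const_mul (Complex.I * t)).comp_ofReal
    exact (h1.cexp.const_mul (wT T t : ℂ)).congr_deriv (by ring)

lemma kd_odd {T : ℝ} (hT : 0 < T) (u : ℝ) : kd T (-u) = - kd T u := by
  have h1 := (kd_deriv hT (-u)).comp u (hasDerivAt_neg u)
  have e : kT T ∘ Neg.neg = kT T := by ext x; simp [kT_neg]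
  rw [e] at h1
  have := h1.unique (kd_deriv hT u)
  linarith

lemma kd_bound {T v : ℝ} (hT : 1 ≤ T) (hv : 1/2 ≤ v) : |kd T v| ≤ 18 / v^2 := by
  have hT0 : 0 < T := by linarith
  have hv0 : 0 < v := by linarith
  have h1 : HasDerivAt (fun u => 4 * Real.sin (T * u / 2)^2 / (T * u^2))
      ((4 * (2 * Real.sin (T * v / 2) * (Real.cos (T * v / 2) * (T/2))) * (T * v^2) - 4 * Real.sin (T * v / 2)^2 * (T * (2 * v))) / (T * v^2)^2) v := by
    have a1 : HasDerivAt (fun u : ℝ => T * u / 2) (T / 2) v := by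
      have := ((hasDerivAt_id v).const_mul T).div_const 2
      simpa using this
    have a2 := ((a1.sin.pow 2).const_mul 4)
    have a3 : HasDerivAt (fun u : ℝ => T * u^2) (T * (2 * v)) v := by
      have := (hasDerivAt_pow 2 v).const_mul T
      simpa using this
    have a4 := a2.div a3 (by positivity)
    refine a4.congr_deriv ?_
    simp
  have h2 : HasDerivAt (kT T) ((4 * (2 * Real.sin (T * v / 2) * (Real.cos (T * v / 2) * (T/2))) * (T * v^2) - 4 * Real.sin (T * v / 2)^2 * (T * (2 * v))) / (T * v^2)^2) v := by
    refine h1.congr_of_eventuallyEq ?_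
    filter_upwards [isOpen_ne.mem_nhds hv0.ne'] with u hu
    exact kT_eq hT0 hu
  rw [(kd_deriv hT0 v).unique h2]
  have e : (4 * (2 * Real.sin (T * v / 2) * (Real.cos (T * v / 2) * (T/2))) * (T * v^2) - 4 * Real.sin (T * v / 2)^2 * (T * (2 * v))) / (T * v^2)^2
     = (4 * Real.sin (T * v / 2) * Real.cos (T * v / 2) - 8 * Real.sin (T * v / 2)^2 / (T * v)) / v^2 := by
    field_simp; ring
  rw [e, abs_div, abs_of_pos (by positivity : 0 < v^2)]
  apply div_le_div_of_nonneg_right _ (by positivity)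
  set x := T * v / 2
  have s1 := Real.sin_sq_add_cos_sq x
  have b1 : |4 * Real.sin x * Real.cos x| ≤ 2 := by
    rw [abs_le]; constructor <;> nlinarith [sq_nonneg (Real.sin x - Real.cos x), sq_nonneg (Real.sin x + Real.cos x)]
  have b2 : |8 * Real.sin x^2 / (T * v)| ≤ 16 := by
    rw [abs_of_nonneg (by positivity), div_le_iff₀ (by positivity)]
    nlinarith [Real.sin_sq_le_one x]
  refine (abs_sub _ _).trans ?_
  linarith

lemma log2_half : (1/2:ℝ) ≤ Real.log 2 := by linarith [Real.log_two_gt_d9]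

/-- the f-side bound. -/
lemma I_bound (hRH : RHyp) : ∃ C > 0, ∀ T ≥ 1, ∀ σ : ℝ, 0 < σ → σ ≤ 1/4 →
    |∫ v : ℝ, fF v * Real.exp (-σ * v) * ((σ + 1/2) * kT T v - kd T v)| ≤ C * T := by
  set E := ∫ v : ℝ, (|fF v| + 1) / (1 + v^2) with hE
  have E0 : 0 ≤ E := integral_nonneg fun v => by positivity
  refine ⟨5 + 110 * E, by positivity, fun T hT σ hσ hσ1 => ?_⟩
  have hT0 : 0 < T := by linarith
  set a := Real.log 2 with ha
  have ha1 := log2_half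
  rw [← ha] at ha1
  have ha2 : a ≤ 1 := by rw [ha]; linarith [Real.log_two_lt_d9]
  set q : ℝ → ℝ := fun v => (σ + 1/2) * kT T v - kd T v with hq
  have qc : Continuous q := by have := kT_cont T; have := kd_cont hT0; simp only [hq]; fun_prop
  set Φ : ℝ → ℝ := fun v => fF v * Real.exp (-σ * v) * q v with hΦ
  have mΦ : Measurable Φ := (fF_meas.mul (Continuous.measurable (by fun_prop))).mul qc.measurable
  have bq : ∀ v, a < v → |Φ v| ≤ 110 * ((|fF v| + 1) / (1 + v^2)) := by
    intro v hv
    have hv0 : 1/2 ≤ v := by linarith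
    have hvp : 0 < v := by linarith
    have k1 : kT T v ≤ 4 / v^2 := by rw [le_div_iff₀ (by positivity)]; exact kT_le2 hT
    have k0 := kT_nonneg hT0 v
    have k2 := kd_bound hT hv0
    have q1 : |q v| ≤ 22 / v^2 := by
      calc |q v| ≤ |(σ + 1/2) * kT T v| + |kd T v| := by simp only [hq]; exact abs_sub _ _
        _ ≤ 4 / v^2 + 18 / v^2 := by
          apply add_le_add _ k2
          rw [abs_of_nonneg (by positivity)]; nlinarith
        _ = _ := by ring
    have e1 : Real.exp (-σ * v) ≤ 1 := Real.exp_le_one_iff.2 (by nlinarith)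
    calc |Φ v| = |fF v| * Real.exp (-σ * v) * |q v| := by
          simp only [hΦ]; rw [abs_mul, abs_mul, abs_of_pos (Real.exp_pos _)]
      _ ≤ |fF v| * 1 * (22 / v^2) := by gcongr
      _ ≤ (|fF v| + 1) * (110 / (1 + v^2)) := by
          rw [mul_one]
          apply mul_le_mul (by linarith) _ (by positivity) (by positivity)
          rw [div_le_div_iff₀ (by positivity) (by positivity)]; nlinarith
      _ = _ := by ring
  have i3 : IntegrableOn Φ (Set.Ioi a) := by
    refine (((fF_env hRH).const_mul 110).integrableOn).mono' mΦ.aestronglyMeasurable ?_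
    filter_upwards [ae_restrict_mem measurableSet_Ioi] with v hv
    exact bq v hv
  set ψ : ℝ → ℝ := fun v => -(Real.exp ((1/2 - σ) * v) * q v) with hψ
  have ψc : Continuous ψ := by simp only [hψ]; fun_prop
  have eqm : Set.EqOn Φ ψ (Set.Ioo 0 a) := by
    intro v hv
    simp only [hΦ, hψ]
    rw [fF_eq_small hv.1 hv.2, show (1/2 - σ) * v = v/2 + (-σ * v) by ring, Real.exp_add]; ring
  have i2 : IntegrableOn Φ (Set.Ioc 0 a) := by
    rw [integrableOn_Ioc_iff_integrableOn_Ioo]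
    exact ((ψc.integrableOn_Icc (a := 0) (b := a)).mono_set Set.Ioo_subset_Icc_self).congr_fun eqm.symm measurableSet_Ioo
  have z1 : ∀ v ∉ Set.Ioi (0:ℝ), Φ v = 0 := by
    intro v hv
    have : v ≤ 0 := by simpa using hv
    simp [hΦ, fF_nonpos this]
  have s1 : ∫ v, Φ v = (∫ v in Set.Ioc 0 a, Φ v) + ∫ v in Set.Ioi a, Φ v := by
    rw [← setIntegral_eq_integral_of_forall_compl_eq_zero z1, ← Set.Ioc_union_Ioi_eq_Ioi (by linarith : (0:ℝ) ≤ a)]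
    rw [setIntegral_union (Set.Ioc_disjoint_Ioi le_rfl) measurableSet_Ioi i2 i3]
  have b3 : |∫ v in Set.Ioi a, Φ v| ≤ 110 * E := by
    calc _ ≤ ∫ v in Set.Ioi a, |Φ v| := abs_integral_le_integral_abs
      _ ≤ ∫ v in Set.Ioi a, 110 * ((|fF v| + 1) / (1 + v^2)) := by
        refine setIntegral_mono_on i3.abs ((fF_env hRH).const_mul 110).integrableOn measurableSet_Ioi fun v hv => bq v hv
      _ ≤ ∫ v, 110 * ((|fF v| + 1) / (1 + v^2)) :=
        setIntegral_le_integral ((fF_env hRH).const_mul 110) (ae_of_all _ fun v => by positivity)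
      _ = 110 * E := by rw [integral_const_mul]
  have b2 : |∫ v in Set.Ioc 0 a, Φ v| ≤ 5 * T := by
    have e1 : ∫ v in Set.Ioc 0 a, Φ v = ∫ v in (0:ℝ)..a, ψ v := by
      rw [intervalIntegral.integral_of_le (by linarith), integral_Ioc_eq_integral_Ioo, integral_Ioc_eq_integral_Ioo]
      exact setIntegral_congr_fun measurableSet_Ioo eqm
    set p : ℝ → ℝ := fun v => Real.exp ((1/2 - σ) * v) * kT T v with hp
    have pc : Continuous p := by have := kT_cont T; simp only [hp]; fun_prop
    have dp : ∀ v, HasDerivAt p (ψ v + p v) v := by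
      intro v
      have d1 : HasDerivAt (fun v : ℝ => Real.exp ((1/2 - σ) * v)) (Real.exp ((1/2 - σ) * v) * (1/2 - σ)) v := by
        have := ((hasDerivAt_id v).const_mul (1/2 - σ)).exp
        simpa using this
      refine (d1.mul (kd_deriv hT0 v)).congr_deriv ?_
      simp only [hψ, hp, hq]; ring
    have ft := intervalIntegral.integral_eq_sub_of_hasDerivAt (fun v _ => dp v) ((ψc.add pc).intervalIntegrable 0 a)
    rw [intervalIntegral.integral_add (ψc.intervalIntegrable _ _) (pc.intervalIntegrable _ _)] at ft
    have pb : ∀ v, 0 ≤ v → v ≤ a → 0 ≤ p v ∧ p v ≤ 2 * T := by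
      intro v h0 h1
      have x1 : Real.exp ((1/2 - σ) * v) ≤ 2 := by
        calc _ ≤ Real.exp a := by apply Real.exp_le_exp.2; nlinarith
          _ = 2 := by rw [ha, Real.exp_log (by norm_num)]
      have k0 := kT_nonneg hT0 v
      have k1 := kT_le hT0 v
      refine ⟨by simp only [hp]; positivity, ?_⟩
      simp only [hp]; exact mul_le_mul x1 k1 k0 (by norm_num)
    have p0 : p 0 ≤ T := by simp only [hp]; simp; exact kT_le hT0 0
    have pI0 : 0 ≤ ∫ v in (0:ℝ)..a, p v := intervalIntegral.integral_nonneg (by linarith) fun v hv => (pb v hv.1 hv.2).1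
    have pI1 : ∫ v in (0:ℝ)..a, p v ≤ 2 * T := by
      calc _ ≤ ∫ v in (0:ℝ)..a, 2 * T := intervalIntegral.integral_mono_on (by linarith) (pc.intervalIntegrable _ _) (by simp) fun v hv => (pb v hv.1 hv.2).2
        _ = a * (2 * T) := by simp; ring
        _ ≤ _ := by nlinarith
    have pa := pb a (by linarith) le_rfl
    have p00 := (pb 0 le_rfl (by linarith)).1
    rw [e1, abs_le]; constructor <;> linarith [pa.1, pa.2]
  rw [s1]
  calc _ ≤ _ := abs_add_le _ _
    _ ≤ 5 * T + 110 * E := add_le_add b2 b3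
    _ ≤ _ := by nlinarith

end RS

namespace RS

lemma ift_w1 {T : ℝ} (hT : 0 < T) (σ v : ℝ) :
    (ift (fun t => (wT T t : ℂ) * (σ + 1/2 + Complex.I * t)) (0 - v)).re = (σ + 1/2) * kT T v - kd T v := by
  have i1 : Integrable (fun t : ℝ => ((σ:ℂ)+1/2) * ((wT T t : ℂ) * Complex.exp (Complex.I * t * ((0 - v : ℝ):ℂ)))) := by
    refine Integrable.const_mul ?_ _
    exact (wT_integrableC hT).mul_bdd (c := 1) (g := fun t : ℝ => Complex.exp (Complex.I * t * ((0 - v : ℝ):ℂ))) (Continuous.aestronglyMeasurable (by fun_prop)) (ae_of_all _ fun t => by rw [norm_expI])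
  have i2 : Integrable (fun t : ℝ => (wT T t : ℂ) * (Complex.I * t) * Complex.exp (Complex.I * t * ((0 - v : ℝ):ℂ))) := by
    exact (wit_int hT).mul_bdd (c := 1) (g := fun t : ℝ => Complex.exp (Complex.I * t * ((0 - v : ℝ):ℂ))) (Continuous.aestronglyMeasurable (by fun_prop)) (ae_of_all _ fun t => by rw [norm_expI])
  have e : ift (fun t => (wT T t : ℂ) * (σ + 1/2 + Complex.I * t)) (0 - v) = ((σ:ℂ)+1/2) * ift (fun t => (wT T t : ℂ)) (0 - v) + ift (fun t => (wT T t : ℂ) * (Complex.I * t)) (0 - v) := by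
    unfold ift
    rw [← integral_const_mul, ← integral_add i1 i2]
    congr 1; ext t; ring
  rw [e, ift_wT hT, Complex.add_re]
  have h1 : (ift (fun t => (wT T t : ℂ) * (Complex.I * t)) (0 - v)).re = kd T (-v) := by rw [zero_sub]; rfl
  rw [h1, kd_odd hT, zero_sub]
  beta_reduce
  rw [kT_neg, Complex.re_mul_ofReal]
  simp; ring

lemma I_t (hRH : RHyp) {T σ : ℝ} (hT : 1 ≤ T) (hσ : 0 < σ) :
    (∫ t : ℝ, (wT T t : ℂ) * (-(logDeriv riemannZeta₁ (σ + t * Complex.I + 1/2) + 1))).re =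
      ∫ v : ℝ, fF v * Real.exp (-σ * v) * ((σ + 1/2) * kT T v - kd T v) := by
  have hT0 : 0 < T := by linarith
  have hw := wT_cont T
  set w1 : ℝ → ℂ := fun t => (wT T t : ℂ) * (σ + 1/2 + Complex.I * t) with hw1
  have iw1 : Integrable w1 :=
    (Continuous.integrableOn_Icc (by fun_prop) (a := -T) (b := T)).integrable_of_forall_notMem_eq_zero (fun t ht => by
      simp [hw1, wT_zero_notMem hT0 ht])
  set G : ℝ → ℂ := fun v => (fF v : ℂ) * Complex.exp (-(σ:ℂ) * v) with hG
  have iG : Integrable G := fF_int hRH (w := (σ:ℂ)) (by simpa using hσ)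
  have h := swapFT iG iw1 0
  have e1 : ∀ t : ℝ, w1 t * (∫ v : ℝ, G v * Complex.exp (-(Complex.I * t * v))) * Complex.exp (Complex.I * t * (0:ℝ)) =
      (wT T t : ℂ) * (-(logDeriv riemannZeta₁ (σ + t * Complex.I + 1/2) + 1)) := by
    intro t
    have : ∫ v : ℝ, G v * Complex.exp (-(Complex.I * t * v)) = Lf (σ + t * Complex.I) := by
      rw [← fF_laplace hRH (w := σ + t * Complex.I) (by simpa using hσ)]
      congr 1; ext v
      simp only [hG]; rw [mul_assoc, ← Complex.exp_add]; congr 2; ring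
    rw [this]; unfold Lf
    have s0 : (σ + t * Complex.I + 1/2 : ℂ) ≠ 0 := by
      intro h; have := congrArg Complex.re h; simp at this; linarith
    have : (σ + 1/2 + Complex.I * t : ℂ) = σ + t * Complex.I + 1/2 := by ring
    simp only [hw1]
    rw [this]
    simp only [Complex.ofReal_zero, mul_zero, Complex.exp_zero, mul_one]
    rw [mul_assoc, mul_div_cancel₀ _ s0]
  simp_rw [e1] at h
  rw [h]
  have ii : Integrable fun v => G v * ift w1 (0 - v) :=
    iG.mul_bdd (c := ∫ t, ‖w1 t‖) (((ift_cont iw1).comp (by fun_prop : Continuous fun v : ℝ => 0 - v)).aestronglyMeasurable) (ae_of_all _ fun v => ift_norm_le _ _)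
  have := Complex.reCLM.integral_comp_comm ii
  change _ = (∫ v : ℝ, G v * ift w1 (0 - v)).re at this
  rw [← this]
  congr 1; ext v
  have hGr : G v = ((fF v * Real.exp (-σ * v) : ℝ) : ℂ) := by simp [hG]
  rw [hGr, Complex.reCLM_apply, Complex.re_ofReal_mul, ift_w1 hT0]

lemma wT_int_le {T : ℝ} (hT : 0 < T) : ∫ t, wT T t ≤ 2 * T := by
  have e : ∫ t, wT T t = ∫ t in Set.Icc (-T) T, wT T t :=
    (setIntegral_eq_integral_of_forall_compl_eq_zero fun t ht => wT_zero_notMem hT ht).symm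
  rw [e]
  calc _ ≤ ∫ t in Set.Icc (-T) T, (1:ℝ) :=
        setIntegral_mono_on (wT_integrable hT).integrableOn (integrableOn_const (by simp)) measurableSet_Icc fun t _ => wT_le_one hT t
    _ = 2 * T := by simp; rw [max_eq_left (by linarith)]; ring

lemma re_inv_sub (σ t γ : ℝ) (m : ℕ) :
    ((m : ℂ) / (σ + t * Complex.I + 1/2 - rp γ)).re = m * (σ * (1 / (σ^2 + (t - γ)^2))) := by
  have e : (σ + t * Complex.I + 1/2 - rp γ : ℂ) = ((σ:ℝ):ℂ) + ((t - γ : ℝ):ℂ) * Complex.I := by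
    unfold rp; push_cast; ring
  rw [e, div_eq_mul_inv, show (m:ℂ) = ((m:ℝ):ℂ) by norm_cast, Complex.re_ofReal_mul, Complex.inv_re]
  congr 1
  simp only [Complex.normSq_apply, Complex.add_re, Complex.add_im, Complex.ofReal_re, Complex.ofReal_im, Complex.mul_re, Complex.mul_im, Complex.I_re, Complex.I_im]
  rw [mul_one_div]
  congr 1 <;> ring

lemma count_lower (hRH : RHyp) : ∃ C > 0, ∀ T ≥ 4, T / 16 * Real.log (T / 4) - C * T ≤ Real.pi * ∑ γ ∈ zs (-T) T, (mz γ : ℝ) := by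
  obtain ⟨C1, hC1, hI⟩ := I_bound hRH
  obtain ⟨C2, hC2, hR⟩ := re_logDeriv_zeta1_le
  refine ⟨C1 + 2 + 2 * C2, by positivity, fun T hT => ?_⟩
  have hT1 : 1 ≤ T := by linarith
  have hT0 : 0 < T := by linarith
  obtain ⟨g, hg, hf, hn⟩ := factor_zs (-T) T
  set S := zs (-T) T with hS
  set N := ∑ γ ∈ S, (mz γ : ℝ) with hN
  have wre : ∀ w : ℂ, (w + 1/2).re = w.re + 1/2 := by intro w; simp
  have wim : ∀ w : ℂ, (w + 1/2).im = w.im := by intro w; simp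
  set H : ℂ → ℂ := fun w => logDeriv g (w + 1/2) with hH
  have hHc : ContinuousOn H (Set.Icc 0 1 ×ℂ Set.Icc (-T) T) := by
    intro w hw
    rw [Complex.mem_reProdIm] at hw
    have gs : g (w + 1/2) ≠ 0 := g_ne_zero hRH hf hn (by rw [wre]; linarith [hw.1.1]) (by rw [wim]; exact abs_le.2 hw.2)
    apply ContinuousAt.continuousWithinAt
    have c1 : ContinuousAt (fun w : ℂ => w + 1/2) w := by fun_prop
    have c2 : ContinuousAt (logDeriv g) (w + 1/2) := by
      have : ContinuousAt (deriv g) (w + 1/2) := (hg.deriv).continuous.continuousAt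
      exact this.div hg.continuous.continuousAt gs
    exact ContinuousAt.comp (f := fun w : ℂ => w + 1/2) c2 c1
  -- bound at σ
  have key : ∀ σ : ℝ, 0 < σ → σ ≤ 1/4 → -(∫ t : ℝ, (wT T t : ℂ) * H (σ + t * Complex.I)).re ≤ C1 * T + Real.pi * N + 2 * T := by
    intro σ hσ hσ1
    have b1 := hI T hT1 σ hσ hσ1
    rw [← I_t hRH hT1 hσ] at b1
    have iH := wH_integrable hT0 hHc hσ.le (by linarith : σ ≤ 1)
    have iP : ∀ γ, Integrable fun t : ℝ => wT T t * (1 / (σ^2 + (t - γ)^2)) := fun γ =>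
      (integral_poisson hσ γ).1.bdd_mul (c := 1) (wT_cont T).aestronglyMeasurable (ae_of_all _ fun t => by
        rw [Real.norm_eq_abs, abs_of_nonneg (wT_nonneg T t)]; exact wT_le_one hT0 t)
    -- decomposition
    have iD : ∀ γ ∈ S, Integrable fun t : ℝ => (wT T t : ℂ) * ((mz γ : ℂ) / (σ + t * Complex.I + 1/2 - rp γ)) := by
      intro γ _
      have hne : ∀ t : ℝ, (σ + t * Complex.I + 1/2 - rp γ : ℂ) ≠ 0 := by
        intro t h; have := congrArg Complex.re h; simp at this; linarith
      have hc : Continuous fun t : ℝ => (wT T t : ℂ) * ((mz γ : ℂ) / (σ + t * Complex.I + 1/2 - rp γ)) := by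
        refine (Complex.continuous_ofReal.comp (wT_cont T)).mul (continuous_const.div (by fun_prop) hne)
      exact (hc.integrableOn_Icc (a := -T) (b := T)).integrable_of_forall_notMem_eq_zero (fun t ht => by
        simp [wT_zero_notMem hT0 ht])
    have e1 : (fun t : ℝ => (wT T t : ℂ) * (-(logDeriv riemannZeta₁ (σ + t * Complex.I + 1/2) + 1))) =
        fun t : ℝ => -((∑ γ ∈ S, (wT T t : ℂ) * ((mz γ : ℂ) / (σ + t * Complex.I + 1/2 - rp γ))) + (wT T t : ℂ) * H (σ + t * Complex.I) + (wT T t : ℂ)) := by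
      ext t
      by_cases ht : |t| ≤ T
      · have sr : ∀ γ ∈ S, (σ + t * Complex.I + 1/2 : ℂ) ≠ rp γ := by
          intro γ _ h; have := congrArg Complex.re h; simp at this; linarith
        have gs : g (σ + t * Complex.I + 1/2) ≠ 0 := g_ne_zero hRH hf hn (by simp; linarith) (by simpa using ht)
        rw [logDeriv_factor hg hf sr gs, ← Finset.mul_sum]
        simp only [hH]; ring
      · rw [wT_zero hT0 (by linarith)]; simp
    have iS : Integrable (fun t : ℝ => (∑ γ ∈ S, (wT T t : ℂ) * ((mz γ : ℂ) / (σ + t * Complex.I + 1/2 - rp γ))) + (wT T t : ℂ) * H (σ + t * Complex.I)) := (integrable_finsetSum S iD).add iH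
    rw [e1, integral_neg, integral_add iS (wT_integrableC hT0), integral_add (integrable_finsetSum S iD) iH, integral_finsetSum S iD,
      integral_complex_ofReal] at b1
    rw [Complex.neg_re, abs_neg, Complex.add_re, Complex.add_re, Complex.ofReal_re, Complex.re_sum] at b1
    have b2 : ∑ γ ∈ S, (∫ t : ℝ, (wT T t : ℂ) * ((mz γ : ℂ) / (σ + t * Complex.I + 1/2 - rp γ))).re ≤ Real.pi * N := by
      rw [hN, Finset.mul_sum]
      refine Finset.sum_le_sum fun γ hγ => ?_
      have := Complex.reCLM.integral_comp_comm (iD γ hγ)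
      rw [Complex.reCLM_apply] at this
      rw [← this]
      have e2 : ∀ t : ℝ, Complex.reCLM ((wT T t : ℂ) * ((mz γ : ℂ) / (σ + t * Complex.I + 1/2 - rp γ))) = (mz γ * σ) * (wT T t * (1 / (σ^2 + (t - γ)^2))) := by
        intro t
        rw [Complex.reCLM_apply, Complex.re_ofReal_mul, re_inv_sub]; ring
      simp_rw [e2]
      rw [integral_const_mul]
      have : ∫ t : ℝ, wT T t * (1 / (σ^2 + (t - γ)^2)) ≤ Real.pi / σ := by
        rw [← (integral_poisson hσ γ).2]
        refine integral_mono (iP γ) (integral_poisson hσ γ).1 fun t => ?_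
        exact mul_le_of_le_one_left (by positivity) (wT_le_one hT0 t)
      calc _ ≤ (mz γ * σ) * (Real.pi / σ) := mul_le_mul_of_nonneg_left this (by positivity)
        _ = _ := by field_simp
    have b3 := wT_int_le hT0
    have := (abs_le.1 b1).1
    linarith
  set s : ℕ → ℝ := fun n => 1/4 * (1 / ((n:ℝ) + 1)) with hs
  have s0 : ∀ n, 0 < s n := fun n => by simp only [hs]; positivity
  have s1 : ∀ n, s n ≤ 1/4 := fun n => by
    simp only [hs]
    have : 1 / ((n:ℝ) + 1) ≤ 1 := by
      rw [div_le_one (by positivity)]; have : (0:ℝ) ≤ n := Nat.cast_nonneg n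
      linarith
    linarith
  have slim : Tendsto s atTop (𝓝 0) := by
    have := (tendsto_one_div_add_atTop_nhds_zero_nat (𝕜 := ℝ)).const_mul (1/4)
    simpa [hs] using this
  have L := wH_lim hT0 hHc s0 (fun n => (s1 n).trans (by norm_num)) slim
  have L2 := ((Complex.continuous_re.tendsto _).comp L).neg
  have key0 : -(∫ t : ℝ, (wT T t : ℂ) * H (t * Complex.I)).re ≤ C1 * T + Real.pi * N + 2 * T :=
    le_of_tendsto L2 (Eventually.of_forall fun n => key (s n) (s0 n) (s1 n))
  have iH0 : Integrable fun t : ℝ => (wT T t : ℂ) * H (t * Complex.I) := by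
    have := wH_integrable hT0 hHc le_rfl zero_le_one
    simpa using this
  have e0 : (∫ t : ℝ, (wT T t : ℂ) * H (t * Complex.I)).re = ∫ t : ℝ, wT T t * (H (t * Complex.I)).re := by
    have := Complex.reCLM.integral_comp_comm iH0
    rw [Complex.reCLM_apply] at this
    rw [← this]
    congr 1; ext t; rw [Complex.reCLM_apply, Complex.re_ofReal_mul]
  have iHr : Integrable fun t : ℝ => wT T t * (H (t * Complex.I)).re := by
    have := iH0.re
    refine this.congr (ae_of_all _ fun t => ?_)
    simp
  rw [e0, ← integral_neg] at key0
  -- pointwise lower bound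
  have hae : ∀ᵐ t : ℝ, t ∉ (S : Set ℝ) := by
    have : volume (S : Set ℝ) = 0 := S.finite_toSet.measure_zero _
    exact measure_eq_zero_iff_ae_notMem.1 this
  have pw : ∀ t : ℝ, t ∉ (S : Set ℝ) → wT T t * ((1/2) * Real.log (1 + |t|) - C2) ≤ -(wT T t * (H (t * Complex.I)).re) := by
    intro t ht
    by_cases htT : |t| ≤ T
    · have hz : riemannZeta₁ (rp t) ≠ 0 := by
        intro h; exact ht (mem_zs.2 ⟨abs_le.1 htT, h⟩)
      have h1 := hR t hz
      have sr : ∀ γ ∈ S, (rp t : ℂ) ≠ rp γ := by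
        intro γ hγ h; apply ht; rw [rp_inj h]; exact hγ
      have gs : g (rp t) ≠ 0 := g_ne_zero hRH hf hn (by simp) (by simpa using htT)
      rw [logDeriv_factor hg hf sr gs, Complex.add_re, Complex.re_sum] at h1
      have z : ∑ γ ∈ S, ((mz γ : ℂ) / (rp t - rp γ)).re = 0 := by
        refine Finset.sum_eq_zero fun γ _ => ?_
        have := re_inv_sub 0 t γ (mz γ)
        simp only [zero_mul, mul_zero] at this
        rw [← this]; congr 2; unfold rp; push_cast; ring
      rw [z, zero_add] at h1
      have e : (t * Complex.I + 1/2 : ℂ) = rp t := by unfold rp; push_cast; ring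
      simp only [hH]; rw [e, ← mul_neg]
      exact mul_le_mul_of_nonneg_left (by linarith) (wT_nonneg T t)
    · rw [wT_zero hT0 (by linarith)]; simp
  have hlc : Continuous fun t : ℝ => Real.log (1 + |t|) := by
    refine Continuous.log (by fun_prop) fun t => by positivity
  have il : Integrable fun t : ℝ => wT T t * Real.log (1 + |t|) :=
    (Continuous.integrableOn_Icc ((wT_cont T).mul hlc) (a := -T) (b := T)).integrable_of_forall_notMem_eq_zero (fun t ht => by
        simp [wT_zero_notMem hT0 ht])
  have iL : Integrable fun t : ℝ => wT T t * ((1/2) * Real.log (1 + |t|) - C2) := by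
    refine ((il.const_mul (1/2)).sub ((wT_integrable hT0).mul_const C2)).congr (ae_of_all _ fun t => ?_)
    simp only [Pi.sub_apply]; ring
  have low : ∫ t : ℝ, wT T t * ((1/2) * Real.log (1 + |t|) - C2) ≤ C1 * T + Real.pi * N + 2 * T := by
    refine le_trans (integral_mono_ae iL iHr.neg ?_) key0
    filter_upwards [hae] with t ht using pw t ht
  have e3 : ∫ t : ℝ, wT T t * ((1/2) * Real.log (1 + |t|) - C2) = (1/2) * (∫ t : ℝ, wT T t * Real.log (1 + |t|)) - (∫ t, wT T t) * C2 := by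
    rw [← integral_const_mul, ← integral_mul_const, ← integral_sub (il.const_mul _) ((wT_integrable hT0).mul_const C2)]
    congr 1; ext t; ring
  have low2 : T / 8 * Real.log (T / 4) ≤ ∫ t : ℝ, wT T t * Real.log (1 + |t|) := by
    calc T / 8 * Real.log (T / 4) = ∫ t in Set.Icc (T/4) (T/2), (1/2) * Real.log (T/4) := by
          simp; rw [max_eq_left (by linarith)]; ring
      _ ≤ ∫ t in Set.Icc (T/4) (T/2), wT T t * Real.log (1 + |t|) := by
          refine setIntegral_mono_on (integrableOn_const (by simp)) il.integrableOn measurableSet_Icc fun t ht => ?_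
          have t0 : 0 ≤ t := by linarith [ht.1]
          have a1 : 1/2 ≤ wT T t := wT_half hT0 (by rw [abs_of_nonneg t0]; exact ht.2)
          have a2 : 0 ≤ Real.log (T/4) := Real.log_nonneg (by linarith)
          have a3 : Real.log (T/4) ≤ Real.log (1 + |t|) := Real.log_le_log (by positivity) (by rw [abs_of_nonneg t0]; linarith [ht.1])
          exact mul_le_mul a1 a3 a2 (by linarith)
      _ ≤ _ := setIntegral_le_integral il (ae_of_all _ fun t => mul_nonneg (wT_nonneg T t) (Real.log_nonneg (by linarith [abs_nonneg t])))
  have := wT_int_le hT0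
  have : (∫ t, wT T t) * C2 ≤ 2 * T * C2 := by gcongr
  nlinarith

end RS

namespace RS

lemma sum_inv_sq : ∃ C > 0, ∀ T : ℝ, ∑ γ ∈ zs (-T) T, (mz γ : ℝ) / (1/4 + γ^2) ≤ C := by
  obtain ⟨C0, hC0, hc⟩ := count_bound
  set φ : ℤ → ℝ := fun n => ell n ^ 2 / (1 + |(n:ℝ)|) ^ 2 with hφ
  have φ0 : ∀ n, 0 ≤ φ n := fun n => by simp only [hφ]; positivity
  refine ⟨24 * C0 * (∑' n, φ n) + 1, by have : 0 ≤ ∑' n, φ n := (tsum_nonneg φ0); positivity, fun T => ?_⟩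
  set S := zs (-T) T with hS
  have e := Finset.sum_fiberwise_of_maps_to (s := S) (t := S.image (fun γ => ⌊γ⌋)) (g := fun γ => ⌊γ⌋) (fun γ hγ => Finset.mem_image_of_mem _ hγ) (fun γ => (mz γ : ℝ) / (1/4 + γ^2))
  rw [← e]
  have hb : ∀ n : ℤ, ∑ γ ∈ S with ⌊γ⌋ = n, (mz γ : ℝ) / (1/4 + γ^2) ≤ 24 * C0 * φ n := by
    intro n
    have hfl : ∀ γ ∈ S.filter (fun γ => ⌊γ⌋ = n), (n:ℝ) ≤ γ ∧ γ ≤ n + 1 := by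
      intro γ hγ
      have h := (Finset.mem_filter.1 hγ).2
      subst h
      exact ⟨Int.floor_le γ, (Int.lt_floor_add_one γ).le⟩
    calc ∑ γ ∈ S with ⌊γ⌋ = n, (mz γ : ℝ) / (1/4 + γ^2)
        ≤ ∑ γ ∈ S with ⌊γ⌋ = n, (mz γ : ℝ) * (24 / (1 + |(n:ℝ)|)^2) := by
          refine Finset.sum_le_sum fun γ hγ => ?_
          obtain ⟨h1, h2⟩ := hfl γ hγ
          rw [div_eq_mul_inv]
          refine mul_le_mul_of_nonneg_left ?_ (Nat.cast_nonneg _)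
          rw [inv_eq_one_div, div_le_div_iff₀ (by positivity) (by positivity)]
          have : (1 + |(n:ℝ)|)^2 ≤ 2 * (1 + (n:ℝ)^2) := by
            nlinarith [sq_nonneg (1 - |(n:ℝ)|), sq_abs (n:ℝ)]
          have : (n:ℝ)^2 ≤ 2 * γ^2 + 2 := by nlinarith [sq_nonneg (2 * γ - n)]
          nlinarith [sq_nonneg γ]
      _ = (24 / (1 + |(n:ℝ)|)^2) * ∑ γ ∈ S with ⌊γ⌋ = n, (mz γ : ℝ) := by
          rw [← Finset.sum_mul, mul_comm]
      _ ≤ (24 / (1 + |(n:ℝ)|)^2) * ∑ γ ∈ zs ((n:ℝ) - 1) (n + 1), (mz γ : ℝ) := by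
          refine mul_le_mul_of_nonneg_left ?_ (by positivity)
          refine Finset.sum_le_sum_of_subset_of_nonneg (fun γ hγ => ?_) (fun _ _ _ => Nat.cast_nonneg _)
          obtain ⟨h1, h2⟩ := hfl γ hγ
          exact mem_zs.2 ⟨⟨by linarith, h2⟩, (mem_zs.1 (Finset.mem_filter.1 hγ).1).2⟩
      _ ≤ (24 / (1 + |(n:ℝ)|)^2) * (C0 * ell n ^ 2) := by
          refine mul_le_mul_of_nonneg_left ((hc n).trans ?_) (by positivity)
          have := one_le_ell n
          refine mul_le_mul_of_nonneg_left ?_ hC0.le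
          nlinarith
      _ = 24 * C0 * φ n := by simp only [hφ]; ring
  calc _ ≤ ∑ n ∈ S.image (fun γ => ⌊γ⌋), 24 * C0 * φ n := Finset.sum_le_sum fun n _ => hb n
    _ = 24 * C0 * ∑ n ∈ S.image (fun γ => ⌊γ⌋), φ n := by rw [Finset.mul_sum]
    _ ≤ 24 * C0 * ∑' n, φ n := by
        refine mul_le_mul_of_nonneg_left ?_ (by positivity)
        exact summable_ell.sum_le_tsum _ (fun n _ => φ0 n)
    _ ≤ _ := by linarith

lemma count_upper : ∃ C > 0, ∀ T ≥ 1, ∑ γ ∈ zs (-T) T, (mz γ : ℝ) ≤ C * T^2 := by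
  obtain ⟨C, hC, h⟩ := sum_inv_sq
  refine ⟨2 * C, by positivity, fun T hT => ?_⟩
  calc ∑ γ ∈ zs (-T) T, (mz γ : ℝ) ≤ ∑ γ ∈ zs (-T) T, (2 * T^2) * ((mz γ : ℝ) / (1/4 + γ^2)) := by
        refine Finset.sum_le_sum fun γ hγ => ?_
        have h1 := (mem_zs.1 hγ).1
        have : γ^2 ≤ T^2 := sq_le_sq' h1.1 h1.2
        rw [← mul_div_assoc, le_div_iff₀ (by positivity)]
        have m0 : (0:ℝ) ≤ mz γ := Nat.cast_nonneg _
        have : 1/4 + γ^2 ≤ 2 * T^2 := by nlinarith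
        rw [mul_comm (2 * T^2)]
        exact mul_le_mul_of_nonneg_left this m0
    _ ≤ (2 * T^2) * C := by rw [← Finset.mul_sum]; exact mul_le_mul_of_nonneg_left (h T) (by positivity)
    _ = _ := by ring

lemma sin_part (hRH : RHyp) : ∃ c > 0, ∃ C > 0, ∀ T ≥ 8, c * Real.log T - C ≤
    ∑ γ ∈ zs (-T) T, (mz γ : ℝ) * wT T γ * (γ * Real.sin (γ * (1/T)) / (1/4 + γ^2)) := by
  obtain ⟨C, hC, h⟩ := sum_inv_sq
  obtain ⟨C1, hC1, h1⟩ := count_lower hRH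
  have hpi := Real.pi_pos
  refine ⟨1/(128 * Real.pi), by positivity, 1/(128 * Real.pi) * Real.log 8 + C1 / (8 * Real.pi) + C, ?_, fun T hT => ?_⟩
  · have := Real.log_pos (show (1:ℝ) < 8 by norm_num)
    positivity
  have hT0 : 0 < T := by linarith
  have low : ∀ γ ∈ zs (-T) T, γ^2 * (1/(2*T)) ≤ γ * Real.sin (γ * (1/T)) := by
    have aux : ∀ x, 0 ≤ x → x ≤ T → x^2 * (1/(2*T)) ≤ x * Real.sin (x * (1/T)) := by
      intro x hx hxT
      have h0 : x * (1/T) ≤ 1 := by rw [mul_one_div, div_le_one hT0]; exact hxT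
      have h2 := Real.mul_le_sin (x := x * (1/T)) (by positivity) (h0.trans (by linarith [Real.pi_gt_three]))
      have h3 : 1/2 ≤ 2 / Real.pi := by
        rw [div_le_div_iff₀ (by norm_num) hpi]; linarith [Real.pi_lt_four]
      calc x^2 * (1/(2*T)) = x * (1/2 * (x * (1/T))) := by field_simp
        _ ≤ x * (2 / Real.pi * (x * (1/T))) := by gcongr
        _ ≤ _ := by gcongr
    intro γ hγ
    have h2 := (mem_zs.1 hγ).1
    rcases le_total 0 γ with h0 | h0
    · exact aux γ h0 h2.2
    · have := aux (-γ) (by linarith) (by linarith)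
      rw [neg_mul (γ) (1/T), Real.sin_neg] at this
      nlinarith
  have term : ∀ γ ∈ zs (-T) T, 0 ≤ γ * Real.sin (γ * (1/T)) / (1/4 + γ^2) := fun γ hγ =>
    div_nonneg (le_trans (by positivity) (low γ hγ)) (by positivity)
  have sub : zs (-(T/2)) (T/2) ⊆ zs (-T) T := fun γ hγ => by
    have := mem_zs.1 hγ
    exact mem_zs.2 ⟨⟨by linarith [this.1.1], by linarith [this.1.2]⟩, this.2⟩
  have h2 := h1 (T/2) (by linarith)
  have h3 := h (T/2)
  calc 1/(128 * Real.pi) * Real.log T - (1/(128 * Real.pi) * Real.log 8 + C1 / (8 * Real.pi) + C)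
      ≤ 1/(4*T) * (∑ γ ∈ zs (-(T/2)) (T/2), (mz γ : ℝ)) - 1/(16*T) * ∑ γ ∈ zs (-(T/2)) (T/2), (mz γ : ℝ) / (1/4 + γ^2) := by
        have a1 : 1/(16*T) * ∑ γ ∈ zs (-(T/2)) (T/2), (mz γ : ℝ) / (1/4 + γ^2) ≤ C := by
          calc _ ≤ 1/(16*T) * C := by gcongr
            _ ≤ 1 * C := by
                gcongr; rw [div_le_one (by positivity)]; linarith
            _ = C := one_mul C
        have a2 : 1/(4*T*Real.pi) * (T/2/16 * Real.log (T/2/4) - C1 * (T/2)) ≤ 1/(4*T*Real.pi) * (Real.pi * ∑ γ ∈ zs (-(T/2)) (T/2), (mz γ : ℝ)) := by gcongr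
        have a3 : Real.log (T/2/4) = Real.log T - Real.log 8 := by
          rw [div_div, ← Real.log_div (by positivity) (by norm_num)]; norm_num
        rw [a3] at a2
        have a4 : 1/(4*T*Real.pi) * (T/2/16 * (Real.log T - Real.log 8) - C1 * (T/2)) = 1/(128 * Real.pi) * Real.log T - (1/(128 * Real.pi) * Real.log 8 + C1 / (8 * Real.pi)) := by
          field_simp; ring
        have a5 : 1/(4*T*Real.pi) * (Real.pi * ∑ γ ∈ zs (-(T/2)) (T/2), (mz γ : ℝ)) = 1/(4*T) * (∑ γ ∈ zs (-(T/2)) (T/2), (mz γ : ℝ)) := by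
          field_simp
        rw [a4, a5] at a2
        linarith
    _ = ∑ γ ∈ zs (-(T/2)) (T/2), (mz γ : ℝ) * (1/2) * (γ^2 * (1/(2*T)) / (1/4 + γ^2)) := by
        rw [Finset.mul_sum, Finset.mul_sum, ← Finset.sum_sub_distrib]
        refine Finset.sum_congr rfl fun γ _ => ?_
        have : (1/4 + γ^2) ≠ 0 := by positivity
        field_simp; ring
    _ ≤ ∑ γ ∈ zs (-(T/2)) (T/2), (mz γ : ℝ) * wT T γ * (γ * Real.sin (γ * (1/T)) / (1/4 + γ^2)) := by
        refine Finset.sum_le_sum fun γ hγ => ?_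
        have hw : 1/2 ≤ wT T γ := wT_half hT0 (abs_le.2 (mem_zs.1 hγ).1)
        have hl := low γ (sub hγ)
        have := term γ (sub hγ)
        gcongr
    _ ≤ _ := Finset.sum_le_sum_of_subset_of_nonneg sub fun γ hγ _ =>
        mul_nonneg (mul_nonneg (Nat.cast_nonneg _) (wT_nonneg T γ)) (term γ hγ)

lemma Pr_large (hRH : RHyp) : ∃ c > 0, ∃ C > 0, ∀ T ≥ 8,
    c * Real.log T - C ≤ Pr T (-(1/T)) ∧ Pr T (1/T) ≤ -(c * Real.log T - C) := by
  obtain ⟨c, hc, C, hC, h⟩ := sin_part hRH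
  obtain ⟨C1, hC1, h1⟩ := sum_inv_sq
  refine ⟨c, hc, C + C1, by positivity, fun T hT => ?_⟩
  have hT0 : 0 < T := by linarith
  have hs := h T hT
  have hcos : |∑ γ ∈ zs (-T) T, (mz γ : ℝ) * wT T γ * (1/2 * Real.cos (γ * (1/T)) / (1/4 + γ^2))| ≤ C1 := by
    refine (Finset.abs_sum_le_sum_abs _ _).trans ((Finset.sum_le_sum fun γ _ => ?_).trans (h1 T))
    rw [abs_mul, abs_mul, Nat.abs_cast, abs_of_nonneg (wT_nonneg T γ), abs_div, abs_mul, abs_of_pos (show 0 < 1/4 + γ^2 by positivity), div_eq_mul_inv (mz γ : ℝ), mul_assoc]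
    refine mul_le_mul_of_nonneg_left ?_ (Nat.cast_nonneg _)
    rw [div_eq_mul_inv, ← mul_assoc]
    refine mul_le_of_le_one_left (by positivity) ?_
    have := Real.abs_cos_le_one (γ * (1/T))
    have := wT_le_one hT0 γ
    have := wT_nonneg T γ
    have h5 : |(1/2:ℝ)| = 1/2 := abs_of_pos (by norm_num)
    rw [h5]
    nlinarith [abs_nonneg (Real.cos (γ * (1/T)))]
  obtain ⟨g1, g2⟩ := abs_le.1 hcos
  have e1 : Pr T (1/T) = -(∑ γ ∈ zs (-T) T, (mz γ : ℝ) * wT T γ * (1/2 * Real.cos (γ * (1/T)) / (1/4 + γ^2))) - ∑ γ ∈ zs (-T) T, (mz γ : ℝ) * wT T γ * (γ * Real.sin (γ * (1/T)) / (1/4 + γ^2)) := by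
    unfold Pr
    rw [← neg_add', ← Finset.sum_add_distrib]
    congr 1; refine Finset.sum_congr rfl fun γ _ => ?_
    ring
  have e2 : Pr T (-(1/T)) = -(∑ γ ∈ zs (-T) T, (mz γ : ℝ) * wT T γ * (1/2 * Real.cos (γ * (1/T)) / (1/4 + γ^2))) + ∑ γ ∈ zs (-T) T, (mz γ : ℝ) * wT T γ * (γ * Real.sin (γ * (1/T)) / (1/4 + γ^2)) := by
    unfold Pr
    rw [← sub_eq_neg_add, ← neg_sub, ← Finset.sum_sub_distrib]
    congr 1; refine Finset.sum_congr rfl fun γ _ => ?_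
    rw [mul_neg, Real.cos_neg, Real.sin_neg]
    ring
  constructor
  · rw [e2]; linarith
  · rw [e1]; linarith

lemma Pr_near {T a y η : ℝ} (hT : 0 < T) (h : ∀ γ ∈ zs (-T) T, ∃ k : ℤ, |γ * y - k * (2 * Real.pi)| ≤ η) :
    |Pr T (y + a) - Pr T a| ≤ 3 * η * ∑ γ ∈ zs (-T) T, (mz γ : ℝ) := by
  unfold Pr
  rw [← neg_sub', abs_neg, ← Finset.sum_sub_distrib, Finset.mul_sum]
  refine (Finset.abs_sum_le_sum_abs _ _).trans (Finset.sum_le_sum fun γ hγ => ?_)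
  obtain ⟨k, hk⟩ := h γ hγ
  rw [← mul_sub, abs_mul, abs_mul, Nat.abs_cast, abs_of_nonneg (wT_nonneg T γ), ← sub_div, abs_div, abs_of_pos (show 0 < 1/4 + γ^2 by positivity)]
  have hc : Real.cos (γ * (y + a)) = Real.cos (γ * (y + a) - k * (2 * Real.pi)) := (Real.cos_sub_int_mul_two_pi _ _).symm
  have hs : Real.sin (γ * (y + a)) = Real.sin (γ * (y + a) - k * (2 * Real.pi)) := (Real.sin_sub_int_mul_two_pi _ _).symm
  have dx : |(γ * (y + a) - k * (2 * Real.pi)) - γ * a| ≤ η := by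
    rw [show (γ * (y + a) - k * (2 * Real.pi)) - γ * a = γ * y - k * (2 * Real.pi) by ring]; exact hk
  have c1 : |Real.cos (γ * (y + a)) - Real.cos (γ * a)| ≤ η := by
    rw [hc]; exact (Real.abs_cos_sub_cos_le _ _).trans dx
  have s1 : |Real.sin (γ * (y + a)) - Real.sin (γ * a)| ≤ η := by
    rw [hs]; exact (Real.abs_sin_sub_sin_le _ _).trans dx
  have η0 : 0 ≤ η := (abs_nonneg _).trans dx
  have num : |1/2 * Real.cos (γ * (y + a)) + γ * Real.sin (γ * (y + a)) - (1/2 * Real.cos (γ * a) + γ * Real.sin (γ * a))| ≤ (1/2 + |γ|) * η := by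
    have e : 1/2 * Real.cos (γ * (y + a)) + γ * Real.sin (γ * (y + a)) - (1/2 * Real.cos (γ * a) + γ * Real.sin (γ * a)) = 1/2 * (Real.cos (γ * (y + a)) - Real.cos (γ * a)) + γ * (Real.sin (γ * (y + a)) - Real.sin (γ * a)) := by ring
    rw [e]
    refine (abs_add_le _ _).trans ?_
    rw [abs_mul, abs_mul, show |(1/2:ℝ)| = 1/2 from abs_of_pos (by norm_num)]
    nlinarith [abs_nonneg γ]
  have fr : |1/2 * Real.cos (γ * (y + a)) + γ * Real.sin (γ * (y + a)) - (1/2 * Real.cos (γ * a) + γ * Real.sin (γ * a))| / (1/4 + γ^2) ≤ 3 * η := by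
    rw [div_le_iff₀ (by positivity)]
    refine num.trans ?_
    have : 1/2 + |γ| ≤ 3 * (1/4 + γ^2) := by
      rw [← sq_abs γ]; nlinarith [sq_nonneg (|γ| - 1/6)]
    nlinarith
  have w1 := wT_le_one hT γ
  have w0 := wT_nonneg T γ
  have m0 : (0:ℝ) ≤ mz γ := Nat.cast_nonneg _
  calc _ ≤ (mz γ : ℝ) * 1 * (3 * η) := by gcongr
    _ = _ := by ring

lemma one_le_mz {a b γ : ℝ} (h : γ ∈ zs a b) : 1 ≤ mz γ := by
  by_contra hlt
  have h0 : mz γ = 0 := by omega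
  obtain ⟨g, hg, hf, hn⟩ := factor_zs γ γ
  have hz := (mem_zs.1 h).2
  have hmem : γ ∈ zs γ γ := mem_zs.2 ⟨⟨le_rfl, le_rfl⟩, hz⟩
  have h1 := hf (rp γ)
  have : ∏ δ ∈ zs γ γ, (rp γ - rp δ) ^ mz δ = 1 := by
    refine Finset.prod_eq_one fun δ hδ => ?_
    have := (mem_zs.1 hδ).1
    have e : δ = γ := le_antisymm this.2 this.1
    rw [e, h0, pow_zero]
  rw [this, one_mul, hz] at h1
  exact hn γ hmem h1.symm

lemma card_le (T : ℝ) : ((zs (-T) T).card : ℝ) ≤ ∑ γ ∈ zs (-T) T, (mz γ : ℝ) := by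
  rw [Finset.card_eq_sum_ones]; push_cast
  exact Finset.sum_le_sum fun γ hγ => by exact_mod_cast one_le_mz hγ

def Gs (S : Finset ℝ) (η : ℝ) : Set ℝ := {y | ∀ γ ∈ S, ∃ k : ℤ, |γ * y - k * (2 * Real.pi)| ≤ η}

lemma Gs_meas (S : Finset ℝ) (η : ℝ) : MeasurableSet (Gs S η) := by
  have : Gs S η = ⋂ γ ∈ S, ⋃ k : ℤ, {y | |γ * y - k * (2 * Real.pi)| ≤ η} := by
    ext y; simp [Gs]
  rw [this]
  refine S.measurableSet_biInter fun γ _ => MeasurableSet.iUnion fun k => ?_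
  exact measurableSet_le (by fun_prop) measurable_const

lemma Gs_neg {S : Finset ℝ} {η y : ℝ} (h : y ∈ Gs S η) : -y ∈ Gs S η := by
  intro γ hγ
  obtain ⟨k, hk⟩ := h γ hγ
  refine ⟨-k, ?_⟩
  rw [← abs_neg]; convert hk using 2; push_cast; ring

lemma dirichlet (S : Finset ℝ) {M : ℕ} (hM : 0 < M) {Y : ℝ} (hY : 0 < Y) :
    Y / (2 * M ^ S.card) ≤ volume.real (Gs S (2 * Real.pi / M) ∩ Set.Icc 0 Y) := by
  set η := 2 * Real.pi / M with hη
  have hpi := Real.pi_pos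
  have hM' : (0:ℝ) < M := by exact_mod_cast hM
  set cl : ℝ → S → Fin M := fun y γ => ⟨⌊Int.fract (γ * y / (2 * Real.pi)) * M⌋₊, by
    rw [Nat.floor_lt (by have := Int.fract_nonneg (γ * y / (2 * Real.pi)); positivity)]
    have := Int.fract_lt_one (γ * y / (2 * Real.pi))
    nlinarith⟩ with hcl
  set A : (S → Fin M) → Set ℝ := fun c => {y | cl y = c} ∩ Set.Icc 0 Y with hA
  have hfin : ∀ s : Set ℝ, ∀ a b : ℝ, volume (s ∩ Set.Icc a b) ≠ ⊤ := fun s a b =>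
    ne_top_of_le_ne_top (by simp) (measure_mono (Set.inter_subset_right (s := s) (t := Set.Icc a b)))
  have hU : Set.Icc 0 Y ⊆ ⋃ c, A c := fun y hy => Set.mem_iUnion.2 ⟨cl y, rfl, hy⟩
  have hsum : Y ≤ ∑ c, volume.real (A c) := by
    have h1 : volume.real (Set.Icc 0 Y) ≤ volume.real (⋃ c, A c) :=
      measureReal_mono hU (ne_top_of_le_ne_top (by simp : volume (Set.Icc (0:ℝ) Y) ≠ ⊤) (measure_mono (Set.iUnion_subset fun c => Set.inter_subset_right)))
    have h2 := measureReal_iUnion_fintype_le (μ := volume) A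
    have h3 : volume.real (Set.Icc 0 Y) = Y := by simp [hY.le]
    linarith
  have hcard : Fintype.card (S → Fin M) = M ^ S.card := by simp
  obtain ⟨c, hc⟩ : ∃ c, Y / M ^ S.card ≤ volume.real (A c) := by
    by_contra hcon
    push Not at hcon
    have hne : (Finset.univ : Finset (S → Fin M)).Nonempty := ⟨cl 0, Finset.mem_univ _⟩
    have := Finset.sum_lt_sum_of_nonempty hne (fun c _ => hcon c)
    rw [Finset.sum_const, Finset.card_univ, hcard, nsmul_eq_mul] at this
    push_cast at this
    rw [mul_div_cancel₀ _ (by positivity)] at this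
    linarith
  have hpos : 0 < volume.real (A c) := lt_of_lt_of_le (by positivity) hc
  obtain ⟨s, hs⟩ : (A c).Nonempty := by
    rw [Set.nonempty_iff_ne_empty]; rintro h; rw [h] at hpos; simp at hpos
  -- the shift
  have hsub : A c ⊆ (fun y => y + (-s)) ⁻¹' (Gs S η ∩ Set.Icc (-Y) Y) := by
    intro y hy
    refine ⟨fun γ hγ => ?_, ⟨?_, ?_⟩⟩
    · have h1 : cl y ⟨γ, hγ⟩ = cl s ⟨γ, hγ⟩ := by rw [hy.1, hs.1]
      have h2 := congrArg Fin.val h1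
      simp only [hcl] at h2
      set u := γ * y / (2 * Real.pi) with hu
      set v := γ * s / (2 * Real.pi) with hv
      have n1 := Int.fract_nonneg u
      have n2 := Int.fract_nonneg v
      have f1 := Nat.floor_le (show 0 ≤ Int.fract u * M by positivity)
      have f2 := Nat.lt_floor_add_one (Int.fract u * M)
      have f3 := Nat.floor_le (show 0 ≤ Int.fract v * M by positivity)
      have f4 := Nat.lt_floor_add_one (Int.fract v * M)
      rw [h2] at f1 f2
      refine ⟨⌊u⌋ - ⌊v⌋, ?_⟩
      have e : γ * (y + -s) - ((⌊u⌋ - ⌊v⌋ : ℤ):ℝ) * (2 * Real.pi) = 2 * Real.pi / M * (Int.fract u * M - Int.fract v * M) := by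
        rw [← Int.self_sub_floor, ← Int.self_sub_floor, hu, hv]; push_cast; field_simp; ring
      rw [e, abs_mul, abs_of_pos (by positivity)]
      have : |Int.fract u * M - Int.fract v * M| ≤ 1 := abs_le.2 ⟨by linarith, by linarith⟩
      calc _ ≤ 2 * Real.pi / M * 1 := by gcongr
        _ = η := by rw [hη, mul_one]
    · show -Y ≤ y + -s
      linarith [hy.2.1, hs.2.2]
    · show y + -s ≤ Y
      linarith [hy.2.2, hs.2.1]
  have h1 : volume.real (A c) ≤ volume.real (Gs S η ∩ Set.Icc (-Y) Y) := by
    have e : volume ((fun y => y + (-s)) ⁻¹' (Gs S η ∩ Set.Icc (-Y) Y)) = volume (Gs S η ∩ Set.Icc (-Y) Y) := measure_preimage_add_right _ _ _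
    refine ENNReal.toReal_mono (hfin _ _ _) ?_
    rw [← e]; exact measure_mono hsub
  have h2 : Gs S η ∩ Set.Icc (-Y) Y ⊆ (Gs S η ∩ Set.Icc 0 Y) ∪ Neg.neg ⁻¹' (Gs S η ∩ Set.Icc 0 Y) := by
    intro y hy
    rcases le_total 0 y with h0 | h0
    · exact Or.inl ⟨hy.1, h0, hy.2.2⟩
    · exact Or.inr ⟨Gs_neg hy.1, by linarith, by linarith [hy.2.1]⟩
  have h3 : volume.real (Gs S η ∩ Set.Icc (-Y) Y) ≤ volume.real (Gs S η ∩ Set.Icc 0 Y) + volume.real (Gs S η ∩ Set.Icc 0 Y) := by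
    have e : volume (Neg.neg ⁻¹' (Gs S η ∩ Set.Icc 0 Y)) = volume (Gs S η ∩ Set.Icc 0 Y) := Measure.measure_preimage_neg _ _
    have : volume (Gs S η ∩ Set.Icc (-Y) Y) ≤ volume (Gs S η ∩ Set.Icc 0 Y) + volume (Gs S η ∩ Set.Icc 0 Y) := by
      refine (measure_mono h2).trans ((measure_union_le _ _).trans ?_)
      rw [e]
    unfold Measure.real
    rw [← ENNReal.toReal_add (hfin _ _ _) (hfin _ _ _)]
    exact ENNReal.toReal_mono (ENNReal.add_ne_top.2 ⟨hfin _ _ _, hfin _ _ _⟩) this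
  have : Y / (2 * M ^ S.card) = (Y / M ^ S.card) / 2 := by rw [div_div, mul_comm (2:ℝ)]
  rw [this]; linarith

lemma large (hRH : RHyp) : ∃ c > 0, ∃ C > 0, ∀ T ≥ 8, ∃ G : Set ℝ, MeasurableSet G ∧
    (∀ Y > 0, Real.exp (-(C * T^3)) * Y ≤ volume.real (G ∩ Set.Icc 0 Y)) ∧
    ∀ y ∈ G, c * Real.log T - C ≤ Pr T (y + -(1/T)) ∧ Pr T (y + 1/T) ≤ -(c * Real.log T - C) := by
  obtain ⟨c, hc, C, hC, h⟩ := Pr_large hRH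
  obtain ⟨C1, hC1, h1⟩ := count_upper
  refine ⟨c, hc, C + 10 * C1 + 1, by positivity, fun T hT => ?_⟩
  have hT0 : 0 < T := by linarith
  have hpi := Real.pi_pos
  have hpi4 := Real.pi_lt_four
  set S := zs (-T) T with hS
  set M := ⌈2 * Real.pi * T^2⌉₊ with hM
  have M1 : 2 * Real.pi * T^2 ≤ M := Nat.le_ceil _
  have M0' : (0:ℝ) < M := lt_of_lt_of_le (by positivity) M1
  have M0 : 0 < M := by exact_mod_cast M0'
  have M2 : (M:ℝ) ≤ 10 * T^2 := by
    have := (Nat.ceil_lt_add_one (show 0 ≤ 2 * Real.pi * T^2 by positivity)).le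
    refine this.trans ?_
    nlinarith
  have hη : 2 * Real.pi / M ≤ 1 / T^2 := by
    rw [div_le_div_iff₀ M0' (by positivity)]; linarith
  refine ⟨Gs S (2 * Real.pi / M), Gs_meas _ _, fun Y hY => ?_, fun y hy => ?_⟩
  · refine le_trans ?_ (dirichlet S M0 hY)
    have hN : (S.card : ℝ) ≤ C1 * T^2 := (card_le T).trans (h1 T (by linarith))
    have lM : Real.log M ≤ 8 * T := by
      have a1 : Real.log M ≤ Real.log (10 * T^2) := Real.log_le_log M0' M2
      have a2 : Real.log (10 * T^2) = Real.log 10 + 2 * Real.log T := by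
        rw [Real.log_mul (by norm_num) (by positivity), Real.log_pow]; push_cast; ring
      have a3 := Real.log_le_sub_one_of_pos hT0
      have a4 := Real.log_le_sub_one_of_pos (show (0:ℝ) < 10 by norm_num)
      linarith
    have l0 : 0 ≤ Real.log M := Real.log_natCast_nonneg M
    have hMN : (M:ℝ) ^ S.card ≤ Real.exp (8 * C1 * T^3) := by
      rw [← Real.exp_log M0', ← Real.exp_nat_mul]
      refine Real.exp_le_exp.2 ?_
      calc (S.card : ℝ) * Real.log M ≤ (C1 * T^2) * (8 * T) := by gcongr
        _ = _ := by ring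
    have h2 : 2 * (M:ℝ) ^ S.card ≤ Real.exp ((C + 10 * C1 + 1) * T^3) := by
      have a1 : (2:ℝ) ≤ Real.exp 1 := by have := Real.add_one_le_exp (1:ℝ); linarith
      calc 2 * (M:ℝ) ^ S.card ≤ Real.exp 1 * Real.exp (8 * C1 * T^3) := by gcongr
        _ = Real.exp (1 + 8 * C1 * T^3) := (Real.exp_add _ _).symm
        _ ≤ _ := by
          refine Real.exp_le_exp.2 ?_
          have : 1 ≤ T^3 := one_le_pow₀ (by linarith)
          have : 0 ≤ (C + 2 * C1) * T^3 := by positivity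
          nlinarith
    rw [Real.exp_neg, inv_mul_eq_div]
    gcongr
  · have n1 : ∀ a, |Pr T (y + a) - Pr T a| ≤ 3 * C1 := by
      intro a
      refine (Pr_near hT0 hy).trans ?_
      calc 3 * (2 * Real.pi / M) * ∑ γ ∈ zs (-T) T, (mz γ : ℝ) ≤ 3 * (1 / T^2) * (C1 * T^2) := by
            gcongr
            exact h1 T (by linarith)
        _ = 3 * C1 := by field_simp
    have g1 := abs_le.1 (n1 (-(1/T)))
    have g2 := abs_le.1 (n1 (1/T))
    have := h T hT
    constructor <;> linarith

end RS

namespace RS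

lemma density (hRH : RHyp) : ∃ c > 0, ∀ (h : ℝ → ℝ) (T y0 δ B Y1 : ℝ) (G : Set ℝ), Measurable h →
    (∀ v, h v ^ 2 = fF v ^ 2) → 1 ≤ T → |y0| ≤ 1 → 0 < δ → 1 ≤ B → 0 ≤ Y1 → MeasurableSet G →
    (∀ Y > 0, δ * Y ≤ volume.real (G ∩ Set.Icc 0 Y)) →
    (∀ y, Integrable fun v => h v * kT T (y - v)) →
    (∀ y ∈ G, Y1 ≤ y → 2 * Real.pi * B ≤ ∫ v, h v * kT T (y + y0 - v)) →
    ∀ᶠ Y in atTop, c * δ^2 * Y ≤ volume.real ({v | B/2 < h v} ∩ Set.Icc 0 Y) := by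
  obtain ⟨C, hC, hL2⟩ := fF_L2 hRH
  obtain ⟨C', hC', htail⟩ := fF_tail hRH
  refine ⟨1/(256 * C), by positivity, ?_⟩
  intro h T y0 δ B Y1 G hm hsq hT hy0 hδ hB hY1 hG hdens hIntg hbig
  have hpi := Real.pi_pos
  have hT0 : 0 < T := by linarith
  set D : Set ℝ := {v | B/2 < h v} with hD
  have hDm : MeasurableSet D := measurableSet_lt measurable_const hm
  have D0 : ∀ v ∈ D, 0 < v := by
    intro v hv
    by_contra hv0
    have h1 := hsq v
    rw [fF_nonpos (not_lt.1 hv0)] at h1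
    have : h v = 0 := by nlinarith [sq_nonneg (h v)]
    have : B/2 < h v := hv
    linarith
  set P : ℝ → ℝ := D.indicator h with hP
  have hPm : Measurable P := hm.indicator hDm
  have P0 : ∀ v, 0 ≤ P v := fun v => Set.indicator_nonneg (fun v hv => by
    have : B/2 < h v := hv
    linarith) v
  have hPle : ∀ v, h v ≤ P v + B/2 := by
    intro v
    by_cases hv : v ∈ D
    · rw [hP, Set.indicator_of_mem hv]; linarith
    · rw [hP, Set.indicator_of_notMem hv]
      have : h v ≤ B/2 := not_lt.1 hv
      linarith
  set lam := δ / (32 * C) with hlam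
  have hlam0 : 0 < lam := by positivity
  have kint : ∀ y, Integrable fun v => kT T (y - v) := fun y => (kT_integrable hT).comp_sub_left y
  have kval : ∀ y, ∫ v, kT T (y - v) = 2 * Real.pi := fun y => by
    rw [integral_sub_left_eq_self (fun u => kT T u) volume y, kT_integral hT]
  have Pint : ∀ y, Integrable fun v => P v * kT T (y - v) := by
    intro y
    have := (hIntg y).indicator hDm
    refine this.congr (ae_of_all _ fun v => ?_)
    simp only [hP]
    by_cases hv : v ∈ D
    · simp [hv]
    · simp [hv]
  have big2 : ∀ y ∈ G, Y1 ≤ y → Real.pi * B ≤ ∫ v, P v * kT T (y + y0 - v) := by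
    intro y hy hyY
    have h1 := hbig y hy hyY
    have h2 : ∫ v, h v * kT T (y + y0 - v) ≤ ∫ v, (P v * kT T (y + y0 - v) + B/2 * kT T (y + y0 - v)) := by
      refine integral_mono (hIntg _) ((Pint _).add ((kint _).const_mul _)) fun v => ?_
      have := kT_nonneg hT0 (y + y0 - v)
      have := hPle v
      dsimp only
      nlinarith
    rw [integral_add (Pint _) ((kint _).const_mul _), integral_const_mul, kval] at h2
    linarith
  -- main inequality
  have main : ∀ Y : ℝ, 1 ≤ Y → Y1 ≤ Y → Real.pi * (δ * Y - Y1) ≤ Real.pi * δ * Y / 8 + Real.pi / lam * volume.real (D ∩ Set.Icc 0 (4*Y)) + 2 * C' := by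
    intro Y hY hYY1
    set F := G ∩ Set.Icc Y1 Y with hF
    have hFm : MeasurableSet F := hG.inter measurableSet_Icc
    have fin1 : ∀ (s : Set ℝ) (a b : ℝ), volume (s ∩ Set.Icc a b) ≠ ⊤ := fun s a b =>
      ne_top_of_le_ne_top (by simp) (measure_mono (Set.inter_subset_right (s := s) (t := Set.Icc a b)))
    have hFl : δ * Y - Y1 ≤ volume.real F := by
      have h1 := hdens Y (by linarith)
      have h2 : G ∩ Set.Icc 0 Y ⊆ F ∪ Set.Icc 0 Y1 := by
        intro y hy
        rcases le_total Y1 y with hh | hh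
        · exact Or.inl ⟨hy.1, hh, hy.2.2⟩
        · exact Or.inr ⟨hy.2.1, hh⟩
      have h3 : volume.real (G ∩ Set.Icc 0 Y) ≤ volume.real (F ∪ Set.Icc 0 Y1) :=
        measureReal_mono h2 (measure_union_ne_top (fin1 _ _ _) (by simp))
      have h4 := measureReal_union_le (μ := volume) F (Set.Icc 0 Y1)
      have h5 : volume.real (Set.Icc 0 Y1) = Y1 := by simp [hY1]
      linarith
    -- integrated
    have i1 : ENNReal.ofReal (Real.pi * B) * volume F ≤ ∫⁻ y in F, ∫⁻ v, ENNReal.ofReal (P v) * ENNReal.ofReal (kT T (y + y0 - v)) := by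
      rw [← setLIntegral_const]
      refine setLIntegral_mono' hFm fun y hy => ?_
      have := ofReal_integral_eq_lintegral_ofReal (Pint (y + y0)) (ae_of_all _ fun v => mul_nonneg (P0 v) (kT_nonneg hT0 _))
      simp_rw [← ENNReal.ofReal_mul (P0 _)]
      rw [← this]
      exact ENNReal.ofReal_le_ofReal (big2 y hy.1 hy.2.1)
    have hkm : Measurable (kT T) := (kT_cont T).measurable
    have sw : ∫⁻ y in F, ∫⁻ v, ENNReal.ofReal (P v) * ENNReal.ofReal (kT T (y + y0 - v)) = ∫⁻ v, ENNReal.ofReal (P v) * ∫⁻ y in F, ENNReal.ofReal (kT T (y + y0 - v)) := by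
      rw [lintegral_lintegral_swap]
      · congr 1; ext v
        rw [lintegral_const_mul]
        exact (hkm.comp (by fun_prop)).ennreal_ofReal
      · apply Measurable.aemeasurable
        have b1 : Measurable fun p : ℝ × ℝ => ENNReal.ofReal (P p.2) := (hPm.comp measurable_snd).ennreal_ofReal
        have b2 : Measurable fun p : ℝ × ℝ => ENNReal.ofReal (kT T (p.1 + y0 - p.2)) :=
          (hkm.comp (by fun_prop : Measurable fun p : ℝ × ℝ => p.1 + y0 - p.2)).ennreal_ofReal
        exact b1.mul b2
    have q1 : ∀ v, ∫⁻ y in F, ENNReal.ofReal (kT T (y + y0 - v)) ≤ ENNReal.ofReal (2 * Real.pi) := by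
      intro v
      refine (setLIntegral_le_lintegral _ _).trans ?_
      have e : ∀ y, kT T (y + y0 - v) = kT T (y - (v - y0)) := fun y => by congr 1; ring
      simp_rw [e]
      rw [← ofReal_integral_eq_lintegral_ofReal ((kT_integrable hT).comp_sub_right _) (ae_of_all _ fun y => kT_nonneg hT0 _),
        integral_sub_right_eq_self (fun u => kT T u), kT_integral hT]
    have q2 : ∀ v, 4 * Y < v → ∫⁻ y in F, ENNReal.ofReal (kT T (y + y0 - v)) ≤ ENNReal.ofReal (16 * Y / v^2) := by
      intro v hv
      have v0 : 0 < v := by linarith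
      calc ∫⁻ y in F, ENNReal.ofReal (kT T (y + y0 - v)) ≤ ∫⁻ y in F, ENNReal.ofReal (16 / v^2) := by
            refine setLIntegral_mono' hFm fun y hy => ENNReal.ofReal_le_ofReal ?_
            have h1 := kT_le2 (u := y + y0 - v) hT
            have h2 := kT_nonneg hT0 (y + y0 - v)
            have h3 := hy.2.2
            have h4 := (abs_le.1 hy0).2
            have h5 : v / 2 ≤ v - y - y0 := by linarith
            have h6 : (v/2)^2 ≤ (y + y0 - v)^2 := by nlinarith
            rw [le_div_iff₀ (by positivity)]
            nlinarith
        _ = ENNReal.ofReal (16 / v^2) * volume F := by rw [setLIntegral_const]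
        _ ≤ ENNReal.ofReal (16 / v^2) * ENNReal.ofReal Y := by
            gcongr
            calc volume F ≤ volume (Set.Icc Y1 Y) := measure_mono Set.inter_subset_right
              _ = ENNReal.ofReal (Y - Y1) := by simp
              _ ≤ _ := ENNReal.ofReal_le_ofReal (by linarith)
        _ = _ := by rw [← ENNReal.ofReal_mul (by positivity)]; congr 1; ring
    set f1 : ℝ → ℝ := fun v => 2 * Real.pi * (lam / 2 * fF v ^ 2 + D.indicator (fun _ => 1 / (2 * lam)) v) with hf1
    set f2 : ℝ → ℝ := fun v => 8 * Y * ((fF v ^ 2 + 1) / v^2) with hf2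
    have f10 : ∀ v, 0 ≤ f1 v := fun v => by
      have : 0 ≤ D.indicator (fun _ => 1 / (2 * lam)) v := Set.indicator_nonneg (fun _ _ => by positivity) v
      simp only [hf1]; positivity
    have f20 : ∀ v, 0 ≤ f2 v := fun v => by simp only [hf2]; positivity
    have pw : ∀ v, ENNReal.ofReal (P v) * ∫⁻ y in F, ENNReal.ofReal (kT T (y + y0 - v)) ≤
        (Set.Icc 0 (4*Y)).indicator (fun v => ENNReal.ofReal (f1 v)) v + (Set.Ioi (4*Y)).indicator (fun v => ENNReal.ofReal (f2 v)) v := by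
      intro v
      by_cases hv : v ∈ D
      · have v0 := D0 v hv
        have hPv : P v = h v := by rw [hP, Set.indicator_of_mem hv]
        rcases le_or_gt v (4*Y) with h4 | h4
        · refine le_trans ?_ le_self_add
          rw [Set.indicator_of_mem (s := Set.Icc 0 (4*Y)) (Set.mem_Icc.2 ⟨v0.le, h4⟩)]
          calc _ ≤ ENNReal.ofReal (P v) * ENNReal.ofReal (2 * Real.pi) := by gcongr; exact q1 v
            _ = ENNReal.ofReal (P v * (2 * Real.pi)) := by rw [ENNReal.ofReal_mul (P0 v)]
            _ ≤ _ := by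
              refine ENNReal.ofReal_le_ofReal ?_
              simp only [hf1]
              rw [Set.indicator_of_mem hv, mul_comm]
              refine mul_le_mul_of_nonneg_left ?_ (by positivity)
              rw [hPv, ← hsq v]
              have : lam / 2 * h v ^ 2 + 1 / (2 * lam) - h v = (lam * h v - 1)^2 / (2 * lam) := by field_simp; ring
              have : 0 ≤ (lam * h v - 1)^2 / (2 * lam) := by positivity
              linarith
        · refine le_trans ?_ le_add_self
          rw [Set.indicator_of_mem (show v ∈ Set.Ioi (4*Y) from h4)]
          calc _ ≤ ENNReal.ofReal (P v) * ENNReal.ofReal (16 * Y / v^2) := by gcongr; exact q2 v h4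
            _ = ENNReal.ofReal (P v * (16 * Y / v^2)) := by rw [ENNReal.ofReal_mul (P0 v)]
            _ ≤ _ := by
              refine ENNReal.ofReal_le_ofReal ?_
              simp only [hf2]
              rw [hPv, ← hsq v]
              have : h v ≤ (h v ^ 2 + 1) / 2 := by nlinarith [sq_nonneg (h v - 1)]
              calc h v * (16 * Y / v^2) ≤ (h v ^ 2 + 1) / 2 * (16 * Y / v^2) := by gcongr
                _ = _ := by ring
      · have : P v = 0 := by rw [hP, Set.indicator_of_notMem hv]
        rw [this]; simp
    have hf1m : Measurable f1 := by
      have := fF_meas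
      have h2 : Measurable (D.indicator (fun _ : ℝ => 1 / (2 * lam))) := measurable_const.indicator hDm
      simp only [hf1]
      exact ((this.pow_const 2).const_mul _ |>.add h2).const_mul _
    have if1 : IntegrableOn f1 (Set.Icc 0 (4*Y)) := by
      have a1 : IntegrableOn (fun v => lam / 2 * fF v ^ 2) (Set.Icc 0 (4*Y)) := (fF_sq_locint 0 (4*Y)).const_mul _
      have a2 : IntegrableOn (D.indicator (fun _ : ℝ => 1 / (2 * lam))) (Set.Icc 0 (4*Y)) := by
        refine Integrable.indicator ?_ hDm
        exact integrableOn_const measure_Icc_lt_top.ne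
      exact (a1.add a2).const_mul _
    have vf1 : ∫ v in Set.Icc 0 (4*Y), f1 v ≤ Real.pi * δ * Y / 8 + Real.pi / lam * volume.real (D ∩ Set.Icc 0 (4*Y)) := by
      have a1 : IntegrableOn (fun v => lam / 2 * fF v ^ 2) (Set.Icc 0 (4*Y)) := (fF_sq_locint 0 (4*Y)).const_mul _
      have a2 : IntegrableOn (D.indicator (fun _ : ℝ => 1 / (2 * lam))) (Set.Icc 0 (4*Y)) := by
        refine Integrable.indicator ?_ hDm
        exact integrableOn_const measure_Icc_lt_top.ne
      simp only [hf1]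
      rw [integral_const_mul, integral_add a1 a2, integral_const_mul, integral_indicator hDm, setIntegral_const, smul_eq_mul]
      have e1 : (volume.restrict (Set.Icc 0 (4*Y))).real D = volume.real (D ∩ Set.Icc 0 (4*Y)) := by
        unfold Measure.real
        rw [Measure.restrict_apply hDm]
      have a3 := hL2 (4*Y) (by linarith)
      have a4 : lam / 2 * ∫ v in Set.Icc 0 (4*Y), fF v ^ 2 ≤ lam / 2 * (C * (4 * Y)) := by gcongr
      have e2 : lam / 2 * (C * (4 * Y)) = δ * Y / 16 := by rw [hlam]; field_simp; norm_num
      have e3 : ((volume.restrict (Set.Icc 0 (4*Y))).restrict D).real Set.univ = volume.real (D ∩ Set.Icc 0 (4*Y)) := by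
        rw [← e1]; unfold Measure.real; rw [Measure.restrict_apply_univ]
      first
        | rw [e1]
        | rw [e3]
      have e4 : Real.pi / lam * volume.real (D ∩ Set.Icc 0 (4*Y)) = 2 * Real.pi * (volume.real (D ∩ Set.Icc 0 (4*Y)) * (1 / (2 * lam))) := by field_simp
      rw [e4]
      rw [e2] at a4
      nlinarith
    obtain ⟨it, vt⟩ := htail (4*Y) (by linarith)
    have if2 : IntegrableOn f2 (Set.Ioi (4*Y)) := it.const_mul _
    have vf2 : ∫ v in Set.Ioi (4*Y), f2 v ≤ 2 * C' := by
      simp only [hf2]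
      rw [integral_const_mul]
      calc 8 * Y * _ ≤ 8 * Y * (C' / (4 * Y)) := by gcongr
        _ = 2 * C' := by field_simp; norm_num
    have tot : ENNReal.ofReal (Real.pi * B) * volume F ≤ ENNReal.ofReal (Real.pi * δ * Y / 8 + Real.pi / lam * volume.real (D ∩ Set.Icc 0 (4*Y)) + 2 * C') := by
      rw [sw] at i1
      refine i1.trans ((lintegral_mono pw).trans ?_)
      rw [lintegral_add_left (hf1m.ennreal_ofReal.indicator measurableSet_Icc), lintegral_indicator measurableSet_Icc, lintegral_indicator measurableSet_Ioi,
        ← ofReal_integral_eq_lintegral_ofReal if1 (ae_of_all _ f10), ← ofReal_integral_eq_lintegral_ofReal if2 (ae_of_all _ f20), ← ENNReal.ofReal_add (integral_nonneg f10) (integral_nonneg f20)]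
      exact ENNReal.ofReal_le_ofReal (by linarith)
    have : ENNReal.ofReal (Real.pi * B) * volume F = ENNReal.ofReal (Real.pi * B * volume.real F) := by
      rw [ENNReal.ofReal_mul (p := Real.pi * B) (by positivity), Measure.real, ENNReal.ofReal_toReal (fin1 G Y1 Y)]
    rw [this, ENNReal.ofReal_le_ofReal_iff (by positivity)] at tot
    refine le_trans ?_ tot
    have v0 : 0 ≤ volume.real F := measureReal_nonneg
    calc Real.pi * (δ * Y - Y1) ≤ Real.pi * volume.real F := by gcongr
      _ ≤ Real.pi * B * volume.real F := by
        refine mul_le_mul_of_nonneg_right ?_ v0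
        nlinarith
  filter_upwards [eventually_ge_atTop (4 : ℝ), eventually_ge_atTop (4 * Y1), eventually_ge_atTop (4 * ((Y1 + C') * 4 / δ))] with Y h1 h2 h3
  have h4 := main (Y/4) (by linarith) (by linarith)
  rw [show 4 * (Y/4) = Y by ring] at h4
  set m := volume.real (D ∩ Set.Icc 0 Y) with hm'
  have h5 : (Y1 + C') * 4 ≤ δ * (Y/4) := by
    have : (Y1 + C') * 4 / δ ≤ Y/4 := by linarith
    rw [div_le_iff₀ hδ] at this; linarith
  have h6 : Real.pi * (δ * (Y/4) / 2) ≤ Real.pi * (m / lam) := by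
    have : Real.pi / lam * m = Real.pi * (m / lam) := by ring
    rw [this] at h4
    have : 2 * C' ≤ Real.pi * C' := by nlinarith [Real.pi_gt_three]
    nlinarith
  have h7 := le_of_mul_le_mul_left h6 hpi
  rw [le_div_iff₀ hlam0] at h7
  refine le_trans (le_of_eq ?_) h7
  rw [hlam]; field_simp; norm_num

lemma dens_final (hRH : RHyp) : ∃ c > 0, ∃ K > 0, ∃ A₀, ∀ A ≥ A₀, ∀ᶠ Y in atTop,
    K * Real.exp (-Real.exp (c * A)) * Y ≤ volume.real ({v | A < fF v} ∩ Set.Icc 0 Y) ∧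
    K * Real.exp (-Real.exp (c * A)) * Y ≤ volume.real ({v | fF v < -A} ∩ Set.Icc 0 Y) := by
  obtain ⟨c1, hc1, hden⟩ := density hRH
  obtain ⟨c, hc, C, hC, hl⟩ := large hRH
  refine ⟨12 / c, by positivity, c1, hc1, max 1 (max ((c * Real.log 8)) (c / 6 * (Real.log (2 * C) + 3 * (C + 1) / c))), fun A hA => ?_⟩
  have A1 : 1 ≤ A := (le_max_left _ _).trans hA
  have A2 : c * Real.log 8 ≤ A := (le_max_left _ _).trans ((le_max_right _ _).trans hA)
  have A3 : c / 6 * (Real.log (2 * C) + 3 * (C + 1) / c) ≤ A := (le_max_right _ _).trans ((le_max_right _ _).trans hA)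
  set T := Real.exp ((2 * A + C + 1) / c) with hT
  have hT0 : 0 < T := Real.exp_pos _
  have T8 : 8 ≤ T := by
    rw [hT, ← Real.exp_log (show (0:ℝ) < 8 by norm_num)]
    refine Real.exp_le_exp.2 ?_
    rw [le_div_iff₀ hc]; linarith
  have T1 : 1 ≤ T := by linarith
  have hlog : c * Real.log T = 2 * A + C + 1 := by rw [hT, Real.log_exp]; field_simp
  obtain ⟨G, Gm, Gd, Gl⟩ := hl T T8
  obtain ⟨ai, at0⟩ := asymp hRH T1
  have ev : ∀ᶠ y in atTop, |(∫ v : ℝ, fF v * kT T (y - v)) - 2 * Real.pi * Pr T y| ≤ 1 := by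
    have := at0.eventually (Metric.closedBall_mem_nhds (0:ℝ) one_pos)
    filter_upwards [this] with y hy
    simpa [Real.dist_eq] using hy
  obtain ⟨Y0, hY0⟩ := eventually_atTop.1 ev
  have hpi := Real.pi_gt_three
  have inv1 : 0 ≤ 1/T ∧ 1/T ≤ 1 := ⟨by positivity, by rw [div_le_one hT0]; exact T1⟩
  have hexp : Real.exp (-Real.exp (12 / c * A)) ≤ Real.exp (-(C * T^3)) ^ 2 := by
    rw [← Real.exp_nat_mul]
    refine Real.exp_le_exp.2 ?_
    have e1 : T^3 = Real.exp (3 * ((2 * A + C + 1) / c)) := by rw [hT, ← Real.exp_nat_mul]; norm_num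
    have e2 : 2 * C * T^3 ≤ Real.exp (12 / c * A) := by
      rw [e1, ← Real.exp_log (show 0 < 2 * C by positivity), ← Real.exp_add]
      refine Real.exp_le_exp.2 ?_
      have e3 : Real.log (2 * C) + 3 * (C + 1) / c ≤ 6 / c * A := by
        have := mul_le_mul_of_nonneg_left A3 (show 0 ≤ 6 / c by positivity)
        calc _ = 6 / c * (c / 6 * (Real.log (2 * C) + 3 * (C + 1) / c)) := by field_simp
          _ ≤ _ := this
      have e4 : 3 * ((2 * A + C + 1) / c) = 6 / c * A + 3 * (C + 1) / c := by field_simp; ring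
      have e5 : 12 / c * A = 6 / c * A + 6 / c * A := by ring
      rw [e4, e5]; linarith
    push_cast; linarith
  have fin : ∀ {δ Y m : ℝ}, 0 ≤ Y → c1 * Real.exp (-(C * T^3)) ^ 2 * Y ≤ m → c1 * Real.exp (-Real.exp (12 / c * A)) * Y ≤ m := by
    intro δ Y m hY h
    refine le_trans ?_ h
    gcongr
  have P1 := hden fF T (-(1/T)) (Real.exp (-(C * T^3))) (2 * A) (max 0 (Y0 + 1)) G fF_meas (fun _ => rfl) T1
    (by rw [abs_neg, abs_of_nonneg inv1.1]; exact inv1.2) (Real.exp_pos _) (by linarith) (le_max_left _ _) Gm Gd ai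
    (fun y hy hyY => by
      have h1 := (Gl y hy).1
      have h2 := hY0 (y + -(1/T)) (by have := (le_max_right 0 (Y0+1)).trans hyY; linarith)
      have h3 := (abs_le.1 h2).1
      nlinarith)
  have P2 := hden (fun v => -fF v) T (1/T) (Real.exp (-(C * T^3))) (2 * A) (max 0 (Y0 + 1)) G fF_meas.neg (fun _ => by ring) T1
    (by rw [abs_of_nonneg inv1.1]; exact inv1.2) (Real.exp_pos _) (by linarith) (le_max_left _ _) Gm Gd
    (fun y => (ai y).neg.congr (ae_of_all _ fun v => by simp))
    (fun y hy hyY => by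
      have h1 := (Gl y hy).2
      have h2 := hY0 (y + 1/T) (by have := (le_max_right 0 (Y0+1)).trans hyY; linarith)
      have h3 := (abs_le.1 h2).2
      simp_rw [neg_mul]
      rw [integral_neg]
      nlinarith)
  filter_upwards [P1, P2, eventually_ge_atTop 0] with Y h1 h2 hY
  rw [show 2 * A / 2 = A by ring] at h1 h2
  have e : {v | A < -fF v} = {v | fF v < -A} := by ext v; simp only [Set.mem_setOf_eq]; constructor <;> intro h <;> linarith
  rw [e] at h2
  exact ⟨fin (δ := 0) hY h1, fin (δ := 0) hY h2⟩

end RS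

namespace RS

lemma betaZeta_eq (hRH : RHyp) : betaZeta = 1/2 := by
  obtain ⟨C, hC, h⟩ := count_lower hRH
  have hne : ∃ γ, riemannZeta₁ (rp γ) = 0 := by
    by_contra hcon
    push Not at hcon
    set T := 4 * Real.exp (16 * C + 1) with hT
    have e1 : 1 ≤ Real.exp (16 * C + 1) := Real.one_le_exp (by positivity)
    have h1 := h T (by linarith)
    have h2 : zs (-T) T = ∅ := by
      ext γ; simp only [Finset.notMem_empty, iff_false]
      intro hγ; exact hcon γ (mem_zs.1 hγ).2
    rw [h2, Finset.sum_empty, mul_zero] at h1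
    have h3 : Real.log (T/4) = 16 * C + 1 := by
      rw [hT, mul_div_cancel_left₀ _ (by norm_num), Real.log_exp]
    rw [h3] at h1
    have : 0 < T := by positivity
    nlinarith
  obtain ⟨γ, hγ⟩ := hne
  have hz : riemannZeta (rp γ) = 0 := by
    have h1 : rp γ ≠ 1 := by
      intro h; have := congrArg Complex.re h; rw [rp_re, Complex.one_re] at this; norm_num at this
    rw [zeta1_eq_of_ne h1] at hγ
    rcases mul_eq_zero.1 hγ with h2 | h2
    · exact absurd (sub_eq_zero.1 h2) h1
    · exact h2
  have : {b : ℝ | ∃ ρ : ℂ, riemannZeta ρ = 0 ∧ 0 < ρ.re ∧ ρ.re < 1 ∧ ρ.re = b} = {1/2} := by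
    ext b
    simp only [Set.mem_ofPred_eq, Set.mem_singleton_iff]
    constructor
    · rintro ⟨ρ, h0, h1, h2, rfl⟩; exact hRH ρ h0 h1 h2
    · rintro rfl
      exact ⟨rp γ, hz, by rw [rp_re]; norm_num, by rw [rp_re]; norm_num, rp_re γ⟩
  unfold betaZeta
  rw [this, csSup_singleton]

lemma Li_eq {x : ℝ} (hx : 2 ≤ x) : Li x = x / Real.log x - 2 / Real.log 2 + ∫ t in (2:ℝ)..x, 1 / Real.log t ^ 2 := by
  unfold Li
  have hl : ∀ t ∈ Set.uIcc 2 x, 0 < t ∧ 0 < Real.log t := by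
    intro t ht
    rw [Set.uIcc_of_le hx] at ht
    exact ⟨by linarith [ht.1], Real.log_pos (by linarith [ht.1])⟩
  have i2 := Chebyshev.intervalIntegrable_one_div_log_sq (a := 2) (b := x) (by norm_num) (by linarith)
  have i1 : IntervalIntegrable (fun t => 1 / Real.log t) volume 2 x := by
    refine ContinuousOn.intervalIntegrable fun t ht => ContinuousAt.continuousWithinAt ?_
    have h1 := (hl t ht).1.ne'
    have h2 := (hl t ht).2.ne'
    exact continuousAt_const.div (Real.continuousAt_log h1) h2
  have := intervalIntegral.integral_eq_sub_of_hasDerivAt (a := 2) (b := x) (f := fun t => t / Real.log t) (f' := fun t => 1 / Real.log t - 1 / Real.log t ^ 2)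
    (fun t ht => by
      have h1 := (hl t ht).1.ne'
      have h2 := (hl t ht).2.ne'
      have := (hasDerivAt_id t).div (Real.hasDerivAt_log h1) h2
      refine HasDerivAt.congr_deriv (f := fun t => t / Real.log t) this ?_
      show (1 * Real.log t - t * t⁻¹) / Real.log t ^ 2 = 1 / Real.log t - 1 / Real.log t ^ 2
      field_simp) (i1.sub i2)
  rw [intervalIntegral.integral_sub i1 i2] at this
  linarith

lemma pi_sub_Li {x : ℝ} (hx : 2 ≤ x) : (primeCount x : ℝ) - Li x =
    (Chebyshev.theta x - x) / Real.log x + 2 / Real.log 2 + ∫ t in (2:ℝ)..x, (Chebyshev.theta t - t) / (t * Real.log t ^ 2) := by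
  have h1 : (primeCount x : ℝ) = (Nat.primeCounting ⌊x⌋₊ : ℝ) := by
    unfold primeCount Nat.primeCounting Nat.primeCounting'
    rw [Nat.count_eq_card_filter_range]
  rw [h1, Chebyshev.primeCounting_eq_theta_div_log_add_integral hx, Li_eq hx]
  have i1 : IntervalIntegrable (fun t => Chebyshev.theta t / (t * Real.log t ^ 2)) volume 2 x := by
    rw [intervalIntegrable_iff_integrableOn_Icc_of_le hx]
    exact Chebyshev.integrableOn_theta_div_id_mul_log_sq x
  have i2 := Chebyshev.intervalIntegrable_one_div_log_sq (a := 2) (b := x) (by norm_num) (by linarith)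
  have : ∫ t in (2:ℝ)..x, (Chebyshev.theta t - t) / (t * Real.log t ^ 2) = (∫ t in (2:ℝ)..x, Chebyshev.theta t / (t * Real.log t ^ 2)) - ∫ t in (2:ℝ)..x, 1 / Real.log t ^ 2 := by
    rw [← intervalIntegral.integral_sub i1 i2]
    refine intervalIntegral.integral_congr fun t ht => ?_
    rw [Set.uIcc_of_le hx] at ht
    have t0 : t ≠ 0 := by linarith [ht.1]
    rw [sub_div]
    congr 1
    field_simp
  rw [this]
  ring

lemma theta_sub : ∃ C > 0, ∀ y > 0, |Real.exp (-y/2) * (Chebyshev.theta (Real.exp y) - Real.exp y) - fF y| ≤ C := by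
  obtain ⟨C, h⟩ := Chebyshev.psi_sub_theta_le_mul_sqrt
  refine ⟨|C| + 1, by positivity, fun y hy => ?_⟩
  have h1 := h (Real.exp y)
  have h2 := Chebyshev.theta_le_psi (Real.exp y)
  have e : Real.exp (-y/2) * Real.sqrt (Real.exp y) = 1 := by
    rw [← Real.exp_half, ← Real.exp_add]; rw [show -y/2 + y/2 = 0 by ring, Real.exp_zero]
  unfold fF
  rw [if_pos hy, ← mul_sub, abs_mul, abs_of_pos (Real.exp_pos _)]
  rw [show Chebyshev.theta (Real.exp y) - Real.exp y - (Chebyshev.psi (Real.exp y) - Real.exp y) = -(Chebyshev.psi (Real.exp y) - Chebyshev.theta (Real.exp y)) by ring, abs_neg, abs_of_nonneg (by linarith)]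
  calc Real.exp (-y/2) * (Chebyshev.psi (Real.exp y) - Chebyshev.theta (Real.exp y)) ≤ Real.exp (-y/2) * (C * Real.sqrt (Real.exp y)) := by gcongr
    _ = C := by rw [mul_left_comm, e, mul_one]
    _ ≤ |C| + 1 := by linarith [le_abs_self C]

lemma image_exp_Ioc {a b : ℝ} : Real.exp '' Set.Ioc a b = Set.Ioc (Real.exp a) (Real.exp b) := by
  ext x; constructor
  · rintro ⟨y, hy, rfl⟩
    exact ⟨Real.exp_lt_exp.2 hy.1, Real.exp_le_exp.2 hy.2⟩
  · intro hx
    have hx' : 0 < x := (Real.exp_pos a).trans hx.1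
    exact ⟨Real.log x, ⟨(Real.lt_log_iff_exp_lt hx').2 hx.1, (Real.log_le_iff_le_exp hx').2 hx.2⟩, Real.exp_log hx'⟩

lemma J_bound (hRH : RHyp) : ∃ C > 0, ∀ y ≥ 1, |∫ t in (2:ℝ)..Real.exp y, (Chebyshev.theta t - t) / (t * Real.log t ^ 2)| ≤ C * (Real.exp (y/2) / y) := by
  obtain ⟨C, hC, hL⟩ := fF_L2 hRH
  obtain ⟨C1, hC1, hth⟩ := theta_sub
  refine ⟨64 * (C + C1 + 1), by positivity, fun y hy => ?_⟩
  have l2 : Real.log 2 ≤ y := by have := Real.log_two_lt_d9; linarith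
  have l2' : 1/2 < Real.log 2 := by have := Real.log_two_gt_d9; linarith
  have h2 : (2:ℝ) = Real.exp (Real.log 2) := (Real.exp_log (by norm_num)).symm
  have h2y : (2:ℝ) ≤ Real.exp y := by rw [h2]; exact Real.exp_le_exp.2 l2
  rw [intervalIntegral.integral_of_le h2y]
  have him : Set.Ioc (2:ℝ) (Real.exp y) = Real.exp '' Set.Ioc (Real.log 2) y := by rw [image_exp_Ioc, ← h2]
  rw [him, integral_image_eq_integral_abs_deriv_smul measurableSet_Ioc (fun x _ => (Real.hasDerivAt_exp x).hasDerivWithinAt) Real.exp_injective.injOn]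
  rw [← Real.norm_eq_abs]
  refine (norm_integral_le_integral_norm _).trans ?_
  have y0 : 0 < y := by linarith
  set R : ℝ → ℝ := fun v => 64 * (Real.exp (y/2) / y^2) * (fF v ^ 2 + (C1 + 1)) with hR
  have iR : IntegrableOn R (Set.Icc 0 y) :=
    Integrable.const_mul ((fF_sq_locint 0 y).add (integrableOn_const measure_Icc_lt_top.ne)) _
  have R0 : ∀ v, 0 ≤ R v := fun v => by simp only [hR]; positivity
  have sub : Set.Ioc (Real.log 2) y ⊆ Set.Icc 0 y := fun v hv => ⟨by linarith [hv.1], hv.2⟩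
  have pw : ∀ v ∈ Set.Ioc (Real.log 2) y, ‖|Real.exp v| • ((Chebyshev.theta (Real.exp v) - Real.exp v) / (Real.exp v * Real.log (Real.exp v) ^ 2))‖ ≤ R v := by
    intro v hv
    have v0 : 1/2 < v := by linarith [hv.1]
    have vp : 0 < v := by linarith
    have ep := Real.exp_pos v
    have eh : Real.exp v = Real.exp (v/2) * Real.exp (v/2) := by rw [← Real.exp_add]; congr 1; ring
    have en : Real.exp (-v/2) = (Real.exp (v/2))⁻¹ := by rw [← Real.exp_neg]; congr 1; ring
    have e1 : |Real.exp v| • ((Chebyshev.theta (Real.exp v) - Real.exp v) / (Real.exp v * Real.log (Real.exp v) ^ 2)) = (Real.exp (v/2) / v^2) * (Real.exp (-v/2) * (Chebyshev.theta (Real.exp v) - Real.exp v)) := by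
      rw [Real.log_exp, abs_of_pos ep, smul_eq_mul, en]
      field_simp
    rw [e1, Real.norm_eq_abs, abs_mul, abs_of_pos (by positivity)]
    have b1 : |Real.exp (-v/2) * (Chebyshev.theta (Real.exp v) - Real.exp v)| ≤ fF v ^ 2 + (C1 + 1) := by
      have t1 := hth v vp
      have t2 := abs_le_sq1 (fF v)
      have t3 : |Real.exp (-v/2) * (Chebyshev.theta (Real.exp v) - Real.exp v)| ≤ |Real.exp (-v/2) * (Chebyshev.theta (Real.exp v) - Real.exp v) - fF v| + |fF v| := by
        have := abs_add_le (Real.exp (-v/2) * (Chebyshev.theta (Real.exp v) - Real.exp v) - fF v) (fF v)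
        rwa [sub_add_cancel] at this
      nlinarith [sq_nonneg (fF v)]
    have b2 : Real.exp (v/2) / v^2 ≤ 64 * (Real.exp (y/2) / y^2) := by
      have c1 : y / v ≤ 8 * Real.exp ((y - v)/4) := by
        rw [div_le_iff₀ vp]
        have := Real.add_one_le_exp ((y - v)/4)
        have h3 : 8 * ((y - v)/4 + 1) * v ≤ 8 * Real.exp ((y - v)/4) * v := by gcongr
        have := hv.2
        nlinarith
      have c2 : (y / v)^2 ≤ 64 * Real.exp ((y - v)/2) := by
        have : (y / v)^2 ≤ (8 * Real.exp ((y - v)/4))^2 := by gcongr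
        refine this.trans (le_of_eq ?_)
        rw [mul_pow, ← Real.exp_nat_mul]; norm_num; ring
      have c3 : Real.exp (y/2) = Real.exp (v/2) * Real.exp ((y - v)/2) := by rw [← Real.exp_add]; congr 1; ring
      rw [c3]
      calc Real.exp (v/2) / v^2 = Real.exp (v/2) / y^2 * (y / v)^2 := by field_simp
        _ ≤ Real.exp (v/2) / y^2 * (64 * Real.exp ((y - v)/2)) := by gcongr
        _ = _ := by ring
    calc _ ≤ (64 * (Real.exp (y/2) / y^2)) * (fF v ^ 2 + (C1 + 1)) := by gcongr
      _ = _ := rfl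
  calc _ ≤ ∫ v in Set.Ioc (Real.log 2) y, R v := by
        refine integral_mono_of_nonneg (ae_of_all _ fun v => norm_nonneg _) (iR.mono_set sub) ?_
        exact (ae_restrict_iff' measurableSet_Ioc).2 (ae_of_all _ pw)
    _ ≤ ∫ v in Set.Icc 0 y, R v := setIntegral_mono_set iR (ae_of_all _ R0) sub.eventuallyLE
    _ = 64 * (Real.exp (y/2) / y^2) * ((∫ v in Set.Icc 0 y, fF v ^ 2) + (C1 + 1) * y) := by
        simp only [hR]
        rw [integral_const_mul, integral_add (fF_sq_locint 0 y) (integrableOn_const measure_Icc_lt_top.ne), setIntegral_const, smul_eq_mul]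
        congr 2
        simp [y0.le]; ring
    _ ≤ 64 * (Real.exp (y/2) / y^2) * (C * y + (C1 + 1) * y) := by
        gcongr; exact hL y hy
    _ = _ := by field_simp; ring

lemma E_close (hRH : RHyp) : ∃ C > 0, ∀ y ≥ 1, |Ezeta (Real.exp y) - fF y| ≤ C := by
  obtain ⟨C1, hC1, hth⟩ := theta_sub
  obtain ⟨C2, hC2, hJ⟩ := J_bound hRH
  have hl2 : 0 < Real.log 2 := Real.log_pos (by norm_num)
  refine ⟨C1 + (C2 + 4 / Real.log 2), by positivity, fun y hy => ?_⟩
  have y0 : 0 < y := by linarith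
  have h2y : (2:ℝ) ≤ Real.exp y := by have := Real.add_one_le_exp y; linarith
  have en : Real.exp (-y/2) = (Real.exp (y/2))⁻¹ := by rw [← Real.exp_neg]; congr 1; ring
  have ee : Real.exp y ^ (1/2 : ℝ) = Real.exp (y/2) := by rw [← Real.exp_mul]; congr 1; ring
  set J := ∫ t in (2:ℝ)..Real.exp y, (Chebyshev.theta t - t) / (t * Real.log t ^ 2) with hJd
  have e : Ezeta (Real.exp y) - fF y = (Real.exp (-y/2) * (Chebyshev.theta (Real.exp y) - Real.exp y) - fF y) + (y / Real.exp (y/2)) * (J + 2 / Real.log 2) := by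
    unfold Ezeta
    rw [betaZeta_eq hRH, pi_sub_Li h2y, Real.log_exp, ee, en]
    field_simp; ring
  rw [e]
  refine (abs_add_le _ _).trans (add_le_add (hth y y0) ?_)
  rw [abs_mul, abs_of_pos (by positivity)]
  have h1 := hJ y hy
  have h3 : |J + 2 / Real.log 2| ≤ C2 * (Real.exp (y/2) / y) + 2 / Real.log 2 := by
    refine (abs_add_le _ _).trans ?_
    rw [abs_of_pos (show 0 < 2 / Real.log 2 by positivity)]; linarith
  have h4 : y / Real.exp (y/2) ≤ 2 := by
    rw [div_le_iff₀ (Real.exp_pos _)]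
    have := Real.add_one_le_exp (y/2)
    linarith
  calc _ ≤ (y / Real.exp (y/2)) * (C2 * (Real.exp (y/2) / y) + 2 / Real.log 2) := by gcongr
    _ = C2 + (y / Real.exp (y/2)) * (2 / Real.log 2) := by field_simp
    _ ≤ C2 + 2 * (2 / Real.log 2) := by gcongr
    _ = _ := by ring

lemma E_meas : ∃ e : ℝ → ℝ, Measurable e ∧ ∀ y ≥ 1, e y = Ezeta (Real.exp y) := by
  have h1 : Measurable fun x : ℝ => (primeCount x : ℝ) := by
    have : Monotone fun x : ℝ => (primeCount x : ℝ) := by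
      intro x y hxy
      have : primeCount x ≤ primeCount y := by
        unfold primeCount
        refine Finset.card_le_card (Finset.filter_subset_filter _ ?_)
        intro n hn
        rw [Finset.mem_range] at hn ⊢
        have := Nat.floor_mono hxy
        omega
      exact Nat.cast_le.2 this
    exact this.measurable
  have i1 : ∀ a b : ℝ, 2 ≤ a → 2 ≤ b → IntervalIntegrable (fun t => 1 / Real.log t) volume a b := by
    intro a b ha hb
    refine ContinuousOn.intervalIntegrable fun t ht => ContinuousAt.continuousWithinAt ?_
    have ht2 : 2 ≤ t := (le_min ha hb).trans ht.1
    exact continuousAt_const.div (Real.continuousAt_log (by linarith)) (Real.log_pos (by linarith)).ne'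
  have h2 : Monotone fun x : ℝ => Li (max x 2) := by
    intro x y hxy
    have hm : max x 2 ≤ max y 2 := max_le_max_right _ hxy
    have e := intervalIntegral.integral_add_adjacent_intervals (i1 2 (max x 2) le_rfl (le_max_right _ _))
      (i1 (max x 2) (max y 2) (le_max_right _ _) (le_max_right _ _))
    have p : 0 ≤ ∫ t in (max x 2)..(max y 2), 1 / Real.log t := by
      refine intervalIntegral.integral_nonneg hm fun t ht => ?_
      have : 2 ≤ t := (le_max_right _ _).trans ht.1
      have := Real.log_pos (show 1 < t by linarith)
      positivity
    show Li _ ≤ Li _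
    unfold Li
    linarith
  refine ⟨fun y => (Real.log (Real.exp y) / (Real.exp y) ^ betaZeta) * ((primeCount (Real.exp y) : ℝ) - Li (max (Real.exp y) 2)), ?_, ?_⟩
  · have a1 := h1.comp Real.measurable_exp
    have a2 := h2.measurable.comp Real.measurable_exp
    have a3 : Measurable fun y : ℝ => Real.log (Real.exp y) / (Real.exp y) ^ betaZeta := by fun_prop
    exact a3.mul (a1.sub a2)
  · intro y hy
    have : 2 ≤ Real.exp y := by linarith [Real.add_one_le_exp y]
    simp only [max_eq_left this]
    rfl

end RS

namespace RS

lemma low_int {h : ℝ → ℝ} (hm : Measurable h) (h0 : ∀ y, 0 ≤ h y) (h1 : ∀ y, h y ≤ 1) {S : Set ℝ}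
    (hS : MeasurableSet S) (hh : ∀ y ∈ S, 2 ≤ y → 1 ≤ h y) {Y : ℝ} (hY : 2 ≤ Y) :
    volume.real (S ∩ Set.Icc 0 Y) - 2 ≤ ∫ y in (2:ℝ)..Y, h y := by
  have i0 : IntegrableOn h (Set.Ioc 2 Y) volume := by
    refine Measure.integrableOn_of_bounded (M := 1) measure_Ioc_lt_top.ne hm.aestronglyMeasurable ?_
    exact Eventually.of_forall fun y => by rw [Real.norm_eq_abs, abs_of_nonneg (h0 y)]; exact h1 y
  rw [intervalIntegral.integral_of_le hY]
  have a1 : ∫ y in S ∩ Set.Ioc 2 Y, h y ≤ ∫ y in Set.Ioc 2 Y, h y :=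
    setIntegral_mono_set i0 (Eventually.of_forall h0) (Eventually.of_forall Set.inter_subset_right)
  have fin : volume (S ∩ Set.Ioc 2 Y) ≠ ⊤ := ((measure_mono Set.inter_subset_right).trans_lt measure_Ioc_lt_top).ne
  have a2 : volume.real (S ∩ Set.Ioc 2 Y) ≤ ∫ y in S ∩ Set.Ioc 2 Y, h y := by
    have : ∫ y in S ∩ Set.Ioc 2 Y, (1:ℝ) = volume.real (S ∩ Set.Ioc 2 Y) := by
      rw [setIntegral_const]; simp
    rw [← this]
    refine setIntegral_mono_on (integrableOn_const fin) (i0.mono_set Set.inter_subset_right) (hS.inter measurableSet_Ioc) ?_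
    intro y hy
    exact hh y hy.1 hy.2.1.le
  have a3 : volume.real (S ∩ Set.Icc 0 Y) ≤ volume.real (S ∩ Set.Ioc 2 Y) + 2 := by
    have sub : S ∩ Set.Icc 0 Y ⊆ (S ∩ Set.Ioc 2 Y) ∪ Set.Icc 0 2 := by
      rintro y ⟨hy, hy0, hyY⟩
      by_cases h : y ≤ 2
      · exact Or.inr ⟨hy0, h⟩
      · exact Or.inl ⟨hy, not_le.1 h, hyY⟩
    have f2 : volume (Set.Icc (0:ℝ) 2) ≠ ⊤ := measure_Icc_lt_top.ne
    refine (measureReal_mono sub (measure_union_ne_top fin f2)).trans ((measureReal_union_le _ _).trans ?_)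
    simp
  linarith

lemma up_int {h : ℝ → ℝ} (hm : Measurable h) (h0 : ∀ y, 0 ≤ h y) (h1 : ∀ y, h y ≤ 1) {S : Set ℝ}
    (hS : MeasurableSet S) (hh : ∀ y ∈ S, 2 ≤ y → h y ≤ 0) {Y : ℝ} (hY : 2 ≤ Y) :
    ∫ y in (2:ℝ)..Y, h y ≤ Y - volume.real (S ∩ Set.Icc 0 Y) := by
  have := low_int (h := fun y => 1 - h y) (measurable_const.sub hm) (fun y => by linarith [h1 y])
    (fun y => by linarith [h0 y]) hS (fun y hy h2 => by linarith [hh y hy h2]) hY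
  have i0 : IntervalIntegrable h volume 2 Y := by
    rw [intervalIntegrable_iff_integrableOn_Ioc_of_le hY]
    refine Measure.integrableOn_of_bounded (M := 1) measure_Ioc_lt_top.ne hm.aestronglyMeasurable ?_
    exact Eventually.of_forall fun y => by rw [Real.norm_eq_abs, abs_of_nonneg (h0 y)]; exact h1 y
  rw [intervalIntegral.integral_sub intervalIntegrable_const i0, intervalIntegral.integral_const] at this
  simp only [smul_eq_mul, mul_one] at this
  linarith

lemma congr_int {e : ℝ → ℝ} (he : ∀ y ≥ 1, e y = Ezeta (Real.exp y)) (g : ℝ → ℝ) {Y : ℝ} (hY : 2 ≤ Y) :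
    ∫ y in (2:ℝ)..Y, g (Ezeta (Real.exp y)) = ∫ y in (2:ℝ)..Y, g (e y) := by
  refine intervalIntegral.integral_congr fun y hy => ?_
  rw [Set.uIcc_of_le hY] at hy
  show g _ = g _
  rw [he y (by linarith [hy.1])]

/-- The truncated distance from the interval. -/
def gT (A x : ℝ) : ℝ := min 1 (max 0 (|x| - A))

lemma gT_nonneg (A x : ℝ) : 0 ≤ gT A x := le_min zero_le_one (le_max_left _ _)
lemma gT_le (A x : ℝ) : gT A x ≤ 1 := min_le_left _ _

lemma gT_lip (A : ℝ) : LipschitzWith 1 (gT A) := by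
  have h1 : LipschitzWith 1 fun x : ℝ => |x| - A := by
    refine LipschitzWith.of_dist_le_mul fun x y => ?_
    rw [Real.dist_eq, Real.dist_eq, NNReal.coe_one, one_mul]
    have := abs_abs_sub_abs_le x y
    simpa using this
  exact (h1.const_max 0).const_min 1

lemma mu_bound (hRH : RHyp) {μ : Measure ℝ} (hμ : HasLimitingLogDistribution Ezeta μ) :
    ∃ c > (0:ℝ), ∃ K > (0:ℝ), ∃ A₀ : ℝ, ∀ A ≥ A₀,
      ENNReal.ofReal (K * Real.exp (-Real.exp (c * A))) ≤ μ ((Set.Icc (-A) A)ᶜ) := by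
  obtain ⟨c, hc, K, hK, A₀, hA⟩ := dens_final hRH
  obtain ⟨C, hC, hE⟩ := E_close hRH
  obtain ⟨e, em, he⟩ := E_meas
  have := hμ.1
  refine ⟨2 * c, by positivity, K / 2, by positivity, max A₀ (C + 1), fun A hA1 => ?_⟩
  have hA0 : A₀ ≤ A := (le_max_left _ _).trans hA1
  have hAC : C + 1 ≤ A := (le_max_right _ _).trans hA1
  have key := hA (A + C + 1) (by linarith)
  set κ := K * Real.exp (-Real.exp (c * (A + C + 1))) with hκ
  have κpos : 0 < κ := by positivity
  have lim := hμ.2 (gT A) ⟨1, gT_lip A⟩ ⟨1, fun x => by rw [abs_of_nonneg (gT_nonneg A x)]; exact gT_le A x⟩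
  have low : κ / 2 ≤ ∫ t, gT A t ∂μ := by
    refine ge_of_tendsto lim ?_
    filter_upwards [key, eventually_ge_atTop 2, eventually_ge_atTop (4 / κ)] with Y hk hY hY2
    rw [congr_int he _ hY]
    have := low_int (h := fun y => gT A (e y)) ((gT_lip A).continuous.measurable.comp em) (fun y => gT_nonneg _ _)
      (fun y => gT_le _ _) (S := {v | A + C + 1 < fF v}) (measurableSet_lt measurable_const fF_meas)
      (fun y hy h2 => by
        have h3 := abs_le.1 (hE y (by linarith))
        have h4 : A + C + 1 < fF y := hy
        rw [he y (by linarith)]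
        refine le_min le_rfl ((le_max_right _ _).trans' ?_)
        have := le_abs_self (Ezeta (Real.exp y))
        linarith) hY
    rw [div_le_iff₀ κpos] at hY2
    rw [one_div, inv_mul_eq_div, le_div_iff₀ (by linarith)]
    have := hk.1
    linarith
  have up : ∫ t, gT A t ∂μ ≤ μ.real ((Set.Icc (-A) A)ᶜ) := by
    have ms : MeasurableSet ((Set.Icc (-A) A)ᶜ) := measurableSet_Icc.compl
    rw [← integral_indicator_one ms]
    refine integral_mono_of_nonneg (Eventually.of_forall (gT_nonneg A)) ((integrable_const (1:ℝ)).indicator ms) (Eventually.of_forall fun x => ?_)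
    by_cases hx : x ∈ (Set.Icc (-A) A)ᶜ
    · rw [Set.indicator_of_mem hx]; exact gT_le A x
    · rw [Set.indicator_of_notMem hx]
      have h1 : |x| ≤ A := abs_le.2 (not_not.1 hx)
      refine (min_le_right _ _).trans (max_le le_rfl (by linarith))
  rw [ENNReal.ofReal_le_iff_le_toReal (measure_ne_top _ _)]
  refine le_trans ?_ (low.trans up)
  have h5 : Real.exp (c * (A + C + 1)) ≤ Real.exp (2 * c * A) := by
    apply Real.exp_le_exp.2
    nlinarith
  have h6 : Real.exp (-Real.exp (2 * c * A)) ≤ Real.exp (-Real.exp (c * (A + C + 1))) :=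
    Real.exp_le_exp.2 (by linarith)
  have := mul_le_mul_of_nonneg_left h6 hK.le
  rw [hκ]
  linarith

lemma ll_bound (hRH : RHyp) :
    (0 < liminf (fun Y : ℝ => (1 / Y) *
        ∫ y in (2:ℝ)..Y, (if 0 ≤ Ezeta (Real.exp y) then (1:ℝ) else 0)) atTop ∧
      liminf (fun Y : ℝ => (1 / Y) *
        ∫ y in (2:ℝ)..Y, (if 0 ≤ Ezeta (Real.exp y) then (1:ℝ) else 0)) atTop ≤
      limsup (fun Y : ℝ => (1 / Y) *
        ∫ y in (2:ℝ)..Y, (if 0 ≤ Ezeta (Real.exp y) then (1:ℝ) else 0)) atTop ∧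
      limsup (fun Y : ℝ => (1 / Y) *
        ∫ y in (2:ℝ)..Y, (if 0 ≤ Ezeta (Real.exp y) then (1:ℝ) else 0)) atTop < 1) := by
  obtain ⟨c, hc, K, hK, A₀, hA⟩ := dens_final hRH
  obtain ⟨C, hC, hE⟩ := E_close hRH
  obtain ⟨e, em, he⟩ := E_meas
  have key := hA (max A₀ C) (le_max_left _ _)
  have hAC : C ≤ max A₀ C := le_max_right _ _
  set A := max A₀ C
  set κ := K * Real.exp (-Real.exp (c * A)) with hκ
  have κpos : 0 < κ := by positivity
  set u := fun Y : ℝ => (1 / Y) *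
        ∫ y in (2:ℝ)..Y, (if 0 ≤ Ezeta (Real.exp y) then (1:ℝ) else 0) with hu
  have hm : Measurable fun y => if 0 ≤ e y then (1:ℝ) else 0 :=
    Measurable.ite (measurableSet_le measurable_const em) measurable_const measurable_const
  have m0 : ∀ y, 0 ≤ (if 0 ≤ e y then (1:ℝ) else 0) := fun y => by split_ifs <;> norm_num
  have m1 : ∀ y, (if 0 ≤ e y then (1:ℝ) else 0) ≤ 1 := fun y => by split_ifs <;> norm_num
  have ev : ∀ᶠ Y in atTop, κ / 2 ≤ u Y ∧ u Y ≤ 1 - κ := by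
    filter_upwards [key, eventually_ge_atTop 2, eventually_ge_atTop (4 / κ)] with Y hk hY hY2
    have e1 := congr_int he (fun x => if 0 ≤ x then (1:ℝ) else 0) hY
    simp only [hu]
    rw [e1]
    have l := low_int hm m0 m1 (S := {v | A < fF v}) (measurableSet_lt measurable_const fF_meas)
      (fun y hy h2 => by
        have h3 := abs_le.1 (hE y (by linarith))
        have h4 : A < fF y := hy
        rw [he y (by linarith), if_pos (by linarith)]) hY
    have p := up_int hm m0 m1 (S := {v | fF v < -A}) (measurableSet_lt fF_meas measurable_const)
      (fun y hy h2 => by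
        have h3 := abs_le.1 (hE y (by linarith))
        have h4 : fF y < -A := hy
        rw [he y (by linarith), if_neg (by push Not; linarith)]) hY
    rw [div_le_iff₀ κpos] at hY2
    have k1 := hk.1
    have k2 := hk.2
    rw [one_div, inv_mul_eq_div, le_div_iff₀ (by linarith), div_le_iff₀ (by linarith)]
    constructor <;> linarith
  have b1 : IsBoundedUnder (· ≤ ·) atTop u := isBoundedUnder_of_eventually_le (a := 1 - κ) (ev.mono fun _ h => h.2)
  have b2 : IsBoundedUnder (· ≥ ·) atTop u := isBoundedUnder_of_eventually_ge (a := κ / 2) (ev.mono fun _ h => h.1)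
  refine ⟨?_, liminf_le_limsup b1 b2, ?_⟩
  · have := le_liminf_of_le b1.isCoboundedUnder_ge (ev.mono fun _ h => h.1)
    linarith
  · have := limsup_le_of_le b2.isCoboundedUnder_le (ev.mono fun _ h => h.2)
    linarith

end RS

/-- Under RH, `μ_ζ(ℝ ∖ [−A,A]) ≫ exp(−exp(cA))`; in particular the logarithmic density
of `{x : π(x) ≥ Li(x)}` has `0 < liminf ≤ limsup < 1`. -/
theorem stmt13
    (hRH : ∀ ρ : ℂ, riemannZeta ρ = 0 → 0 < ρ.re → ρ.re < 1 → ρ.re = 1 / 2)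
    (μ : Measure ℝ) (hμ : HasLimitingLogDistribution Ezeta μ) :
    (∃ c > (0:ℝ), ∃ K > (0:ℝ), ∃ A₀ : ℝ, ∀ A ≥ A₀,
      ENNReal.ofReal (K * Real.exp (-Real.exp (c * A))) ≤ μ ((Set.Icc (-A) A)ᶜ)) ∧
    (0 < liminf (fun Y : ℝ => (1 / Y) *
        ∫ y in (2:ℝ)..Y, (if 0 ≤ Ezeta (Real.exp y) then (1:ℝ) else 0)) atTop ∧
      liminf (fun Y : ℝ => (1 / Y) *
        ∫ y in (2:ℝ)..Y, (if 0 ≤ Ezeta (Real.exp y) then (1:ℝ) else 0)) atTop ≤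
      limsup (fun Y : ℝ => (1 / Y) *
        ∫ y in (2:ℝ)..Y, (if 0 ≤ Ezeta (Real.exp y) then (1:ℝ) else 0)) atTop ∧
      limsup (fun Y : ℝ => (1 / Y) *
        ∫ y in (2:ℝ)..Y, (if 0 ≤ Ezeta (Real.exp y) then (1:ℝ) else 0)) atTop < 1) := by
  exact ⟨RS.mu_bound hRH hμ, RS.ll_bound hRH⟩
end
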